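/- Let f_1, …, f_r be E-functions and let α be a nonzero algebraic number. For every homogeneous polynomial P ∈ ℚ̄[X_1,…,X_r] with P(f_1(α),…,f_r(α)) = 0, there exist integers m_1,…,m_r ≥ 1 and a polynomial Q ∈ ℚ̄[z, (X_{i,j})_{1≤i≤r, 0≤j<m_i}], homogeneous in the variables X_{i,j}, such that Q(z, (f_i^{(j)}(z))_{1≤i≤r, 0≤j<m_i}) = 0 identically and Q(α, (X_{i,j})) = P(X_{1,0},…,X_{r,0}). In particular, every homogeneous algebraic relation over ℚ̄ among f_1(α),…,f_r(α) that is not banal is obtained by degeneration at α of a homogeneous δ-algebraic relation among f_1,…,f_r. -/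

import Mathlib

noncomputable section

/-- The derivative `d/dz` of a formal power series over `ℂ`. -/
def psD (f : PowerSeries ℂ) : PowerSeries ℂ :=
  PowerSeries.mk fun n => ((n : ℂ) + 1) * PowerSeries.coeff (n + 1) f

/-- The Mahler operator `σ_q : f(z) ↦ f(z^q)` on formal power series over `ℂ`. -/
def psSigma (q : ℕ) (f : PowerSeries ℂ) : PowerSeries ℂ :=
  PowerSeries.mk fun n => if q ∣ n then PowerSeries.coeff (n / q) f else 0

/-- The canonical embedding of polynomials into power series. -/
def polyPS : Polynomial ℂ →+* PowerSeries ℂ := Polynomial.coeToPowerSeries.ringHom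

/-- The power series `∑ (a n / n!) zⁿ` attached to a sequence `a` of coefficients. -/
def ePS (a : ℕ → ℂ) : PowerSeries ℂ := PowerSeries.mk fun n => a n / (n.factorial : ℂ)

/-- `IsE a` : the power series `∑ (a n / n!) zⁿ` is an E-function: its coefficients are
algebraic, it satisfies a nonzero linear differential equation over `ℚ̄[z]`, and the size of
the conjugates of the `a n` as well as their common denominators grow at most geometrically. -/
def IsE (a : ℕ → ℂ) : Prop :=
  (∀ n, IsAlgebraic ℚ (a n)) ∧
  (∃ (m : ℕ) (p : ℕ → Polynomial ℂ),
      (∀ i k, IsAlgebraic ℚ ((p i).coeff k)) ∧ (∃ i, i ≤ m ∧ p i ≠ 0) ∧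
      ∑ i ∈ Finset.range (m + 1), polyPS (p i) * psD^[i] (ePS a) = 0) ∧
  (∃ C : ℝ, 0 < C ∧ ∃ d : ℕ → ℕ, ∀ n : ℕ, 1 ≤ n →
      1 ≤ d n ∧ (d n : ℝ) ≤ C ^ n ∧
      (∀ σ : (integralClosure ℚ ℂ) →+* ℂ, ∀ h : a n ∈ integralClosure ℚ ℂ,
        ‖σ ⟨a n, h⟩‖ ≤ C ^ n) ∧
      (∀ i, 1 ≤ i → i ≤ n → IsIntegral ℤ ((d n : ℂ) * a i)))

/-- The value at `α` of the E-function with coefficient sequence `a`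
(E-functions are entire, so this series converges for all `α`). -/
def evalE (a : ℕ → ℂ) (α : ℂ) : ℂ := ∑' n : ℕ, a n / (n.factorial : ℂ) * α ^ n

/-- `IsM q f` : the formal power series `f` is an M_q-function, i.e. it has algebraic
coefficients and satisfies a linear `σ_q`-difference equation over `ℚ̄[z]` with
not-all-zero polynomial coefficients. -/
def IsM (q : ℕ) (f : PowerSeries ℂ) : Prop :=
  (∀ n, IsAlgebraic ℚ (PowerSeries.coeff n f)) ∧
  ∃ (m : ℕ) (p : ℕ → Polynomial ℂ),
    (∀ i k, IsAlgebraic ℚ ((p i).coeff k)) ∧ (∃ i, i ≤ m ∧ p i ≠ 0) ∧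
    ∑ i ∈ Finset.range (m + 1), polyPS (p i) * (psSigma q)^[i] f = 0

/-- `MahlerValue f α v` : the meromorphic extension of (the sum of) the power series `f`
to the open unit disk has no pole at `α` and takes the value `v` there. -/
def MahlerValue (f : PowerSeries ℂ) (α v : ℂ) : Prop :=
  ∃ F : ℂ → ℂ, MeromorphicOn F (Metric.ball (0 : ℂ) 1) ∧
    (∀ᶠ z in nhds (0 : ℂ), HasSum (fun n => PowerSeries.coeff n f * z ^ n) (F z)) ∧
    AnalyticAt ℂ F α ∧ F α = v

/-- The power series `f` converges (hence defines an analytic function) on the open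
disk `D(0,R)`. -/
def AnOnBall (f : PowerSeries ℂ) (R : ℝ) : Prop :=
  ∀ z : ℂ, ‖z‖ < R → Summable fun n => PowerSeries.coeff n f * z ^ n

/-- The value at `z` of (the sum of) the power series `f`. -/
def psEval (f : PowerSeries ℂ) (z : ℂ) : ℂ := ∑' n : ℕ, PowerSeries.coeff n f * z ^ n

/-- `Banal fv α P` : the homogeneous algebraic relation `P` among the values at `α` of the
power series `fv 1, …, fv r` is banal: it is the specialization at `z = α` of some
`Q ∈ ℚ̄[z, X₁, …, X_r]`, homogeneous in `X₁, …, X_r`, with `Q(z, fv 1, …, fv r) = 0`. -/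
def Banal {r : ℕ} (fv : Fin r → PowerSeries ℂ) (α : ℂ) (P : MvPolynomial (Fin r) ℂ) : Prop :=
  ∃ Q : MvPolynomial (Fin r) (Polynomial ℂ),
    (∀ v k, IsAlgebraic ℚ ((MvPolynomial.coeff v Q).coeff k)) ∧
    (∃ e, Q.IsHomogeneous e) ∧
    MvPolynomial.eval₂ polyPS fv Q = 0 ∧
    MvPolynomial.map (Polynomial.evalRingHom α) Q = P

/-- `Eset S` : the set of values at `z = 1` of all E-functions with coefficients in `S`. -/
def Eset (S : Set ℂ) : Set ℂ :=
  {x | ∃ a : ℕ → ℂ, IsE a ∧ (∀ n, a n ∈ S) ∧ x = evalE a 1}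

/-- `Mset q α S` : the set of values at `α` of all M_q-functions with coefficients in `S`
having no pole at `α`. -/
def Mset (q : ℕ) (α : ℂ) (S : Set ℂ) : Set ℂ :=
  {x | ∃ f : PowerSeries ℂ, IsM q f ∧ (∀ n, PowerSeries.coeff n f ∈ S) ∧ MahlerValue f α x}

open PowerSeries

/-- The ring of power series over `ℂ` converging on the whole complex plane. -/
def entirePS : Subalgebra ℂ (PowerSeries ℂ) where
  carrier := {g | ∀ r : ℝ, 0 ≤ r → Summable fun n => ‖coeff n g‖ * r ^ n}
  mul_mem' := by
    intro f g hf hg r hr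
    have h := summable_norm_sum_mul_antidiagonal_of_summable_norm
      (f := fun n => ‖coeff n f‖ * r ^ n) (g := fun n => ‖coeff n g‖ * r ^ n)
      ((hf r hr).norm) ((hg r hr).norm)
    refine Summable.of_nonneg_of_le (fun n => by positivity) (fun n => ?_) h
    rw [coeff_mul, Real.norm_eq_abs]
    refine le_trans ?_ (le_abs_self _)
    rw [show (∑ kl ∈ Finset.HasAntidiagonal.antidiagonal n, ‖coeff kl.1 f‖ * r ^ kl.1 * (‖coeff kl.2 g‖ * r ^ kl.2))
      = (∑ kl ∈ Finset.HasAntidiagonal.antidiagonal n, ‖coeff kl.1 f * coeff kl.2 g‖) * r ^ n from ?_]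
    · gcongr
      exact norm_sum_le _ _
    · rw [Finset.sum_mul]
      refine Finset.sum_congr rfl fun kl hkl => ?_
      rw [← Finset.HasAntidiagonal.mem_antidiagonal.mp hkl, pow_add, norm_mul]
      ring
  add_mem' := by
    intro f g hf hg r hr
    refine Summable.of_nonneg_of_le (fun n => by positivity) (fun n => ?_) ((hf r hr).add (hg r hr))
    rw [map_add, ← add_mul]
    gcongr
    exact norm_add_le _ _
  algebraMap_mem' := by
    intro c r hr
    refine summable_of_ne_finset_zero (s := {0}) fun n hn => ?_
    have : n ≠ 0 := by simpa using hn
    simp [coeff_C, this]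

theorem mem_entirePS {g : PowerSeries ℂ} :
    g ∈ entirePS ↔ ∀ r : ℝ, 0 ≤ r → Summable fun n => ‖coeff n g‖ * r ^ n := Iff.rfl

theorem polynomial_mem_entirePS (p : Polynomial ℂ) : (p : PowerSeries ℂ) ∈ entirePS := by
  intro r hr
  refine summable_of_ne_finset_zero (s := p.support) fun n hn => ?_
  simp only [Polynomial.coeff_coe]
  rw [Polynomial.notMem_support_iff.mp hn]; simp

theorem derivative_mem_entirePS {g : PowerSeries ℂ} (hg : g ∈ entirePS) :
    d⁄dX ℂ g ∈ entirePS := by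
  intro r hr
  have h := (summable_nat_add_iff 1).mpr (hg (2 * (r + 1)) (by positivity))
  refine Summable.of_nonneg_of_le (fun n => by positivity) (fun n => ?_) h
  rw [coeff_derivative, norm_mul, mul_assoc]
  gcongr
  rw [mul_pow]
  have h1 : ‖((n : ℂ) + 1)‖ ≤ 2 ^ (n + 1) := by
    have : ((n : ℂ) + 1) = ((n + 1 : ℕ) : ℂ) := by push_cast; ring
    rw [this, Complex.norm_natCast]
    exact_mod_cast (Nat.lt_two_pow_self (n := n + 1)).le
  have h2 : r ^ n ≤ (r + 1) ^ (n + 1) :=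
    (pow_le_pow_left₀ hr (by linarith) n).trans (pow_le_pow_right₀ (by linarith) (by omega))
  gcongr

theorem iterate_derivative_mem_entirePS {g : PowerSeries ℂ} (hg : g ∈ entirePS) (k : ℕ) :
    (d⁄dX ℂ)^[k] g ∈ entirePS := by
  induction k with
  | zero => exact hg
  | succ k ih => rw [Function.iterate_succ_apply']; exact derivative_mem_entirePS ih

theorem summable_norm_psEval {g : PowerSeries ℂ} (hg : g ∈ entirePS) (z : ℂ) :
    Summable fun n => ‖coeff n g * z ^ n‖ := by
  simpa [norm_mul, norm_pow] using hg ‖z‖ (norm_nonneg z)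

theorem psEval_add {f g : PowerSeries ℂ} (hf : f ∈ entirePS) (hg : g ∈ entirePS) (z : ℂ) :
    psEval (f + g) z = psEval f z + psEval g z := by
  unfold psEval
  rw [← (summable_norm_psEval hf z).of_norm.tsum_add (summable_norm_psEval hg z).of_norm]
  simp [add_mul]

theorem psEval_mul {f g : PowerSeries ℂ} (hf : f ∈ entirePS) (hg : g ∈ entirePS) (z : ℂ) :
    psEval (f * g) z = psEval f z * psEval g z := by
  unfold psEval
  rw [tsum_mul_tsum_eq_tsum_sum_antidiagonal_of_summable_norm (summable_norm_psEval hf z)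
    (summable_norm_psEval hg z)]
  refine tsum_congr fun n => ?_
  rw [coeff_mul, Finset.sum_mul]
  refine Finset.sum_congr rfl fun kl hkl => ?_
  rw [← Finset.HasAntidiagonal.mem_antidiagonal.mp hkl, pow_add]
  ring

theorem psEval_coe (p : Polynomial ℂ) (z : ℂ) : psEval (p : PowerSeries ℂ) z = p.eval z := by
  unfold psEval
  rw [tsum_eq_sum (s := p.support), Polynomial.eval_eq_sum, Polynomial.sum]
  · simp
  · intro n hn
    simp only [Polynomial.coeff_coe]
    rw [Polynomial.notMem_support_iff.mp hn]; simp

theorem psEval_C (c z : ℂ) : psEval (C c) z = c := by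
  simpa using psEval_coe (Polynomial.C c) z

theorem hasDerivAt_psEval {g : PowerSeries ℂ} (hg : g ∈ entirePS) (z : ℂ) :
    HasDerivAt (psEval g) (psEval (d⁄dX ℂ g) z) z := by
  set R : ℝ := ‖z‖ + 1 with hR
  have hR0 : 0 ≤ R := by positivity
  have hd := derivative_mem_entirePS hg
  have hu : Summable fun n : ℕ => ‖coeff n g‖ * (n * R ^ (n - 1)) := by
    rw [← summable_nat_add_iff 1]
    refine (hd R hR0).congr fun n => ?_
    rw [coeff_derivative, norm_mul]
    have : ((n : ℂ) + 1) = ((n + 1 : ℕ) : ℂ) := by push_cast; ring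
    rw [this, Complex.norm_natCast]
    simp [mul_assoc]
  have key := hasDerivAt_tsum_of_isPreconnected (𝕜 := ℂ) (F := ℂ)
    (g := fun n z => coeff n g * z ^ n)
    (g' := fun n z => coeff n g * (n * z ^ (n - 1))) (t := Metric.ball 0 R) (y₀ := 0) (y := z)
    hu Metric.isOpen_ball (convex_ball 0 R).isPreconnected
    (fun n y _ => (hasDerivAt_pow n y).const_mul _)
    (fun n y hy => ?_) (by simp [R]; positivity) (summable_norm_psEval hg 0).of_norm (by simp [R])
  · have h2 : (∑' n : ℕ, coeff n g * (n * z ^ (n - 1))) = psEval (d⁄dX ℂ g) z := by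
      rw [Summable.tsum_eq_zero_add]
      · unfold psEval
        simp only [Nat.cast_zero, zero_mul, mul_zero, zero_add]
        refine tsum_congr fun n => ?_
        rw [coeff_derivative]
        simp [mul_assoc]
      · refine Summable.of_norm_bounded hu fun n => ?_
        rw [norm_mul, norm_mul, norm_pow, Complex.norm_natCast]
        gcongr
        simp [R]
    rw [h2] at key
    exact key
  · rw [norm_mul, norm_mul, norm_pow, Complex.norm_natCast]
    have : ‖y‖ ≤ R := by simpa using (Metric.mem_ball.mp hy).le
    gcongr

theorem differentiable_psEval {g : PowerSeries ℂ} (hg : g ∈ entirePS) :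
    Differentiable ℂ (psEval g) := fun z => (hasDerivAt_psEval hg z).differentiableAt

theorem iteratedDeriv_psEval {g : PowerSeries ℂ} (hg : g ∈ entirePS) (k : ℕ) :
    iteratedDeriv k (psEval g) = psEval ((d⁄dX ℂ)^[k] g) := by
  induction k with
  | zero => simp
  | succ k ih =>
    rw [iteratedDeriv_succ, ih, Function.iterate_succ_apply']
    funext z
    exact (hasDerivAt_psEval (iterate_derivative_mem_entirePS hg k) z).deriv

theorem psEval_zero_right (g : PowerSeries ℂ) : psEval g 0 = constantCoeff g := by
  unfold psEval
  rw [tsum_eq_single 0]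
  · simp
  · intro n hn; simp [hn]

theorem eq_zero_of_psEval_eq_zero {g : PowerSeries ℂ} (hg : g ∈ entirePS)
    (h : ∀ z, psEval g z = 0) : g = 0 := by
  ext k
  have h0 : psEval g = fun _ => 0 := funext h
  have h1 := iteratedDeriv_psEval hg k
  rw [h0] at h1
  have h2 := congrFun h1 0
  rw [psEval_zero_right, constantCoeff_iterate_derivative] at h2
  have h3 : iteratedDeriv k (fun _ : ℂ => (0 : ℂ)) 0 = 0 := by
    rw [iteratedDeriv_const]; split <;> simp
  rw [h3] at h2
  have : (k.factorial : ℂ) ≠ 0 := by exact_mod_cast k.factorial_ne_zero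
  simpa [this] using h2.symm

/-- The Taylor expansion at `1` of an entire power series. -/
def taylorFun (g : PowerSeries ℂ) : PowerSeries ℂ :=
  mk fun k => psEval ((d⁄dX ℂ)^[k] g) 1 / (k.factorial : ℂ)

theorem coeff_taylorFun (g : PowerSeries ℂ) (k : ℕ) :
    coeff k (taylorFun g) = psEval ((d⁄dX ℂ)^[k] g) 1 / (k.factorial : ℂ) := coeff_mk _ _

theorem constantCoeff_taylorFun (g : PowerSeries ℂ) :
    constantCoeff (taylorFun g) = psEval g 1 := by
  rw [← coeff_zero_eq_constantCoeff_apply, coeff_taylorFun]; simp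

theorem derivative_taylorFun (g : PowerSeries ℂ) :
    d⁄dX ℂ (taylorFun g) = taylorFun (d⁄dX ℂ g) := by
  ext k
  rw [coeff_derivative, coeff_taylorFun, coeff_taylorFun, Function.iterate_succ_apply,
    Nat.factorial_succ]
  have : (k.factorial : ℂ) ≠ 0 := by exact_mod_cast k.factorial_ne_zero
  have : (k : ℂ) + 1 ≠ 0 := by exact_mod_cast k.succ_ne_zero
  push_cast
  field_simp

theorem taylorFun_add {f g : PowerSeries ℂ} (hf : f ∈ entirePS) (hg : g ∈ entirePS) :
    taylorFun (f + g) = taylorFun f + taylorFun g := by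
  ext k
  rw [map_add, coeff_taylorFun, coeff_taylorFun, coeff_taylorFun, ← add_div,
    ← psEval_add (iterate_derivative_mem_entirePS hf k) (iterate_derivative_mem_entirePS hg k),
    iterate_map_add]

theorem taylorFun_mul {f g : PowerSeries ℂ} (hf : f ∈ entirePS) (hg : g ∈ entirePS) :
    taylorFun (f * g) = taylorFun f * taylorFun g := by
  suffices H : ∀ (k : ℕ) (f g : PowerSeries ℂ), f ∈ entirePS → g ∈ entirePS →
      coeff k (taylorFun (f * g)) = coeff k (taylorFun f * taylorFun g) by
    ext k; exact H k f g hf hg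
  intro k
  induction k with
  | zero =>
    intro f g hf hg
    rw [coeff_zero_eq_constantCoeff_apply, coeff_zero_eq_constantCoeff_apply, map_mul,
      constantCoeff_taylorFun, constantCoeff_taylorFun, constantCoeff_taylorFun, psEval_mul hf hg]
  | succ k ih =>
    intro f g hf hg
    have hf' := derivative_mem_entirePS hf
    have hg' := derivative_mem_entirePS hg
    have h0 : (k : ℂ) + 1 ≠ 0 := by exact_mod_cast k.succ_ne_zero
    have h1 : coeff k (d⁄dX ℂ (taylorFun (f * g))) =
        coeff k (d⁄dX ℂ (taylorFun f * taylorFun g)) := by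
      rw [derivative_taylorFun, Derivation.leibniz, Derivation.leibniz, smul_eq_mul, smul_eq_mul,
        smul_eq_mul, smul_eq_mul, taylorFun_add (mul_mem hf hg') (mul_mem hg hf'), map_add, map_add,
        ih _ _ hf hg', ih _ _ hg hf', derivative_taylorFun, derivative_taylorFun]
    rw [coeff_derivative, coeff_derivative] at h1
    exact mul_right_cancel₀ h0 h1

theorem iterate_derivative_C_succ (c : ℂ) (k : ℕ) : (d⁄dX ℂ)^[k + 1] (C c) = 0 := by
  rw [Function.iterate_succ_apply, derivative_C, iterate_map_zero]

theorem taylorFun_C (c : ℂ) : taylorFun (C c) = C c := by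
  ext k
  rw [coeff_taylorFun]
  cases k with
  | zero => simp [psEval_C]
  | succ k => rw [iterate_derivative_C_succ, coeff_C]; simp [psEval]

/-- The Taylor expansion at `1`, as an algebra homomorphism. -/
def taylorHom : entirePS →ₐ[ℂ] PowerSeries ℂ where
  toFun g := taylorFun g.1
  map_one' := by
    have := taylorFun_C 1
    rw [map_one] at this; exact this
  map_mul' f g := taylorFun_mul f.2 g.2
  map_zero' := by
    have := taylorFun_C 0
    rw [map_zero] at this; exact this
  map_add' f g := taylorFun_add f.2 g.2
  commutes' c := taylorFun_C c

theorem taylorFun_eq_zero {g : PowerSeries ℂ} (hg : g ∈ entirePS) (h : taylorFun g = 0) :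
    g = 0 := by
  refine eq_zero_of_psEval_eq_zero hg fun z => ?_
  have h1 := Complex.taylorSeries_eq_of_entire' 1 z (differentiable_psEval hg)
  rw [← h1]
  refine (tsum_congr fun n => ?_).trans tsum_zero
  rw [iteratedDeriv_psEval hg]
  have h2 : coeff n (taylorFun g) = 0 := by rw [h]; simp
  rw [coeff_taylorFun, div_eq_mul_inv] at h2
  rw [mul_comm (_⁻¹), h2, zero_mul]

theorem taylorHom_injective : Function.Injective taylorHom := by
  rw [injective_iff_map_eq_zero]
  intro g hg
  exact Subtype.ext (taylorFun_eq_zero g.2 hg)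

theorem taylorFun_X : taylorFun X = X + 1 := by
  have hX : (X : PowerSeries ℂ) ∈ entirePS := by
    simpa using polynomial_mem_entirePS Polynomial.X
  refine derivative.ext ?_ ?_
  · rw [derivative_taylorFun]
    simp only [derivative_X, map_add, derivative_one, add_zero]
    have := taylorFun_C 1
    rwa [map_one] at this
  · rw [constantCoeff_taylorFun]
    have := psEval_coe Polynomial.X 1
    simpa using this

/-- `HasSymbol E σ e`: the operator `E` maps a series `c Xⁿ + ⋯` to `e(n) c Xⁿ⁺ᵟ + ⋯`,
with `δ = σ`. -/
def HasSymbol (E : PowerSeries ℚ → PowerSeries ℚ) (σ : ℕ) (e : Polynomial ℚ) : Prop :=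
  ∀ h n, X ^ n ∣ h → X ^ (n + σ) ∣ E h ∧ coeff (n + σ) (E h) = e.eval (n : ℚ) * coeff n h

theorem HasSymbol.add {E F : PowerSeries ℚ → PowerSeries ℚ} {σ : ℕ} {e f : Polynomial ℚ}
    (hE : HasSymbol E σ e) (hF : HasSymbol F σ f) :
    HasSymbol (fun h => E h + F h) σ (e + f) := by
  intro h n hn
  refine ⟨dvd_add (hE h n hn).1 (hF h n hn).1, ?_⟩
  rw [map_add, (hE h n hn).2, (hF h n hn).2, Polynomial.eval_add, add_mul]

theorem HasSymbol.zero (σ : ℕ) : HasSymbol (fun _ => 0) σ 0 := by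
  intro h n _; simp

theorem HasSymbol.sum {ι : Type*} (s : Finset ι) {E : ι → PowerSeries ℚ → PowerSeries ℚ} {σ : ℕ}
    {e : ι → Polynomial ℚ} (hE : ∀ i ∈ s, HasSymbol (E i) σ (e i)) :
    HasSymbol (fun h => ∑ i ∈ s, E i h) σ (∑ i ∈ s, e i) := by
  classical
  induction s using Finset.induction_on with
  | empty => simpa using HasSymbol.zero σ
  | insert a s ha ih =>
    simp only [Finset.sum_insert ha]
    exact (hE a (by simp)).add (ih fun i hi => hE i (by simp [hi]))

theorem HasSymbol.comp {E F : PowerSeries ℚ → PowerSeries ℚ} {σ τ : ℕ} {e f : Polynomial ℚ}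
    (hE : HasSymbol E σ e) (hF : HasSymbol F τ f) :
    HasSymbol (fun h => E (F h)) (τ + σ) (e.comp (Polynomial.X + Polynomial.C (τ : ℚ)) * f) := by
  intro h n hn
  have h1 := hF h n hn
  have h2 := hE (F h) (n + τ) h1.1
  rw [← add_assoc]
  refine ⟨h2.1, ?_⟩
  rw [h2.2, h1.2]
  simp [mul_assoc]

theorem HasSymbol.mul_left (c : PowerSeries ℚ) (σ : ℕ) (hc : X ^ σ ∣ c) :
    HasSymbol (fun h => c * h) σ (Polynomial.C (coeff σ c)) := by
  intro h n hn
  obtain ⟨c, rfl⟩ := hc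
  obtain ⟨h, rfl⟩ := hn
  have : X ^ σ * c * (X ^ n * h) = X ^ (n + σ) * (c * h) := by rw [pow_add]; ring
  simp only [this]
  refine ⟨dvd_mul_right _ _, ?_⟩
  have e1 : coeff (n + σ) (X ^ (n + σ) * (c * h)) = constantCoeff (c * h) := by
    simpa using coeff_X_pow_mul (c * h) (n + σ) 0
  have e2 : coeff σ (X ^ σ * c) = constantCoeff c := by simpa using coeff_X_pow_mul c σ 0
  have e3 : coeff n (X ^ n * h) = constantCoeff h := by simpa using coeff_X_pow_mul h n 0
  rw [e1, e2, e3]; simp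

theorem coeff_X_pow_mul_iterate_derivative (h : PowerSeries ℚ) (j k : ℕ) :
    coeff k (X ^ j * (d⁄dX ℚ)^[j] h) = (descPochhammer ℚ j).eval (k : ℚ) * coeff k h := by
  rw [descPochhammer_eval_eq_descFactorial, coeff_X_pow_mul']
  split_ifs with hjk
  · rw [coeff_iterate_derivative, Nat.sub_add_cancel hjk]
    have : (k - j + 1).ascFactorial j = k.descFactorial j := by
      rw [Nat.descFactorial_eq_factorial_mul_choose, Nat.ascFactorial_eq_factorial_mul_choose',
        show k - j + 1 + j - 1 = k by omega]
    simp [this]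
  · rw [Nat.descFactorial_eq_zero_iff_lt.mpr (by omega)]; simp

theorem HasSymbol.X_pow_mul_iterate_derivative (j : ℕ) :
    HasSymbol (fun h => X ^ j * (d⁄dX ℚ)^[j] h) 0 (descPochhammer ℚ j) := by
  intro h n hn
  refine ⟨?_, ?_⟩
  · rw [X_pow_dvd_iff] at hn ⊢
    intro m hm
    rw [coeff_X_pow_mul_iterate_derivative, hn m (by simpa using hm), mul_zero]
  · exact coeff_X_pow_mul_iterate_derivative h j n

theorem HasSymbol.congr {E F : PowerSeries ℚ → PowerSeries ℚ} {σ : ℕ} {e : Polynomial ℚ}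
    (hE : HasSymbol E σ e) (h : ∀ x, E x = F x) : HasSymbol F σ e := by
  have : E = F := funext h
  rwa [← this]

theorem exists_eval_natCast_ne_zero {K : Type*} [Field K] [CharZero K] {e : Polynomial K} (he : e ≠ 0) :
    ∃ n₀ : ℕ, ∀ n : ℕ, n₀ ≤ n → e.eval (n : K) ≠ 0 := by
  classical
  have hfin : {n : ℕ | e.eval (n : K) = 0}.Finite := by
    refine Set.Finite.of_injOn (f := fun n : ℕ => (n : K)) (t := (e.roots.toFinset : Set K)) ?_
      (fun a _ b _ h => Nat.cast_injective h) (Finset.finite_toSet _)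
    intro n hn
    simpa [he, Polynomial.IsRoot] using hn
  obtain ⟨b, hb⟩ := hfin.bddAbove
  refine ⟨b + 1, fun n hn h => ?_⟩
  have := hb (show n ∈ {n : ℕ | e.eval (n : K) = 0} from h)
  omega

theorem HasSymbol.unique {E : PowerSeries ℚ → PowerSeries ℚ} {σ τ : ℕ} {e f : Polynomial ℚ}
    (hE : HasSymbol E σ e) (hF : HasSymbol E τ f) (he : e ≠ 0) (hf : f ≠ 0) :
    σ = τ ∧ e = f := by
  have key : ∀ {σ τ : ℕ} {e f : Polynomial ℚ}, HasSymbol E σ e → HasSymbol E τ f → e ≠ 0 →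
      τ ≤ σ := by
    intro σ τ e f hE hF he
    obtain ⟨n, hn⟩ := exists_eval_natCast_ne_zero he
    by_contra! hlt
    have h1 := (hE (X ^ n) n dvd_rfl).2
    have h2 := X_pow_dvd_iff.mp (hF (X ^ n) n dvd_rfl).1 (n + σ) (by omega)
    rw [h2, coeff_X_pow_self, mul_one] at h1
    exact hn n le_rfl h1.symm
  have hστ : σ = τ := le_antisymm (key hF hE hf) (key hE hF he)
  subst hστ
  refine ⟨rfl, ?_⟩
  refine Polynomial.eq_of_infinite_eval_eq e f ?_
  refine Set.Infinite.mono (s := Set.range (fun n : ℕ => (n : ℚ))) ?_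
    (Set.infinite_range_of_injective Nat.cast_injective)
  rintro _ ⟨n, rfl⟩
  have h1 := (hE (X ^ n) n dvd_rfl).2
  have h2 := (hF (X ^ n) n dvd_rfl).2
  rw [coeff_X_pow_self, mul_one] at h1 h2
  exact h1.symm.trans h2

theorem sum_C_mul_descPochhammer_ne_zero {K : Type*} [Field K] [CharZero K] (s : Finset ℕ) (a : ℕ → K) (j : ℕ) (hj : j ∈ s)
    (ha : a j ≠ 0) : ∑ i ∈ s, Polynomial.C (a i) * descPochhammer K i ≠ 0 := by
  intro h
  have hd : ∀ i, (descPochhammer K i).degree = i := fun i => by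
    rw [Polynomial.degree_eq_natDegree (monic_descPochhammer K i).ne_zero,
      descPochhammer_natDegree]
  let S : Polynomial.Sequence K := ⟨fun i => descPochhammer K i, hd⟩
  have hli := S.linearIndependent
  rw [linearIndependent_iff'] at hli
  refine ha (hli s a ?_ j hj)
  simpa [Polynomial.smul_eq_C_mul] using h

theorem exists_hasSymbol (J : ℕ) (c : ℕ → Polynomial ℚ) (hc : ∃ j ≤ J, c j ≠ 0) :
    ∃ (σ : ℕ) (e : Polynomial ℚ), e ≠ 0 ∧
      HasSymbol (fun h => X ^ J * ∑ j ∈ Finset.range (J + 1), (c j : PowerSeries ℚ) * (d⁄dX ℚ)^[j] h)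
        σ e ∧
      ∀ j ≤ J, c j ≠ 0 → σ + j ≤ (c j).natTrailingDegree + J := by
  set c' : ℕ → Polynomial ℚ := fun j => c j * Polynomial.X ^ (J - j) with hc'
  obtain ⟨j₁, hj₁, hcj₁⟩ := hc
  have hne : ((Finset.range (J + 1)).filter fun j => c j ≠ 0).Nonempty :=
    ⟨j₁, by simp [hcj₁]; omega⟩
  obtain ⟨j₀, hj₀, hmin⟩ := Finset.exists_min_image _ (fun j => (c' j).natTrailingDegree) hne
  simp only [Finset.mem_filter, Finset.mem_range] at hj₀ hmin
  have hc'0 : ∀ j, c j ≠ 0 → c' j ≠ 0 := fun j hj => mul_ne_zero hj (by simp)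
  set σ := (c' j₀).natTrailingDegree
  have htd : ∀ j, c j ≠ 0 → (c' j).natTrailingDegree = (c j).natTrailingDegree + (J - j) := by
    intro j hj
    rw [hc']
    simp only
    rw [Polynomial.natTrailingDegree_mul_X_pow hj]
  refine ⟨σ, ∑ j ∈ Finset.range (J + 1), Polynomial.C ((c' j).coeff σ) * descPochhammer ℚ j,
    sum_C_mul_descPochhammer_ne_zero _ _ j₀ (by simpa using hj₀.1) ?_, ?_, ?_⟩
  · have := Polynomial.trailingCoeff_nonzero_iff_nonzero.mpr (hc'0 j₀ hj₀.2)
    exact this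
  · have hterm : ∀ j ∈ Finset.range (J + 1), HasSymbol
        (fun h => (c' j : PowerSeries ℚ) * (X ^ j * (d⁄dX ℚ)^[j] h)) σ
        (Polynomial.C ((c' j).coeff σ) * descPochhammer ℚ j) := by
      intro j hj
      have hdvd : (X : PowerSeries ℚ) ^ σ ∣ (c' j : PowerSeries ℚ) := by
        rw [X_pow_dvd_iff]
        intro m hm
        rw [Polynomial.coeff_coe]
        by_cases h0 : c j = 0
        · simp [hc', h0]
        · exact Polynomial.coeff_eq_zero_of_lt_natTrailingDegree
            (hm.trans_le (hmin j ⟨by simpa using hj, h0⟩))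
      have h1 := (HasSymbol.mul_left (c' j : PowerSeries ℚ) σ hdvd).comp
        (HasSymbol.X_pow_mul_iterate_derivative j)
      simpa using h1
    refine (HasSymbol.sum _ hterm).congr fun h => ?_
    rw [Finset.mul_sum]
    refine Finset.sum_congr rfl fun j hj => ?_
    have hjJ : j ≤ J := by simpa [Nat.lt_succ_iff] using hj
    have : (X : PowerSeries ℚ) ^ J = X ^ (J - j) * X ^ j := by rw [← pow_add]; congr 1; omega
    rw [this, hc']
    simp only [Polynomial.coe_mul, Polynomial.coe_pow, Polynomial.coe_X]
    ring
  · intro j hj hcj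
    have := hmin j ⟨by omega, hcj⟩
    rw [htd j hcj] at this
    omega

section

/-! ### The companion operator on coordinate vectors -/

/-- The value `∑ c_j f^{(j)}` of a vector of polynomial coefficients. -/
def diffVal {s : ℕ} (f : PowerSeries ℚ) (c : Fin (s + 1) → Polynomial ℚ) : PowerSeries ℚ :=
  ∑ j, (c j : PowerSeries ℚ) * (d⁄dX ℚ)^[j] f

/-- The action of `T · d/dX` on coordinate vectors, when `T f^{(s+1)} = ∑ U_j f^{(j)}`. -/
def compOp {s : ℕ} (T : Polynomial ℚ) (U : Fin (s + 1) → Polynomial ℚ)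
    (c : Fin (s + 1) → Polynomial ℚ) : Fin (s + 1) → Polynomial ℚ :=
  fun j => T * Polynomial.derivative (c j) +
    T * Fin.cases (motive := fun _ => Polynomial ℚ) 0 (fun i => c i.castSucc) j +
    U j * c (Fin.last s)

variable {s : ℕ} {T : Polynomial ℚ} {U : Fin (s + 1) → Polynomial ℚ}

theorem compOp_add (c d : Fin (s + 1) → Polynomial ℚ) :
    compOp T U (c + d) = compOp T U c + compOp T U d := by
  funext j
  refine Fin.cases ?_ (fun i => ?_) j <;> simp [compOp] <;> ring

theorem compOp_smul (a : Polynomial ℚ) (c : Fin (s + 1) → Polynomial ℚ) :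
    compOp T U (a • c) = a • compOp T U c + (T * Polynomial.derivative a) • c := by
  funext j
  refine Fin.cases ?_ (fun i => ?_) j <;> simp [compOp] <;> ring

theorem diffVal_compOp {f : PowerSeries ℚ}
    (hT : (T : PowerSeries ℚ) * (d⁄dX ℚ)^[s + 1] f = diffVal f U)
    (c : Fin (s + 1) → Polynomial ℚ) :
    diffVal f (compOp T U c) = (T : PowerSeries ℚ) * d⁄dX ℚ (diffVal f c) := by
  have h1 : (T : PowerSeries ℚ) * d⁄dX ℚ (diffVal f c) =
      ∑ j : Fin (s + 1), (T : PowerSeries ℚ) * (Polynomial.derivative (c j) : Polynomial ℚ) *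
        (d⁄dX ℚ)^[j] f +
      ∑ j : Fin (s + 1), (T : PowerSeries ℚ) * (c j : PowerSeries ℚ) * (d⁄dX ℚ)^[(j : ℕ) + 1] f := by
    rw [diffVal, map_sum, Finset.mul_sum, ← Finset.sum_add_distrib]
    refine Finset.sum_congr rfl fun j _ => ?_
    rw [Derivation.leibniz, derivative_coe, Function.iterate_succ_apply', smul_eq_mul, smul_eq_mul]
    ring
  rw [h1, Fin.sum_univ_castSucc (n := s) (f := fun j : Fin (s + 1) =>
    (T : PowerSeries ℚ) * (c j : PowerSeries ℚ) * (d⁄dX ℚ)^[(j : ℕ) + 1] f)]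
  have h2 : (T : PowerSeries ℚ) * (c (Fin.last s) : PowerSeries ℚ) *
      (d⁄dX ℚ)^[((Fin.last s : Fin (s + 1)) : ℕ) + 1] f =
      ∑ j : Fin (s + 1), ((U j * c (Fin.last s) : Polynomial ℚ) : PowerSeries ℚ) *
        (d⁄dX ℚ)^[j] f := by
    rw [Fin.val_last, mul_right_comm, hT, diffVal, Finset.sum_mul]
    refine Finset.sum_congr rfl fun j _ => ?_
    rw [Polynomial.coe_mul]; ring
  rw [h2]
  have h3 : ∑ i : Fin s, (T : PowerSeries ℚ) * (c i.castSucc : PowerSeries ℚ) *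
      (d⁄dX ℚ)^[((i.castSucc : Fin (s + 1)) : ℕ) + 1] f =
      ∑ j : Fin (s + 1), ((T * Fin.cases (motive := fun _ => Polynomial ℚ) 0
        (fun i => c i.castSucc) j : Polynomial ℚ) : PowerSeries ℚ) * (d⁄dX ℚ)^[j] f := by
    rw [Fin.sum_univ_succ]
    simp
  rw [h3, diffVal, ← Finset.sum_add_distrib, ← Finset.sum_add_distrib]
  refine Finset.sum_congr rfl fun j _ => ?_
  simp only [compOp, Polynomial.coe_add, Polynomial.coe_mul]
  ring

/-! ### Saturated spans -/

/-- The saturation of the span of a family of vectors. -/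
def satSpan (R : Type*) {ι M : Type*} [CommRing R] [IsDomain R] [AddCommGroup M] [Module R M] (v : ι → M) : Submodule R M where
  carrier := {x | ∃ c : R, c ≠ 0 ∧ c • x ∈ Submodule.span R (Set.range v)}
  add_mem' := by
    rintro x y ⟨c, hc, hx⟩ ⟨d, hd, hy⟩
    refine ⟨c * d, mul_ne_zero hc hd, ?_⟩
    rw [smul_add, mul_smul, mul_smul, smul_comm c d x]
    exact add_mem (Submodule.smul_mem _ _ hx) (Submodule.smul_mem _ _ hy)
  zero_mem' := ⟨1, one_ne_zero, by simp⟩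
  smul_mem' := by
    rintro a x ⟨c, hc, hx⟩
    exact ⟨c, hc, by rw [smul_comm]; exact Submodule.smul_mem _ _ hx⟩

theorem mem_satSpan_of_smul {R ι M : Type*} [CommRing R] [IsDomain R] [AddCommGroup M] [Module R M] {v : ι → M}
    {c : R} (hc : c ≠ 0) {x : M} (h : c • x ∈ satSpan R v) : x ∈ satSpan R v := by
  obtain ⟨d, hd, h⟩ := h
  exact ⟨d * c, mul_ne_zero hd hc, by rwa [mul_smul]⟩

theorem subset_satSpan {R ι M : Type*} [CommRing R] [IsDomain R] [AddCommGroup M] [Module R M] (v : ι → M)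
    (i : ι) : v i ∈ satSpan R v := ⟨1, one_ne_zero, by
      rw [one_smul]; exact Submodule.subset_span ⟨i, rfl⟩⟩

theorem card_le_of_mem_satSpan {l p : ℕ} {R M : Type*} [CommRing R] [IsDomain R] [AddCommGroup M] [Module R M]
    {v : Fin l → M} {w : Fin p → M} (hw : ∀ i, w i ∈ satSpan R v)
    (hli : LinearIndependent R w) : p ≤ l := by
  classical
  choose c hc hcw using hw
  have hli' : LinearIndependent R fun i => c i • w i := by
    rw [Fintype.linearIndependent_iff] at hli ⊢
    intro g hg i
    have := hli (fun i => g i * c i) (by simpa [mul_smul] using hg) i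
    exact (mul_eq_zero.mp this).resolve_right (hc i)
  have h1 := linearIndependent_le_span' (fun i => c i • w i) hli' (Set.range v)
    (by rintro _ ⟨i, rfl⟩; exact hcw i)
  have h2 : Fintype.card (Set.range v) ≤ l := by
    simpa using Fintype.card_le_of_surjective (Set.rangeFactorization v)
      Set.rangeFactorization_surjective
  have h3 : (p : Cardinal.{0}) ≤ (Fintype.card (Set.range v) : Cardinal.{0}) := by simpa using h1
  exact (by exact_mod_cast h3 : p ≤ _).trans h2

theorem exists_relation_of_mem_satSpan {l : ℕ} {R M : Type*} [CommRing R] [IsDomain R] [AddCommGroup M]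
    [Module R M] {v : Fin l → M} {w : Fin (l + 1) → M} (hw : ∀ i, w i ∈ satSpan R v) :
    ∃ g : Fin (l + 1) → R, ∑ i, g i • w i = 0 ∧ ∃ i, g i ≠ 0 := by
  by_contra! h
  have : LinearIndependent R w := by
    rw [Fintype.linearIndependent_iff]
    exact h
  have := card_le_of_mem_satSpan hw this
  omega

theorem linearIndependent_of_triangular {p n : ℕ} (w : Fin p → Fin n → Polynomial ℚ)
    (t : Fin p → Fin n) (ht : StrictMono t) (h1 : ∀ k, w k (t k) ≠ 0)
    (h2 : ∀ k j, t k < j → w k j = 0) : LinearIndependent (Polynomial ℚ) w := by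
  rw [Fintype.linearIndependent_iff]
  intro g hg
  by_contra! hne
  obtain ⟨k, hk, hmax⟩ := Finset.exists_max_image (Finset.univ.filter fun k => g k ≠ 0) id
    (by obtain ⟨i, hi⟩ := hne; exact ⟨i, by simpa using hi⟩)
  simp only [Finset.mem_filter, Finset.mem_univ, true_and, id] at hk hmax
  have h3 := congrFun hg (t k)
  rw [Finset.sum_apply, Finset.sum_eq_single k] at h3
  · simp only [Pi.smul_apply, smul_eq_mul, Pi.zero_apply, mul_eq_zero] at h3
    exact h3.elim hk (h1 k)
  · intro i _ hik
    by_cases hgi : g i = 0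
    · simp [hgi]
    · have : i < k := lt_of_le_of_ne (hmax i hgi) hik
      simp [h2 i (t k) (ht this)]
  · simp

theorem compOp_mem_satSpan {l : ℕ} {v : Fin l → Fin (s + 1) → Polynomial ℚ}
    (hv : ∀ i, compOp T U (v i) ∈ satSpan (Polynomial ℚ) v) {x : Fin (s + 1) → Polynomial ℚ}
    (hx : x ∈ satSpan (Polynomial ℚ) v) : compOp T U x ∈ satSpan (Polynomial ℚ) v := by
  have hspan : ∀ y ∈ Submodule.span (Polynomial ℚ) (Set.range v), compOp T U y ∈ satSpan (Polynomial ℚ) v := by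
    intro y hy
    induction hy using Submodule.span_induction with
    | mem y hy => obtain ⟨i, rfl⟩ := hy; exact hv i
    | zero =>
      have : compOp T U (0 : Fin (s + 1) → Polynomial ℚ) = 0 := by
        simpa using compOp_smul (T := T) (U := U) 0 0
      rw [this]; exact zero_mem _
    | add y z _ _ hy hz => rw [compOp_add]; exact add_mem hy hz
    | smul a y hy' hy =>
      rw [compOp_smul]
      refine add_mem (Submodule.smul_mem _ _ hy) (Submodule.smul_mem _ _ ⟨1, one_ne_zero, ?_⟩)
      rwa [one_smul]
  have hx' := hx
  obtain ⟨c, hc, hcx⟩ := hx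
  refine mem_satSpan_of_smul hc ?_
  have := compOp_smul (T := T) (U := U) c x
  rw [eq_comm, ← eq_sub_iff_add_eq] at this
  rw [this]
  exact sub_mem (hspan _ hcx) (Submodule.smul_mem _ _ hx')

/-- Iterates of the companion operator on a vector with top index `m`. -/
theorem compOp_iterate_top (v : Fin (s + 1) → Polynomial ℚ) (m : ℕ) (hm : m ≤ s)
    (hv : ∀ j : Fin (s + 1), m < j → v j = 0) (k : ℕ) (hk : m + k ≤ s) :
    (compOp T U)^[k] v ⟨m + k, by omega⟩ = T ^ k * v ⟨m, by omega⟩ ∧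
      ∀ j : Fin (s + 1), m + k < j → (compOp T U)^[k] v j = 0 := by
  induction k with
  | zero => exact ⟨by simp, fun j hj => hv j (by simpa using hj)⟩
  | succ k ih =>
    obtain ⟨ih1, ih2⟩ := ih (by omega)
    rw [Function.iterate_succ_apply']
    set w := (compOp T U)^[k] v
    have hlast : w (Fin.last s) = 0 := ih2 _ (by simp; omega)
    refine ⟨?_, fun j hj => ?_⟩
    · have e : (⟨m + (k + 1), by omega⟩ : Fin (s + 1)) = Fin.succ ⟨m + k, by omega⟩ := by
        ext; simp; omega
      have e2 : w (Fin.succ ⟨m + k, by omega⟩) = 0 := ih2 _ (by simp)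
      rw [e, compOp, e2, hlast, Fin.cases_succ]
      have e3 : w (Fin.castSucc ⟨m + k, by omega⟩) = T ^ k * v ⟨m, by omega⟩ := ih1
      rw [e3]
      simp [pow_succ]; ring
    · have e1 : w j = 0 := ih2 j (by omega)
      have hj0 : j ≠ 0 := by rintro rfl; simp at hj
      obtain ⟨i, rfl⟩ := Fin.exists_succ_eq.mpr hj0
      have e2 : w i.castSucc = 0 := ih2 _ (by simp at hj ⊢; omega)
      rw [compOp, e1, hlast, Fin.cases_succ, e2]; simp

end

section

variable {s : ℕ} {T : Polynomial ℚ} {U : Fin (s + 1) → Polynomial ℚ}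

theorem natDegree_compOp_le {c₀ n : ℕ} (hT : T.natDegree ≤ c₀) (hU : ∀ j, (U j).natDegree ≤ c₀)
    {c : Fin (s + 1) → Polynomial ℚ} (hc : ∀ j, (c j).natDegree ≤ n) (j : Fin (s + 1)) :
    (compOp T U c j).natDegree ≤ n + c₀ := by
  unfold compOp
  refine Polynomial.natDegree_add_le_of_degree_le (Polynomial.natDegree_add_le_of_degree_le ?_ ?_) ?_
  · refine Polynomial.natDegree_mul_le.trans ?_
    have := Polynomial.natDegree_derivative_le (c j)
    have := hc j
    omega
  · refine Polynomial.natDegree_mul_le.trans ?_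
    refine Fin.cases ?_ (fun i => ?_) j
    · simp; omega
    · have := hc i.castSucc
      simp only [Fin.cases_succ]; omega
  · refine Polynomial.natDegree_mul_le.trans ?_
    have := hc (Fin.last s)
    have := hU j
    omega

theorem natDegree_compOp_iterate_le {c₀ n : ℕ} (hT : T.natDegree ≤ c₀)
    (hU : ∀ j, (U j).natDegree ≤ c₀)
    {c : Fin (s + 1) → Polynomial ℚ} (hc : ∀ j, (c j).natDegree ≤ n) (k : ℕ) (j : Fin (s + 1)) :
    ((compOp T U)^[k] c j).natDegree ≤ n + k * c₀ := by
  induction k generalizing j with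
  | zero => simpa using hc j
  | succ k ih =>
    rw [Function.iterate_succ_apply']
    refine (natDegree_compOp_le hT hU ih j).trans (le_of_eq (by ring))

theorem natDegree_det_le_of_le {l d : ℕ} (A : Matrix (Fin l) (Fin l) (Polynomial ℚ))
    (hA : ∀ i j, (A i j).natDegree ≤ d) : A.det.natDegree ≤ l * d := by
  rw [Matrix.det_apply]
  refine Polynomial.natDegree_sum_le_of_forall_le _ _ fun σ _ => ?_
  refine (Polynomial.natDegree_smul_le _ _).trans ?_
  refine (Polynomial.natDegree_prod_le _ _).trans ?_
  exact (Finset.sum_le_card_nsmul _ _ d fun i _ => hA _ _).trans (by simp)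

theorem exists_reduced_combination {c₀ n : ℕ} (hT0 : T ≠ 0) (hT : T.natDegree ≤ c₀)
    (hU : ∀ j, (U j).natDegree ≤ c₀) {P : Fin (s + 1) → Polynomial ℚ} (hP0 : P ≠ 0)
    (hP : ∀ j, (P j).natDegree ≤ n) :
    ∃ (l m : ℕ) (_ : 1 ≤ l) (hlm : l + m = s + 1) (b : Fin l → Polynomial ℚ)
      (N : Submodule (Polynomial ℚ) (Fin (s + 1) → Polynomial ℚ)),
      (∑ k, b k • (compOp T U)^[k] P) ∈ N ∧ (∀ x ∈ N, compOp T U x ∈ N) ∧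
      (∀ w : Fin (l + 1) → Fin (s + 1) → Polynomial ℚ, (∀ i, w i ∈ N) →
        ∃ g : Fin (l + 1) → Polynomial ℚ, ∑ i, g i • w i = 0 ∧ ∃ i, g i ≠ 0) ∧
      (∑ k, b k • (compOp T U)^[k] P) ⟨m, by omega⟩ ≠ 0 ∧
      ((∑ k, b k • (compOp T U)^[k] P) ⟨m, by omega⟩).natDegree ≤ l * (n + s * c₀) ∧
      ∀ j : Fin (s + 1), m < j → (∑ k, b k • (compOp T U)^[k] P) j = 0 := by
  classical
  set R : ℕ → Fin (s + 1) → Polynomial ℚ := fun k => (compOp T U)^[k] P with hR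
  have hex : ∃ l, ¬ LinearIndependent (Polynomial ℚ) fun k : Fin (l + 1) => R k := by
    refine ⟨s + 1, fun h => ?_⟩
    have := h.fintype_card_le_finrank
    simp at this
  set l := Nat.find hex with hl
  have hdep : ¬ LinearIndependent (Polynomial ℚ) fun k : Fin (l + 1) => R k := Nat.find_spec hex
  have hl1 : 1 ≤ l := by
    rw [Nat.one_le_iff_ne_zero]
    intro h0
    apply hdep
    rw [h0, Fintype.linearIndependent_iff]
    intro g hg i
    have hi : i = ⟨0, by omega⟩ := by ext; simp
    rw [Fin.sum_univ_succ] at hg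
    subst hi
    obtain ⟨j, hj⟩ := Function.ne_iff.mp hP0
    have h1 := congrFun hg j
    simp [hR] at h1
    exact h1.resolve_right hj
  have hind : LinearIndependent (Polynomial ℚ) fun k : Fin l => R k := by
    have := Nat.find_min hex (m := l - 1) (by omega)
    rw [not_not] at this
    have e : l - 1 + 1 = l := by omega
    rwa [e] at this
  have hls : l ≤ s + 1 := by
    have := hind.fintype_card_le_finrank
    simpa using this
  set v : Fin l → Fin (s + 1) → Polynomial ℚ := fun k => R k with hv
  -- the next iterate lies in the saturation
  have hRl : R l ∈ satSpan (Polynomial ℚ) v := by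
    rw [Fintype.linearIndependent_iff] at hdep hind
    push Not at hdep
    obtain ⟨g, hg, i, hi⟩ := hdep
    rw [Fin.sum_univ_castSucc] at hg
    simp only [Fin.val_castSucc, Fin.val_last] at hg
    refine ⟨g (Fin.last l), ?_, ?_⟩
    · intro h0
      rw [h0, zero_smul, add_zero] at hg
      have := hind (fun k => g k.castSucc) hg
      refine hi (Fin.lastCases h0 (fun k => this k) i)
    · rw [eq_neg_of_add_eq_zero_right hg]
      refine neg_mem (Submodule.sum_mem _ fun k _ => Submodule.smul_mem _ _ ?_)
      exact Submodule.subset_span ⟨k, rfl⟩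
  have hstab : ∀ x ∈ satSpan (Polynomial ℚ) v, compOp T U x ∈ satSpan (Polynomial ℚ) v := by
    intro x hx
    refine compOp_mem_satSpan (fun i => ?_) hx
    have e : compOp T U (v i) = R (i + 1) := by
      simp only [hv, hR]
      rw [Function.iterate_succ_apply']
    rw [e]
    by_cases hil : (i : ℕ) + 1 = l
    · rwa [hil]
    · have : R (i + 1) = v ⟨i + 1, by omega⟩ := rfl
      rw [this]; exact subset_satSpan v _
  set m := s + 1 - l with hm
  have hlm : l + m = s + 1 := by omega
  -- no nonzero element supported in the first `m` coordinates
  have htop : ∀ x ∈ satSpan (Polynomial ℚ) v, (∀ j : Fin (s + 1), m ≤ j → x j = 0) → x = 0 := by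
    intro x hx hxm
    by_contra hx0
    obtain ⟨m', hm', hmax⟩ := Finset.exists_max_image (Finset.univ.filter fun j => x j ≠ 0) id
      (by
        obtain ⟨j, hj⟩ := Function.ne_iff.mp hx0
        exact ⟨j, by simpa using hj⟩)
    simp only [Finset.mem_filter, Finset.mem_univ, true_and, id] at hm' hmax
    have hm'm : (m' : ℕ) < m := by
      by_contra! h
      exact hm' (hxm m' h)
    have hvan : ∀ j : Fin (s + 1), (m' : ℕ) < j → x j = 0 := by
      intro j hj
      by_contra h
      have h1 : (j : ℕ) ≤ m' := hmax j h
      omega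
    have hit := compOp_iterate_top (T := T) (U := U) x m' (by omega) hvan
    have hli : LinearIndependent (Polynomial ℚ)
        fun k : Fin (l + 1) => (compOp T U)^[(k : ℕ)] x := by
      refine linearIndependent_of_triangular _ (fun k => ⟨m' + k, by omega⟩) ?_ ?_ ?_
      · intro a b hab
        have : (a : ℕ) < b := hab
        rw [Fin.mk_lt_mk]; omega
      · intro k
        rw [(hit k (by omega)).1]
        exact mul_ne_zero (pow_ne_zero _ hT0) hm'
      · intro k j hj
        exact (hit k (by omega)).2 j hj
    have hmem : ∀ k, (compOp T U)^[k] x ∈ satSpan (Polynomial ℚ) v := by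
      intro k
      induction k with
      | zero => exact hx
      | succ k ih => rw [Function.iterate_succ_apply']; exact hstab _ ih
    have := card_le_of_mem_satSpan (fun k : Fin (l + 1) => hmem k) hli
    omega
  -- the minor on the last `l` coordinates
  let A : Matrix (Fin l) (Fin l) (Polynomial ℚ) := fun k j => R k ⟨m + j, by omega⟩
  have hdet : A.det ≠ 0 := by
    intro h0
    obtain ⟨c, hc0, hc⟩ := Matrix.exists_vecMul_eq_zero_iff.mpr h0
    have hx : (∑ k, c k • v k) ∈ satSpan (Polynomial ℚ) v :=
      Submodule.sum_mem _ fun k _ => Submodule.smul_mem _ _ (subset_satSpan v k)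
    have h1 := htop _ hx (fun j hj => by
      have h2 := congrFun hc ⟨j - m, by omega⟩
      simp only [Matrix.vecMul, dotProduct, Pi.zero_apply] at h2
      rw [Finset.sum_apply, ← h2]
      refine Finset.sum_congr rfl fun k _ => ?_
      simp only [Pi.smul_apply, smul_eq_mul, A, hv]
      congr 2
      ext; simp; omega)
    rw [Fintype.linearIndependent_iff] at hind
    exact hc0 (funext (hind c h1))
  let z : Fin l := ⟨0, by omega⟩
  have hG : ∀ j : Fin l, (∑ k, A.adjugate z k • v k) ⟨m + j, by omega⟩ =
      if z = j then A.det else 0 := by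
    intro j
    have h1 := congrFun (congrFun A.adjugate_mul z) j
    rw [Matrix.mul_apply] at h1
    rw [Finset.sum_apply]
    simp only [Pi.smul_apply, smul_eq_mul, hv]
    rw [h1]
    simp [Matrix.one_apply]
  have hGm : (∑ k, A.adjugate z k • v k) ⟨m, by omega⟩ = A.det := by
    have := hG z
    simpa [z] using this
  refine ⟨l, m, hl1, hlm, fun k => A.adjugate z k, satSpan (Polynomial ℚ) v, ?_, hstab,
    fun w hw => exists_relation_of_mem_satSpan hw, ?_, ?_, ?_⟩
  · exact Submodule.sum_mem _ fun k _ => Submodule.smul_mem _ _ (subset_satSpan v k)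
  · exact hGm ▸ hdet
  · refine (le_of_eq (congrArg Polynomial.natDegree hGm)).trans
      (natDegree_det_le_of_le _ fun k j => ?_)
    refine (natDegree_compOp_iterate_le hT hU hP k _).trans ?_
    gcongr
    omega
  · intro j hj
    have := hG ⟨j - m, by omega⟩
    rw [if_neg (by simp [z, Fin.ext_iff]; omega)] at this
    have e : (⟨m + (j - m), by omega⟩ : Fin (s + 1)) = j := by ext; simp; omega
    simp only [e] at this
    exact this

end

section

/-! ### Linear differential operators -/

/-- `E` is a linear differential operator of order at most `k` with polynomial coefficients. -/
def IsDiffOp (k : ℕ) (E : PowerSeries ℚ → PowerSeries ℚ) : Prop :=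
  ∃ c : ℕ → Polynomial ℚ, ∀ h, E h = ∑ j ∈ Finset.range (k + 1), (c j : PowerSeries ℚ) * (d⁄dX ℚ)^[j] h

theorem IsDiffOp.mono {k l : ℕ} {E : PowerSeries ℚ → PowerSeries ℚ} (hE : IsDiffOp k E)
    (hkl : k ≤ l) : IsDiffOp l E := by
  obtain ⟨c, hc⟩ := hE
  refine ⟨fun j => if j ≤ k then c j else 0, fun h => ?_⟩
  rw [hc, ← Finset.sum_subset (Finset.range_mono (by omega : k + 1 ≤ l + 1))]
  · refine Finset.sum_congr rfl fun j hj => ?_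
    beta_reduce
    rw [if_pos (by simp at hj; omega)]
  · intro j _ hj
    beta_reduce
    rw [if_neg (by simp at hj; omega)]; simp

theorem IsDiffOp.add {k : ℕ} {E F : PowerSeries ℚ → PowerSeries ℚ} (hE : IsDiffOp k E)
    (hF : IsDiffOp k F) : IsDiffOp k (fun h => E h + F h) := by
  obtain ⟨c, hc⟩ := hE
  obtain ⟨d, hd⟩ := hF
  refine ⟨fun j => c j + d j, fun h => ?_⟩
  beta_reduce
  rw [hc, hd, ← Finset.sum_add_distrib]
  refine Finset.sum_congr rfl fun j _ => ?_
  rw [Polynomial.coe_add]; ring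

theorem IsDiffOp.smul {k : ℕ} {E : PowerSeries ℚ → PowerSeries ℚ} (hE : IsDiffOp k E)
    (p : Polynomial ℚ) : IsDiffOp k (fun h => (p : PowerSeries ℚ) * E h) := by
  obtain ⟨c, hc⟩ := hE
  refine ⟨fun j => p * c j, fun h => ?_⟩
  beta_reduce
  rw [hc, Finset.mul_sum]
  refine Finset.sum_congr rfl fun j _ => ?_
  rw [Polynomial.coe_mul]; ring

theorem IsDiffOp.zero (k : ℕ) : IsDiffOp k (fun _ => 0) := ⟨0, fun h => by simp⟩

theorem IsDiffOp.sum {ι : Type*} (t : Finset ι) {k : ℕ} {E : ι → PowerSeries ℚ → PowerSeries ℚ}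
    (hE : ∀ i ∈ t, IsDiffOp k (E i)) : IsDiffOp k (fun h => ∑ i ∈ t, E i h) := by
  classical
  induction t using Finset.induction_on with
  | empty => simpa using IsDiffOp.zero k
  | insert a t ha ih =>
    simp only [Finset.sum_insert ha]
    exact (hE a (by simp)).add (ih fun i hi => hE i (by simp [hi]))

theorem IsDiffOp.iterate_derivative (j : ℕ) : IsDiffOp j (fun h => (d⁄dX ℚ)^[j] h) := by
  refine ⟨fun i => if i = j then 1 else 0, fun h => ?_⟩
  rw [Finset.sum_eq_single j]
  · simp
  · intro i _ hij; simp [hij]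
  · intro hj; simp at hj

theorem IsDiffOp.derivative {k : ℕ} {E : PowerSeries ℚ → PowerSeries ℚ} (hE : IsDiffOp k E) :
    IsDiffOp (k + 1) (fun h => d⁄dX ℚ (E h)) := by
  obtain ⟨c, hc⟩ := hE
  have h1 : IsDiffOp (k + 1) fun h => ∑ j ∈ Finset.range (k + 1),
      (((c j : PowerSeries ℚ)) * (d⁄dX ℚ)^[j + 1] h +
        ((Polynomial.derivative (c j) : Polynomial ℚ) : PowerSeries ℚ) * (d⁄dX ℚ)^[j] h) := by
    refine IsDiffOp.sum _ fun j hj => ?_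
    simp only [Finset.mem_range] at hj
    exact (((IsDiffOp.iterate_derivative (j + 1)).smul (c j)).mono (by omega)).add
      (((IsDiffOp.iterate_derivative j).smul _).mono (by omega))
  obtain ⟨d, hd⟩ := h1
  refine ⟨d, fun h => ?_⟩
  rw [← hd]
  beta_reduce
  rw [hc, map_sum]
  refine Finset.sum_congr rfl fun j _ => ?_
  rw [Derivation.leibniz, derivative_coe, Function.iterate_succ_apply', smul_eq_mul, smul_eq_mul]
  ring

theorem IsDiffOp.iterate {k : ℕ} {E : PowerSeries ℚ → PowerSeries ℚ} (hE : IsDiffOp k E) (j : ℕ) :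
    IsDiffOp (k + j) (fun h => (d⁄dX ℚ)^[j] (E h)) := by
  induction j with
  | zero => simpa using hE
  | succ j ih =>
    have := ih.derivative
    simp only [← Function.iterate_succ_apply' (f := (d⁄dX ℚ))] at this
    exact this

theorem exists_hasSymbol_mul {p : Polynomial ℚ} (hp : p ≠ 0) :
    ∃ (σ : ℕ) (κ : ℚ), κ ≠ 0 ∧ HasSymbol (fun h => (p : PowerSeries ℚ) * h) σ (Polynomial.C κ) := by
  refine ⟨p.natTrailingDegree, p.coeff p.natTrailingDegree, ?_, ?_⟩
  · exact Polynomial.trailingCoeff_nonzero_iff_nonzero.mpr hp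
  · have := HasSymbol.mul_left (p : PowerSeries ℚ) p.natTrailingDegree (by
      rw [X_pow_dvd_iff]
      intro m hm
      rw [Polynomial.coeff_coe]
      exact Polynomial.coeff_eq_zero_of_lt_natTrailingDegree hm)
    rwa [Polynomial.coeff_coe] at this

theorem HasSymbol.ne_zero_of_ne_zero {E : PowerSeries ℚ → PowerSeries ℚ} {σ : ℕ} {e : Polynomial ℚ}
    (hE : HasSymbol E σ e) (he : e ≠ 0) : ∃ h, E h ≠ 0 := by
  obtain ⟨n, hn⟩ := exists_eval_natCast_ne_zero he
  refine ⟨X ^ n, fun h0 => hn n le_rfl ?_⟩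
  have := (hE (X ^ n) n dvd_rfl).2
  rw [h0] at this
  simpa using this.symm

/-! ### Vanishing under derivation -/

theorem X_pow_dvd_derivative {R : Type*} [CommRing R] {h : PowerSeries R} {n : ℕ} (hn : X ^ n ∣ h) :
    X ^ (n - 1) ∣ d⁄dX R h := by
  rw [X_pow_dvd_iff] at hn ⊢
  intro m hm
  rw [coeff_derivative, hn (m + 1) (by omega), zero_mul]

theorem X_pow_dvd_iterate_mul_derivative {R : Type*} [CommRing R] (T : PowerSeries R)
    {h : PowerSeries R} {n : ℕ} (hn : X ^ n ∣ h) (k : ℕ) :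
    X ^ (n - k) ∣ (fun x => T * d⁄dX R x)^[k] h := by
  induction k with
  | zero => simpa using hn
  | succ k ih =>
    rw [Function.iterate_succ_apply']
    exact Dvd.dvd.mul_left (X_pow_dvd_derivative ih) _

variable {s : ℕ} {T : Polynomial ℚ} {U : Fin (s + 1) → Polynomial ℚ}

theorem diffVal_add (f : PowerSeries ℚ) (c d : Fin (s + 1) → Polynomial ℚ) :
    diffVal f (c + d) = diffVal f c + diffVal f d := by
  simp [diffVal, Finset.sum_add_distrib, add_mul]

theorem diffVal_smul (f : PowerSeries ℚ) (a : Polynomial ℚ) (c : Fin (s + 1) → Polynomial ℚ) :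
    diffVal f (a • c) = (a : PowerSeries ℚ) * diffVal f c := by
  simp [diffVal, Finset.mul_sum, mul_assoc]

theorem diffVal_sum {ι : Type*} (t : Finset ι) (f : PowerSeries ℚ)
    (c : ι → Fin (s + 1) → Polynomial ℚ) :
    diffVal f (∑ i ∈ t, c i) = ∑ i ∈ t, diffVal f (c i) := by
  classical
  induction t using Finset.induction_on with
  | empty => simp [diffVal]
  | insert a t ha ih => rw [Finset.sum_insert ha, Finset.sum_insert ha, diffVal_add, ih]

theorem diffVal_compOp_iterate {f : PowerSeries ℚ}
    (hT : (T : PowerSeries ℚ) * (d⁄dX ℚ)^[s + 1] f = diffVal f U)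
    (c : Fin (s + 1) → Polynomial ℚ) (k : ℕ) :
    diffVal f ((compOp T U)^[k] c) =
      (fun x => (T : PowerSeries ℚ) * d⁄dX ℚ x)^[k] (diffVal f c) := by
  induction k with
  | zero => rfl
  | succ k ih => rw [Function.iterate_succ_apply', Function.iterate_succ_apply', diffVal_compOp hT, ih]

/-- Coordinate vectors of `T ^ k * (d/dX)^k` applied to the value of a vector. -/
def powVec (T : Polynomial ℚ) (U : Fin (s + 1) → Polynomial ℚ) (v : Fin (s + 1) → Polynomial ℚ) :
    ℕ → Fin (s + 1) → Polynomial ℚ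
  | 0 => v
  | k + 1 => compOp T U (powVec T U v k) - ((k : Polynomial ℚ) * Polynomial.derivative T) • powVec T U v k

theorem diffVal_powVec {f : PowerSeries ℚ}
    (hT : (T : PowerSeries ℚ) * (d⁄dX ℚ)^[s + 1] f = diffVal f U)
    (v : Fin (s + 1) → Polynomial ℚ) (k : ℕ) :
    diffVal f (powVec T U v k) = (T : PowerSeries ℚ) ^ k * (d⁄dX ℚ)^[k] (diffVal f v) := by
  induction k with
  | zero => simp [powVec]
  | succ k ih =>
    have e : powVec T U v (k + 1) = compOp T U (powVec T U v k) +
      (-((k : Polynomial ℚ) * Polynomial.derivative T)) • powVec T U v k := by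
      rw [powVec, neg_smul, sub_eq_add_neg]
    rw [e, diffVal_add, diffVal_smul, diffVal_compOp hT, ih, Function.iterate_succ_apply',
      Derivation.leibniz, Derivation.leibniz_pow, derivative_coe]
    have e2 : ((-((k : Polynomial ℚ) * Polynomial.derivative T) : Polynomial ℚ) : PowerSeries ℚ) =
      - ((k : PowerSeries ℚ) * ((Polynomial.derivative T : Polynomial ℚ) : PowerSeries ℚ)) := by
      rw [← Polynomial.coeToPowerSeries.ringHom_apply, map_neg, map_mul]
      simp
    rw [e2]
    cases k with
    | zero => simp
    | succ k =>
      simp only [smul_eq_mul, nsmul_eq_mul, Nat.add_sub_cancel]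
      ring

theorem powVec_mem {N : Submodule (Polynomial ℚ) (Fin (s + 1) → Polynomial ℚ)}
    (hN : ∀ x ∈ N, compOp T U x ∈ N) {v : Fin (s + 1) → Polynomial ℚ} (hv : v ∈ N) (k : ℕ) :
    powVec T U v k ∈ N := by
  induction k with
  | zero => exact hv
  | succ k ih => exact sub_mem (hN _ ih) (Submodule.smul_mem _ _ ih)

theorem zero_estimate {f : PowerSeries ℚ} (hT0 : T ≠ 0)
    (hT : (T : PowerSeries ℚ) * (d⁄dX ℚ)^[s + 1] f = diffVal f U)
    (hind : ∀ c : Fin (s + 1) → Polynomial ℚ, diffVal f c = 0 → c = 0) :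
    ∃ c : ℕ, ∀ (n : ℕ) (P : Fin (s + 1) → Polynomial ℚ), P ≠ 0 → (∀ j, (P j).natDegree ≤ n) →
      ∀ μ : ℕ, X ^ μ ∣ diffVal f P → s * n + c < μ →
      ∃ (b : Fin (s + 1) → Polynomial ℚ) (Δ : Polynomial ℚ), Δ ≠ 0 ∧
        Δ.natDegree ≤ (s + 1) * n + c ∧
        ∑ k, (b k : PowerSeries ℚ) *
          (fun x => (T : PowerSeries ℚ) * d⁄dX ℚ x)^[k] (diffVal f P) = (Δ : PowerSeries ℚ) * f := by
  classical
  obtain ⟨c₀, hc₀T, hc₀U⟩ : ∃ c₀, T.natDegree ≤ c₀ ∧ ∀ j, (U j).natDegree ≤ c₀ := by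
    refine ⟨T.natDegree + ∑ j, (U j).natDegree, by omega, fun j => ?_⟩
    have := Finset.single_le_sum (f := fun j => (U j).natDegree) (fun _ _ => Nat.zero_le _)
      (Finset.mem_univ j)
    omega
  set lc : ℕ → Polynomial ℚ := fun i => if i = s + 1 then T else
    if h : i < s + 1 then -U ⟨i, h⟩ else 0 with hlc
  obtain ⟨σL, ℓ, hℓ0, hL, -⟩ := exists_hasSymbol (s + 1) lc ⟨s + 1, le_rfl, by simpa [hlc] using hT0⟩
  obtain ⟨nℓ, hnℓ⟩ := exists_eval_natCast_ne_zero hℓ0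
  refine ⟨s + s * (s * c₀) + nℓ + (s + 1) * (s * c₀), fun n P hP0 hP μ hμ hμn => ?_⟩
  obtain ⟨l, m, hl1, hlm, b, N, hGN, hNst, hNdep, hGm0, hGmdeg, hGtop⟩ :=
    exists_reduced_combination hT0 hc₀T hc₀U hP0 hP
  set G := ∑ k, b k • (compOp T U)^[k] P with hG
  have hGval : diffVal f G = ∑ k : Fin l, (b k : PowerSeries ℚ) *
      (fun x => (T : PowerSeries ℚ) * d⁄dX ℚ x)^[k] (diffVal f P) := by
    rw [hG, diffVal_sum]
    refine Finset.sum_congr rfl fun k _ => ?_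
    rw [diffVal_smul, diffVal_compOp_iterate hT]
  rcases Nat.eq_zero_or_pos m with rfl | hm
  · obtain rfl : l = s + 1 := by omega
    refine ⟨b, G 0, hGm0, ?_, ?_⟩
    · have : (s + 1) * (n + s * c₀) = (s + 1) * n + (s + 1) * (s * c₀) := by ring
      have h2 : (G 0).natDegree ≤ (s + 1) * (n + s * c₀) := hGmdeg
      omega
    · rw [← hGval, diffVal, Finset.sum_eq_single 0]
      · simp
      · intro j _ hj
        rw [hGtop j (by rw [Fin.pos_iff_ne_zero.symm] at hj; exact hj)]
        simp
      · simp
  exfalso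
  have hls : l ≤ s := by omega
  have hG0 : G ≠ 0 := fun h => hGm0 (by rw [h]; rfl)
  set v : Fin (s + 1) → Polynomial ℚ := (Polynomial.X ^ m : Polynomial ℚ) • G with hv
  set g := diffVal f v with hg
  have hg0 : g ≠ 0 := by
    intro h
    have := hind _ h
    rw [hv] at this
    rcases smul_eq_zero.mp this with h | h
    · exact pow_ne_zero _ Polynomial.X_ne_zero h
    · exact hG0 h
  have hgdvd : X ^ (μ - s) ∣ g := by
    rw [hg, hv, diffVal_smul, hGval]
    refine Dvd.dvd.mul_left (Finset.dvd_sum fun k _ => Dvd.dvd.mul_left ?_ _) _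
    exact (pow_dvd_pow _ (by omega)).trans (X_pow_dvd_iterate_mul_derivative _ hμ k)
  -- the operator `A` with `A f = g`
  set ac : ℕ → Polynomial ℚ := fun i => if h : i < s + 1 then G ⟨i, h⟩ else 0 with hac
  set A : PowerSeries ℚ → PowerSeries ℚ := fun h =>
    X ^ m * ∑ j ∈ Finset.range (m + 1), (ac j : PowerSeries ℚ) * (d⁄dX ℚ)^[j] h with hA
  have hAf : A f = g := by
    rw [hg, hv, diffVal_smul, hA, Polynomial.coe_pow, Polynomial.coe_X]
    beta_reduce
    congr 1
    rw [diffVal, Finset.sum_fin_eq_sum_range,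
      ← Finset.sum_subset (Finset.range_mono (by omega : m + 1 ≤ s + 1))]
    · refine Finset.sum_congr rfl fun j hj => ?_
      have : j < s + 1 := by simp at hj; omega
      simp only [hac]
      rw [dif_pos this, dif_pos this]
    · intro j hj hjm
      have : j < s + 1 := by simpa using hj
      rw [dif_pos this, hGtop ⟨j, this⟩ (by simp at hjm ⊢; omega)]
      simp
  have hacm : ac m ≠ 0 := by
    simp only [hac]
    rw [dif_pos (by omega)]; exact hGm0
  obtain ⟨σA, a, ha0, hAs, hAle⟩ := exists_hasSymbol m ac ⟨m, le_rfl, hacm⟩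
  have hσA : σA ≤ s * n + s * (s * c₀) := by
    have h1 := hAle m le_rfl hacm
    have h2 := Polynomial.natTrailingDegree_le_natDegree (ac m)
    have h3 : (ac m).natDegree ≤ l * (n + s * c₀) := by
      simp only [hac]
      rw [dif_pos (by omega)]; exact hGmdeg
    have h4 : l * (n + s * c₀) ≤ s * (n + s * c₀) := Nat.mul_le_mul_right _ hls
    have h5 : s * (n + s * c₀) = s * n + s * (s * c₀) := by ring
    omega
  -- the operator `B` killing `g`
  obtain ⟨β, hβ, i₀, hi₀⟩ := hNdep (fun k => powVec T U v k)
    fun k => powVec_mem hNst (Submodule.smul_mem _ _ hGN) k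
  set bc : ℕ → Polynomial ℚ := fun k => if h : k < l + 1 then β ⟨k, h⟩ * T ^ k else 0 with hbc
  set B : PowerSeries ℚ → PowerSeries ℚ := fun h =>
    ∑ j ∈ Finset.range (l + 1), (bc j : PowerSeries ℚ) * (d⁄dX ℚ)^[j] h with hB
  have hBg : B g = 0 := by
    have h1 := congrArg (diffVal f) hβ
    rw [diffVal_sum, Finset.sum_fin_eq_sum_range] at h1
    have h0 : diffVal f (0 : Fin (s + 1) → Polynomial ℚ) = 0 := by simp [diffVal]
    rw [h0] at h1
    rw [← h1, hB]
    refine Finset.sum_congr rfl fun j hj => ?_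
    have : j < l + 1 := by simpa using hj
    simp only [hbc]
    rw [dif_pos this, dif_pos this, diffVal_smul, diffVal_powVec hT, Polynomial.coe_mul,
      Polynomial.coe_pow, mul_assoc]
  obtain ⟨σB, bb, hbb0, hBs, -⟩ := exists_hasSymbol l bc ⟨i₀, by omega, by
    simp only [hbc]
    rw [dif_pos i₀.2]
    exact mul_ne_zero hi₀ (pow_ne_zero _ hT0)⟩
  obtain ⟨cc, hcc⟩ : IsDiffOp (s + 1) (fun h => B (A h)) := by
    have hAd : IsDiffOp m A := by
      have : IsDiffOp m fun h => ∑ j ∈ Finset.range (m + 1), (ac j : PowerSeries ℚ) * (d⁄dX ℚ)^[j] h :=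
        ⟨ac, fun h => rfl⟩
      have := this.smul (Polynomial.X ^ m)
      simpa only [Polynomial.coe_pow, Polynomial.coe_X] using this
    refine IsDiffOp.sum _ fun j hj => ?_
    refine ((hAd.iterate j).smul (bc j)).mono ?_
    simp at hj; omega
  set Lop : PowerSeries ℚ → PowerSeries ℚ := fun h =>
    ∑ j ∈ Finset.range (s + 1 + 1), (lc j : PowerSeries ℚ) * (d⁄dX ℚ)^[j] h with hLop
  have hLop' : ∀ h, Lop h = (T : PowerSeries ℚ) * (d⁄dX ℚ)^[s + 1] h - diffVal h U := by
    intro h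
    rw [hLop]
    beta_reduce
    rw [Finset.sum_range_succ, diffVal, Finset.sum_fin_eq_sum_range, add_comm, sub_eq_add_neg,
      ← Finset.sum_neg_distrib]
    congr 1
    · simp [hlc]
    · refine Finset.sum_congr rfl fun j hj => ?_
      have : j < s + 1 := by simpa using hj
      have h3 : j ≠ s + 1 := by omega
      simp only [hlc]
      rw [if_neg h3, dif_pos this, dif_pos this]
      have : ((-U ⟨j, this⟩ : Polynomial ℚ) : PowerSeries ℚ) = -(U ⟨j, this⟩ : PowerSeries ℚ) := by
        rw [← Polynomial.coeToPowerSeries.ringHom_apply, map_neg,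
          Polynomial.coeToPowerSeries.ringHom_apply]
      rw [this, neg_mul]
  have hfac : ∀ h, (T : PowerSeries ℚ) * B (A h) = (cc (s + 1) : PowerSeries ℚ) * Lop h := by
    set w : Fin (s + 1) → Polynomial ℚ := fun i => T * cc i + cc (s + 1) * U i with hw
    have hwh : ∀ h, (T : PowerSeries ℚ) * B (A h) =
        (cc (s + 1) : PowerSeries ℚ) * Lop h + diffVal h w := by
      intro h
      have e1 := hcc h
      beta_reduce at e1
      have e2 : diffVal h w = (T : PowerSeries ℚ) *
          ∑ j ∈ Finset.range (s + 1), (cc j : PowerSeries ℚ) * (d⁄dX ℚ)^[j] h +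
          (cc (s + 1) : PowerSeries ℚ) * diffVal h U := by
        rw [← Fin.sum_univ_eq_sum_range (fun j => (cc j : PowerSeries ℚ) * (d⁄dX ℚ)^[j] h)]
        simp only [diffVal, Finset.mul_sum, ← Finset.sum_add_distrib, hw]
        refine Finset.sum_congr rfl fun j _ => ?_
        simp only [Polynomial.coe_add, Polynomial.coe_mul]; ring
      rw [e1, Finset.sum_range_succ, e2, hLop']
      ring
    have hw0 : w = 0 := by
      apply hind
      have := hwh f
      rw [hAf, hBg, hLop', hT, sub_self, mul_zero, mul_zero, zero_add] at this
      exact this.symm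
    intro h
    rw [hwh h, hw0]
    simp [diffVal]
  -- compare symbols
  obtain ⟨σ₁, κ₁, hκ₁, hs₁⟩ := exists_hasSymbol_mul
    (mul_ne_zero hT0 (pow_ne_zero (s + 1) Polynomial.X_ne_zero) : T * Polynomial.X ^ (s + 1) ≠ 0)
  have hsl := hs₁.comp (hBs.comp hAs)
  have hsl0 : (Polynomial.C κ₁).comp (Polynomial.X + Polynomial.C ((σA + σB : ℕ) : ℚ)) *
      (bb.comp (Polynomial.X + Polynomial.C (σA : ℚ)) * a) ≠ 0 := by
    rw [Polynomial.C_comp]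
    refine mul_ne_zero (by simpa using hκ₁) (mul_ne_zero ?_ ha0)
    intro h
    apply hbb0
    have := congrArg (fun p => p.comp (Polynomial.X - Polynomial.C (σA : ℚ))) h
    simpa [Polynomial.comp_assoc] using this
  have hcc0 : cc (s + 1) ≠ 0 := by
    intro h0
    obtain ⟨h, hh⟩ := hsl.ne_zero_of_ne_zero hsl0
    apply hh
    have h1 := hfac h
    rw [h0, Polynomial.coe_zero, zero_mul] at h1
    have h2 : (T : PowerSeries ℚ) ≠ 0 := by simpa using hT0
    have h3 := (mul_eq_zero.mp h1).resolve_left h2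
    have h4 : B (X ^ m * ∑ j ∈ Finset.range (m + 1), (ac j : PowerSeries ℚ) * (d⁄dX ℚ)^[j] h) = 0 := h3
    simp only [hB] at h4
    rw [h4]; simp
  obtain ⟨σ₂, κ₂, hκ₂, hs₂⟩ := exists_hasSymbol_mul
    (mul_ne_zero hcc0 (pow_ne_zero l Polynomial.X_ne_zero) : cc (s + 1) * Polynomial.X ^ l ≠ 0)
  have hsr := hs₂.comp hL
  have hsr' : HasSymbol _ _ _ := hsr.congr (F := fun h =>
      ((T * Polynomial.X ^ (s + 1) : Polynomial ℚ) : PowerSeries ℚ) *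
        (X ^ l * ∑ j ∈ Finset.range (l + 1), (bc j : PowerSeries ℚ) * (d⁄dX ℚ)^[j] (
          X ^ m * ∑ j ∈ Finset.range (m + 1), (ac j : PowerSeries ℚ) * (d⁄dX ℚ)^[j] h))) (by
    intro h
    have h1 := hfac h
    simp only [hA, hB, hLop] at h1
    simp only [Polynomial.coe_mul, Polynomial.coe_pow, Polynomial.coe_X]
    linear_combination (-(X ^ (s + 1) * X ^ l : PowerSeries ℚ)) * h1)
  have hsr0 : (Polynomial.C κ₂).comp (Polynomial.X + Polynomial.C (σL : ℚ)) * ℓ ≠ 0 := by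
    rw [Polynomial.C_comp]
    exact mul_ne_zero (by simpa using hκ₂) hℓ0
  obtain ⟨-, heq⟩ := hsl.unique hsr' hsl0 hsr0
  set ω := (order g).toNat with hω
  have hωg : (ω : ℕ∞) = order g := coe_toNat_order hg0
  have hω1 : X ^ ω ∣ g := X_pow_order_dvd
  have hω2 : coeff ω g ≠ 0 := coeff_order hg0
  have hω3 : μ - s ≤ ω := by
    by_contra! h
    exact hω2 (X_pow_dvd_iff.mp hgdvd ω h)
  have hbω : bb.eval (ω : ℚ) = 0 := by
    have h1 := (hBs g ω hω1).2
    have h2 : ∑ j ∈ Finset.range (l + 1), (bc j : PowerSeries ℚ) * (d⁄dX ℚ)^[j] g = 0 := hBg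
    beta_reduce at h1
    rw [h2, mul_zero, map_zero, eq_comm, mul_eq_zero] at h1
    exact h1.resolve_right hω2
  have hev := congrArg (fun p => p.eval ((ω - σA : ℕ) : ℚ)) heq
  simp only [Polynomial.eval_mul, Polynomial.eval_comp, Polynomial.eval_add, Polynomial.eval_X,
    Polynomial.eval_C] at hev
  rw [Nat.cast_sub (by omega), sub_add_cancel, hbω, zero_mul, mul_zero, eq_comm, mul_eq_zero] at hev
  rw [← Nat.cast_sub (by omega)] at hev
  exact hnℓ (ω - σA) (by omega) (hev.resolve_left hκ₂)

end

/-! ### Exponential coefficients -/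

/-- The coefficient of `X ^ n / n!` in a power series. -/
def ecoeff {A : Type*} [CommRing A] (n : ℕ) (g : PowerSeries A) : A := (n.factorial : A) * coeff n g

section Ecoeff

variable {A : Type*} [CommRing A]

theorem ecoeff_add (n : ℕ) (g h : PowerSeries A) : ecoeff n (g + h) = ecoeff n g + ecoeff n h := by
  simp [ecoeff, mul_add]

@[simp]
theorem ecoeff_zero (n : ℕ) : ecoeff n (0 : PowerSeries A) = 0 := by
  simp [ecoeff]

theorem ecoeff_sum {ι : Type*} (t : Finset ι) (n : ℕ) (g : ι → PowerSeries A) :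
    ecoeff n (∑ i ∈ t, g i) = ∑ i ∈ t, ecoeff n (g i) := by
  simp [ecoeff, Finset.mul_sum]

theorem ecoeff_mul (n : ℕ) (g h : PowerSeries A) :
    ecoeff n (g * h) = ∑ r ∈ Finset.range (n + 1), (n.choose r : A) * ecoeff r g * ecoeff (n - r) h := by
  rw [ecoeff, coeff_mul, Finset.Nat.sum_antidiagonal_eq_sum_range_succ_mk, Finset.mul_sum]
  refine Finset.sum_congr rfl fun r hr => ?_
  have hr : r ≤ n := by simp at hr; omega
  rw [ecoeff, ecoeff, ← Nat.choose_mul_factorial_mul_factorial hr]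
  push_cast
  ring

theorem ecoeff_derivative (n : ℕ) (g : PowerSeries A) :
    ecoeff n (d⁄dX A g) = ecoeff (n + 1) g := by
  rw [ecoeff, ecoeff, coeff_derivative, Nat.factorial_succ]
  push_cast; ring

theorem ecoeff_iterate_derivative (n j : ℕ) (g : PowerSeries A) :
    ecoeff n ((d⁄dX A)^[j] g) = ecoeff (n + j) g := by
  induction j generalizing n with
  | zero => simp
  | succ j ih => rw [Function.iterate_succ_apply', ecoeff_derivative, ih, add_right_comm, add_assoc]

theorem constantCoeff_iterate_derivative_eq_ecoeff (j : ℕ) (g : PowerSeries A) :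
    constantCoeff ((d⁄dX A)^[j] g) = ecoeff j g := by
  have := ecoeff_iterate_derivative 0 j g
  simpa [ecoeff] using this

end Ecoeff

/-- The exponential coefficients of a solution of a linear differential equation with polynomial
coefficients satisfy a recurrence with polynomial coefficients. -/
theorem exists_recurrence {k A : Type*} [Field k] [CharZero k] [CommRing A] [Algebra k A]
    (J : ℕ) (c : ℕ → Polynomial k) (hc : ∃ j ≤ J, c j ≠ 0) (φ : PowerSeries A)
    (hφ : ∑ j ∈ Finset.range (J + 1),
      (((c j).map (algebraMap k A) : Polynomial A) : PowerSeries A) * (d⁄dX A)^[j] φ = 0) :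
    ∃ (E : ℕ) (p : ℕ → Polynomial k), p E ≠ 0 ∧
      ∀ n : ℕ, ∑ e ∈ Finset.range (E + 1), (p e).eval (n : k) • ecoeff (n + e) φ = 0 := by
  classical
  obtain ⟨R, hR⟩ : ∃ R, ∀ j ≤ J, (c j).natDegree ≤ R := by
    refine ⟨∑ j ∈ Finset.range (J + 1), (c j).natDegree, fun j hj => ?_⟩
    exact Finset.single_le_sum (f := fun j => (c j).natDegree) (fun _ _ => Nat.zero_le _)
      (by simp; omega)
  -- the coefficient polynomials
  set a : ℕ → ℕ → k := fun e r => if R ≤ e + r ∧ e + r ≤ R + J then (c (e + r - R)).coeff r else 0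
    with ha
  set p : ℕ → Polynomial k := fun e => (∑ r ∈ Finset.range (R + 1),
    Polynomial.C (a e r) * descPochhammer k r).comp (Polynomial.X + Polynomial.C (R : k)) with hp
  have hpeval : ∀ e (n : ℕ), (p e).eval (n : k) =
      ∑ r ∈ Finset.range (R + 1), a e r * ((n + R).descFactorial r : k) := by
    intro e n
    simp only [hp, Polynomial.eval_comp, Polynomial.eval_finsetSum, Polynomial.eval_mul,
      Polynomial.eval_C, Polynomial.eval_add, Polynomial.eval_X]
    refine Finset.sum_congr rfl fun r _ => ?_
    rw [← descPochhammer_eval_eq_descFactorial, Nat.cast_add]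
  have hrec : ∀ n : ℕ, ∑ e ∈ Finset.range (R + J + 1), (p e).eval (n : k) • ecoeff (n + e) φ = 0 := by
    intro n
    have h1 := congrArg (ecoeff (n + R)) hφ
    rw [ecoeff_sum, ecoeff_zero] at h1
    have h2 : ∀ j ∈ Finset.range (J + 1),
        ecoeff (n + R) ((((c j).map (algebraMap k A) : Polynomial A) : PowerSeries A) *
          (d⁄dX A)^[j] φ) =
        ∑ r ∈ Finset.range (R + 1), (((c j).coeff r) * ((n + R).descFactorial r : k)) •
          ecoeff (n + (R + j - r)) φ := by
      intro j hj
      have hj : j ≤ J := by simp at hj; omega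
      rw [ecoeff_mul, ← Finset.sum_subset (Finset.range_mono (by omega : R + 1 ≤ n + R + 1))]
      · refine Finset.sum_congr rfl fun r hr => ?_
        have hr : r ≤ R := by simp at hr; omega
        rw [ecoeff_iterate_derivative, ecoeff, Polynomial.coeff_coe, Polynomial.coeff_map,
          Nat.descFactorial_eq_factorial_mul_choose, Algebra.smul_def]
        have : n + R - r + j = n + (R + j - r) := by omega
        rw [this]
        push_cast
        ring
      · intro r _ hr
        have : (c j).coeff r = 0 := Polynomial.coeff_eq_zero_of_natDegree_lt (by
          have := hR j hj; simp at hr; omega)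
        simp [ecoeff, this]
    rw [Finset.sum_congr rfl h2, Finset.sum_comm] at h1
    rw [← h1]
    simp_rw [hpeval, Finset.sum_smul]
    rw [Finset.sum_comm]
    refine Finset.sum_congr rfl fun r hr => ?_
    have hr : r ≤ R := by simp at hr; omega
    rw [← Finset.sum_subset (s₁ := (Finset.range (J + 1)).image fun j => R + j - r)]
    rotate_left
    · intro e he
      simp only [Finset.mem_image, Finset.mem_range] at he ⊢
      omega
    · intro e he' he
      simp only [Finset.mem_image, Finset.mem_range, not_exists, not_and] at he he'
      have : a e r = 0 := by
        simp only [ha]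
        rw [if_neg]
        rintro ⟨h3, h4⟩
        exact he (e + r - R) (by omega) (by omega)
      simp [this]
    · rw [Finset.sum_image]
      · refine Finset.sum_congr rfl fun j hj => ?_
        have hj : j ≤ J := by simp at hj; omega
        have : a (R + j - r) r = (c j).coeff r := by
          simp only [ha]
          rw [if_pos (by omega)]
          congr 2; omega
        rw [this]
      · intro i _ j _ hij
        simp only at hij
        omega
  obtain ⟨j₀, hj₀, hcj₀⟩ := hc
  have hex : ∃ e ≤ R + J, p e ≠ 0 := by
    set r₀ := (c j₀).natDegree with hr₀
    have hr₀R : r₀ ≤ R := hR j₀ hj₀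
    refine ⟨R + j₀ - r₀, by omega, fun h0 => ?_⟩
    have h1 : ∑ r ∈ Finset.range (R + 1),
        Polynomial.C (a (R + j₀ - r₀) r) * descPochhammer k r ≠ 0 := by
      refine sum_C_mul_descPochhammer_ne_zero _ _ r₀ (by simp; omega) ?_
      simp only [ha]
      rw [if_pos (by omega)]
      have : R + j₀ - r₀ + r₀ - R = j₀ := by omega
      rw [this]
      exact Polynomial.leadingCoeff_ne_zero.mpr hcj₀
    apply h1
    have := congrArg (fun q => q.comp (Polynomial.X - Polynomial.C (R : k))) h0
    simpa [hp, Polynomial.comp_assoc] using this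
  obtain ⟨E, hE, hmax⟩ := Finset.exists_max_image
    ((Finset.range (R + J + 1)).filter fun e => p e ≠ 0) id (by
      obtain ⟨e, he, hpe⟩ := hex
      exact ⟨e, by simp; exact ⟨by omega, hpe⟩⟩)
  simp only [Finset.mem_filter, Finset.mem_range, id] at hE hmax
  refine ⟨E, p, hE.2, fun n => ?_⟩
  rw [← hrec n]
  refine Finset.sum_subset (Finset.range_mono (by omega)) fun e he hne => ?_
  have : p e = 0 := by
    by_contra h
    have := hmax e ⟨by simpa using he, h⟩
    simp at hne; omega
  simp [this]

theorem exists_int_smul_polynomial (p : Polynomial ℚ) :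
    ∃ d : ℕ, 0 < d ∧ ∃ p' : Polynomial ℤ, p'.map (Int.castRingHom ℚ) = Polynomial.C (d : ℚ) * p := by
  induction p using Polynomial.induction_on' with
  | add p q hp hq =>
    obtain ⟨d, hd, p', hp⟩ := hp
    obtain ⟨e, he, q', hq⟩ := hq
    refine ⟨d * e, Nat.mul_pos hd he, Polynomial.C (e : ℤ) * p' + Polynomial.C (d : ℤ) * q', ?_⟩
    simp only [Polynomial.map_add, Polynomial.map_mul, Polynomial.map_C, hp, hq]
    push_cast
    simp only [eq_intCast, Int.cast_natCast, Polynomial.C_mul]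
    ring
  | monomial n a =>
    refine ⟨a.den, a.den_pos, Polynomial.monomial n a.num, ?_⟩
    rw [Polynomial.map_monomial, Polynomial.C_mul_monomial, mul_comm]
    simp [Rat.mul_den_eq_num]

theorem exists_int_smul_polynomials (E : ℕ) (p : ℕ → Polynomial ℚ) :
    ∃ d : ℕ, 0 < d ∧ ∃ p' : ℕ → Polynomial ℤ,
      ∀ e ≤ E, (p' e).map (Int.castRingHom ℚ) = Polynomial.C (d : ℚ) * p e := by
  choose d hd p' hp' using fun e => exists_int_smul_polynomial (p e)
  refine ⟨∏ e ∈ Finset.range (E + 1), d e, Finset.prod_pos fun e _ => hd e,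
    fun e => Polynomial.C ((∏ i ∈ (Finset.range (E + 1)).erase e, d i : ℕ) : ℤ) * p' e, fun e he => ?_⟩
  rw [Polynomial.map_mul, hp', Polynomial.map_C,
    ← Finset.mul_prod_erase (Finset.range (E + 1)) d (by simp; omega : e ∈ _)]
  push_cast
  simp only [eq_intCast, Int.cast_natCast, Polynomial.C_mul, map_prod]
  ring

theorem exists_abs_eval_le (p : Polynomial ℤ) :
    ∃ H b : ℕ, ∀ n : ℕ, |p.eval (n : ℤ)| ≤ H * (n + 1) ^ b := by
  induction p using Polynomial.induction_on' with
  | add p q hp hq =>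
    obtain ⟨H, b, h⟩ := hp
    obtain ⟨H', b', h'⟩ := hq
    refine ⟨H + H', b + b', fun n => ?_⟩
    rw [Polynomial.eval_add]
    refine (abs_add_le _ _).trans ?_
    push_cast
    rw [add_mul]
    have hn : (1 : ℤ) ≤ n + 1 := by omega
    refine add_le_add ((h n).trans ?_) ((h' n).trans ?_)
    · gcongr
      omega
    · gcongr
      omega
  | monomial m a =>
    refine ⟨a.natAbs, m, fun n => ?_⟩
    rw [Polynomial.eval_monomial, abs_mul, abs_pow, Nat.abs_cast, Int.natCast_natAbs]
    gcongr
    omega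

/-- A sequence of rational vectors satisfying a polynomial recurrence has denominators and size
of factorial growth. -/
theorem exists_denominator_bound {ι : Type*} [Finite ι] (x : ℕ → ι → ℚ) (E : ℕ)
    (p : ℕ → Polynomial ℚ) (hE : p E ≠ 0)
    (hrec : ∀ (n : ℕ) i, ∑ e ∈ Finset.range (E + 1), (p e).eval (n : ℚ) * x (n + e) i = 0) :
    ∃ A B : ℕ, ∀ k, ∃ M : ℕ, 0 < M ∧ M ≤ A ^ (k + 1) * k.factorial ^ B ∧
      ∀ n ≤ k, ∀ i, ∃ y : ℤ, (M : ℚ) * x n i = y ∧ |y| ≤ A ^ (k + 1) * k.factorial ^ B := by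
  classical
  have := Fintype.ofFinite ι
  obtain ⟨d, hd, p', hp'⟩ := exists_int_smul_polynomials E p
  have hev : ∀ e ≤ E, ∀ n : ℕ, (((p' e).eval (n : ℤ) : ℤ) : ℚ) = d * (p e).eval (n : ℚ) := by
    intro e he n
    have := congrArg (Polynomial.eval (n : ℚ)) (hp' e he)
    rw [Polynomial.eval_mul, Polynomial.eval_C] at this
    rw [← this, Polynomial.eval_map, Polynomial.eval₂_at_natCast]
    simp
  obtain ⟨n₀, hn₀⟩ := exists_eval_natCast_ne_zero hE
  have hn₀' : ∀ n, n₀ ≤ n → (p' E).eval (n : ℤ) ≠ 0 := by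
    intro n hn h
    have := hev E le_rfl n
    rw [h, Int.cast_zero, eq_comm, mul_eq_zero] at this
    rcases this with h | h
    · rw [Nat.cast_eq_zero] at h; omega
    · exact hn₀ n hn h
  choose H b hHb using fun e => exists_abs_eval_le (p' e)
  set b' := ∑ e ∈ Finset.range (E + 1), b e with hb'
  set H' := (∑ e ∈ Finset.range (E + 1), H e) * 2 ^ b' with hH'
  have hbound : ∀ e ≤ E, ∀ n k : ℕ, n ≤ k → 1 ≤ k → |(p' e).eval (n : ℤ)| ≤ H' * k ^ b' := by
    intro e he n k hnk hk
    have h1 : H e ≤ ∑ e ∈ Finset.range (E + 1), H e :=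
      Finset.single_le_sum (f := H) (fun _ _ => Nat.zero_le _) (by simp; omega)
    have h2 : b e ≤ b' := Finset.single_le_sum (f := b) (fun _ _ => Nat.zero_le _) (by simp; omega)
    refine (hHb e n).trans ?_
    have h3 : (n + 1) ^ b e ≤ 2 ^ b' * k ^ b' := by
      rw [← mul_pow]
      exact (Nat.pow_le_pow_left (by omega) _).trans (Nat.pow_le_pow_right (by omega) h2)
    have h4 := Nat.mul_le_mul h1 h3
    rw [← mul_assoc] at h4
    exact_mod_cast h4
  -- common denominator and size of the initial terms
  set k₀ := n₀ + E with hk₀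
  set M₀ : ℕ := ∏ n ∈ Finset.range (k₀ + 1), ∏ i, (x n i).den with hM₀
  have hM₀pos : 0 < M₀ := Finset.prod_pos fun n _ => Finset.prod_pos fun i _ => (x n i).den_pos
  have hM₀int : ∀ n ≤ k₀, ∀ i, ∃ y : ℤ, (M₀ : ℚ) * x n i = y := by
    intro n hn i
    have h1 : (x n i).den ∣ M₀ :=
      (Finset.dvd_prod_of_mem (fun i => (x n i).den) (Finset.mem_univ i)).trans
        (Finset.dvd_prod_of_mem (fun n => ∏ i, (x n i).den) (by simp; omega))
    obtain ⟨c, hc⟩ := h1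
    refine ⟨c * (x n i).num, ?_⟩
    rw [hc]; push_cast
    rw [mul_comm ((x n i).den : ℚ), mul_assoc, Rat.den_mul_eq_num]
  choose! y₀ hy₀ using hM₀int
  set S₀ : ℕ := M₀ + ∑ n ∈ Finset.range (k₀ + 1), ∑ i, (y₀ n i).natAbs with hS₀
  have hS₀y : ∀ n ≤ k₀, ∀ i, |y₀ n i| ≤ S₀ := by
    intro n hn i
    have h1 : (y₀ n i).natAbs ≤ ∑ i, (y₀ n i).natAbs :=
      Finset.single_le_sum (f := fun i => (y₀ n i).natAbs) (fun _ _ => Nat.zero_le _) (Finset.mem_univ i)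
    have h2 : ∑ i, (y₀ n i).natAbs ≤ ∑ n ∈ Finset.range (k₀ + 1), ∑ i, (y₀ n i).natAbs :=
      Finset.single_le_sum (f := fun n => ∑ i, (y₀ n i).natAbs) (fun _ _ => Nat.zero_le _)
        (by simp; omega)
    rw [Int.abs_eq_natAbs]
    exact_mod_cast (h1.trans h2).trans (by omega)
  set A₁ := (E + 1) * (H' + 1) with hA₁
  have key : ∀ k, ∃ M : ℕ, 0 < M ∧ M ≤ S₀ * A₁ ^ k * k.factorial ^ b' ∧
      ∀ n ≤ k, ∀ i, ∃ y : ℤ, (M : ℚ) * x n i = y ∧ |y| ≤ S₀ * A₁ ^ k * k.factorial ^ b' := by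
    have hinit : ∀ k ≤ k₀, ∃ M : ℕ, 0 < M ∧ M ≤ S₀ * A₁ ^ k * k.factorial ^ b' ∧
        ∀ n ≤ k, ∀ i, ∃ y : ℤ, (M : ℚ) * x n i = y ∧ |y| ≤ S₀ * A₁ ^ k * k.factorial ^ b' := by
      intro k hk
      have h1 : S₀ ≤ S₀ * A₁ ^ k * k.factorial ^ b' := by
        rw [mul_assoc]
        refine Nat.le_mul_of_pos_right _ (Nat.mul_pos (pow_pos ?_ _) (pow_pos k.factorial_pos _))
        exact Nat.mul_pos (by omega) (by omega)
      exact ⟨M₀, hM₀pos, (Nat.le_add_right _ _).trans h1, fun n hn i =>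
        ⟨y₀ n i, hy₀ n (by omega) i, (hS₀y n (by omega) i).trans (by exact_mod_cast h1)⟩⟩
    intro k
    induction k with
    | zero => exact hinit 0 (Nat.zero_le _)
    | succ k ih =>
      rcases le_or_gt (k + 1) k₀ with hk | hk
      · exact hinit _ hk
      obtain ⟨M, hM, hM1, hMy⟩ := ih
      choose! y hy hy1 using hMy
      set m := k + 1 - E with hm
      have hmE : m + E = k + 1 := by omega
      set Q := (p' E).eval (m : ℤ) with hQ
      have hQ0 : Q ≠ 0 := hn₀' m (by omega)
      have hQle : Q.natAbs ≤ H' * (k + 1) ^ b' := by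
        have := hbound E le_rfl m (k + 1) (by omega) (by omega)
        rw [Int.abs_eq_natAbs] at this
        exact_mod_cast this
      set W := S₀ * A₁ ^ k * k.factorial ^ b' with hW
      have hW1 : (E + 1) * (H' * (k + 1) ^ b' * W) ≤ S₀ * A₁ ^ (k + 1) * (k + 1).factorial ^ b' := by
        rw [Nat.factorial_succ, mul_pow (k + 1), hW, pow_succ A₁]
        calc (E + 1) * (H' * (k + 1) ^ b' * (S₀ * A₁ ^ k * k.factorial ^ b'))
            = S₀ * (A₁ ^ k * ((E + 1) * H')) * ((k + 1) ^ b' * k.factorial ^ b') := by ring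
          _ ≤ _ := by
            gcongr
            exact Nat.mul_le_mul le_rfl (Nat.le_succ _)
      have hW2 : H' * (k + 1) ^ b' * W ≤ S₀ * A₁ ^ (k + 1) * (k + 1).factorial ^ b' :=
        (Nat.le_mul_of_pos_left _ (by omega)).trans hW1
      refine ⟨M * Q.natAbs, Nat.mul_pos hM (Int.natAbs_pos.mpr hQ0), ?_, fun n hn i => ?_⟩
      · rw [mul_comm]
        exact (Nat.mul_le_mul hQle hM1).trans hW2
      rcases Nat.lt_or_ge k n with hkn | hkn
      · obtain rfl : n = k + 1 := by omega
        refine ⟨-Q.sign * ∑ e ∈ Finset.range E, (p' e).eval (m : ℤ) * y (m + e) i, ?_, ?_⟩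
        · have h1 := hrec m i
          rw [Finset.sum_range_succ, hmE] at h1
          have h2 : (Q : ℚ) * x (k + 1) i =
              -∑ e ∈ Finset.range E, (((p' e).eval (m : ℤ) : ℤ) : ℚ) * x (m + e) i := by
            rw [hQ, hev E le_rfl]
            have : ∑ e ∈ Finset.range E, (((p' e).eval (m : ℤ) : ℤ) : ℚ) * x (m + e) i =
                d * ∑ e ∈ Finset.range E, (p e).eval (m : ℚ) * x (m + e) i := by
              rw [Finset.mul_sum]
              refine Finset.sum_congr rfl fun e he => ?_
              rw [hev e (by simp at he; omega), mul_assoc]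
            rw [this]
            linear_combination (d : ℚ) * h1
          have h3 : ((Q.natAbs : ℕ) : ℚ) = (Q.sign : ℚ) * Q := by
            have : ((Q.natAbs : ℤ)) = Q.sign * Q := (Int.sign_mul_self_eq_natAbs Q).symm
            rw [← Int.cast_natCast, this, Int.cast_mul]
          push_cast
          rw [h3]
          have h4 : ∑ e ∈ Finset.range E, (((p' e).eval (m : ℤ) : ℤ) : ℚ) * (y (m + e) i : ℚ) =
              M * ∑ e ∈ Finset.range E, (((p' e).eval (m : ℤ) : ℤ) : ℚ) * x (m + e) i := by
            rw [Finset.mul_sum]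
            refine Finset.sum_congr rfl fun e he => ?_
            rw [← hy (m + e) (by simp at he; omega) i]; ring
          rw [h4]
          linear_combination (M : ℚ) * (Q.sign : ℚ) * h2
        · have hs : |(-Q.sign)| ≤ 1 := by
            rw [abs_neg]
            rcases Int.sign_trichotomy Q with h | h | h <;> simp [h]
          rw [abs_mul]
          refine (mul_le_mul hs (Finset.abs_sum_le_sum_abs _ _) (abs_nonneg _) zero_le_one).trans ?_
          rw [one_mul]
          have h5 : ∀ e ∈ Finset.range E, |(p' e).eval (m : ℤ) * y (m + e) i| ≤
              ((H' * (k + 1) ^ b' * W : ℕ) : ℤ) := by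
            intro e he
            have he : e < E := by simpa using he
            rw [abs_mul]
            have h6 := hbound e he.le m (k + 1) (by omega) (by omega)
            have h7 := hy1 (m + e) (by omega) i
            push_cast at h6 ⊢
            rw [hW]
            push_cast
            exact mul_le_mul h6 h7 (abs_nonneg _) (by positivity)
          refine (Finset.sum_le_card_nsmul _ _ _ h5).trans ?_
          rw [Finset.card_range, nsmul_eq_mul]
          have h8 : E * (H' * (k + 1) ^ b' * W) ≤ S₀ * A₁ ^ (k + 1) * (k + 1).factorial ^ b' :=
            (Nat.mul_le_mul_right _ (Nat.le_succ E)).trans hW1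
          exact_mod_cast h8
      · refine ⟨Q.natAbs * y n i, ?_, ?_⟩
        · rw [Int.cast_mul, Int.cast_natCast, Nat.cast_mul, ← hy n hkn i]; ring
        · rw [abs_mul, Nat.abs_cast]
          have h1 := hy1 n hkn i
          have h2 : (Q.natAbs : ℤ) ≤ ((H' * (k + 1) ^ b' : ℕ) : ℤ) := by exact_mod_cast hQle
          have h3 : |y n i| ≤ (W : ℤ) := by rw [hW]; exact_mod_cast h1
          refine (mul_le_mul h2 h3 (abs_nonneg _) (by positivity)).trans ?_
          exact_mod_cast hW2
  refine ⟨S₀ + A₁, b', fun k => ?_⟩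
  have hle : S₀ * A₁ ^ k * k.factorial ^ b' ≤ (S₀ + A₁) ^ (k + 1) * k.factorial ^ b' := by
    rw [pow_succ']
    gcongr <;> omega
  obtain ⟨M, hM, hM1, h⟩ := key k
  refine ⟨M, hM, hM1.trans hle, fun n hn i => ?_⟩
  obtain ⟨y, hy, hy1⟩ := h n hn i
  exact ⟨y, hy, hy1.trans (by exact_mod_cast hle)⟩

/-! ### Auxiliary approximation forms -/

section Siegel

attribute [local instance] Matrix.seminormedAddCommGroup

/-- A form of Siegel's lemma with a natural number exponent. -/
theorem exists_small_int_solution {α β : Type*} [Fintype α] [Fintype β] (A : Matrix α β ℤ)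
    (hα : 0 < Fintype.card α) (hαβ : Fintype.card α < Fintype.card β) (E H : ℕ) (hH : 1 ≤ H)
    (hE : Fintype.card α ≤ E * (Fintype.card β - Fintype.card α)) (hA : ∀ i j, |A i j| ≤ H) :
    ∃ t : β → ℤ, t ≠ 0 ∧ A.mulVec t = 0 ∧
      ∀ j, |t j| ≤ (((Fintype.card β * H) ^ E : ℕ) : ℤ) := by
  obtain ⟨t, ht0, hAt, ht⟩ := Int.Matrix.exists_ne_zero_int_vec_norm_le A hαβ hα
  refine ⟨t, ht0, hAt, fun j => ?_⟩
  have hAn : ‖A‖ ≤ H := by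
    rw [Matrix.norm_le_iff (by positivity)]
    intro i j
    rw [Int.norm_eq_abs]
    exact_mod_cast hA i j
  have h1 : (1 : ℝ) ≤ H := by exact_mod_cast hH
  have hβ : (1 : ℝ) ≤ Fintype.card β := by exact_mod_cast (by omega : 1 ≤ Fintype.card β)
  have hd : (0 : ℝ) < (Fintype.card β : ℝ) - Fintype.card α := by
    rw [sub_pos]; exact_mod_cast hαβ
  have hle : ‖t‖ ≤ ((Fintype.card β : ℝ) * H) ^ E := by
    refine ht.trans ?_
    rw [← Real.rpow_natCast]
    calc _ ≤ ((Fintype.card β : ℝ) * H) ^ ((Fintype.card α : ℝ) / (Fintype.card β - Fintype.card α)) := by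
          gcongr
          exact max_le h1 hAn
      _ ≤ _ := by
          refine Real.rpow_le_rpow_of_exponent_le (by nlinarith) ?_
          rw [div_le_iff₀ hd]
          have : ((Fintype.card α : ℕ) : ℝ) ≤ ((E * (Fintype.card β - Fintype.card α) : ℕ) : ℝ) := by
            exact_mod_cast hE
          rwa [Nat.cast_mul, Nat.cast_sub hαβ.le] at this
  have := (norm_le_pi_norm t j).trans hle
  rw [Int.norm_eq_abs] at this
  exact_mod_cast this

end Siegel

/-- Geometric growth of the exponential coefficients and of their common denominators. -/
def SizeBound (C : ℕ) (f : PowerSeries ℚ) : Prop :=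
  (∀ n, |ecoeff n f| ≤ C ^ (n + 1)) ∧
    ∀ n, ∃ D : ℕ, 0 < D ∧ D ≤ C ^ (n + 1) ∧ ∀ i ≤ n, ∃ z : ℤ, (D : ℚ) * ecoeff i f = z

theorem SizeBound.one_le {C : ℕ} {f : PowerSeries ℚ} (h : SizeBound C f) : 1 ≤ C := by
  obtain ⟨D, hD, hDC, -⟩ := h.2 0
  by_contra hC
  have : C = 0 := by omega
  subst this
  simp at hDC
  omega

/-- Existence of a good approximation form of the derivatives of `f` at the origin, in terms of
exponential coefficients. -/
theorem SizeBound.exists_approximation {C : ℕ} {f : PowerSeries ℚ} (hf : SizeBound C f) (s q : ℕ)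
    (hq : 2 ≤ q) :
    ∃ C' : ℕ, ∀ N, 1 ≤ N → ∃ x : Fin (s + 1) → ℕ → ℤ, x ≠ 0 ∧ (∀ j i, q * N < i → x j i = 0) ∧
      (∀ j i, |x j i| ≤ C' ^ (N + 1)) ∧
      ∀ m < ((s + 1) * q - 1) * N, ∑ j, ∑ i ∈ Finset.range (m + 1),
        (m.choose i : ℚ) * x j i * ecoeff (m - i + j) f = 0 := by
  have hC := hf.one_le
  set S := s + 1 with hS
  refine ⟨(2 * C) ^ (4 * S * (q + 1) * (S * q)), fun N hN => ?_⟩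
  set M₁ := (S * q - 1) * N with hM₁
  have hSq : 2 ≤ S * q := by nlinarith
  have hM₁' : M₁ + N = S * q * N := by
    rw [hM₁, ← Nat.succ_mul, Nat.succ_eq_add_one, Nat.sub_add_cancel (by omega)]
  obtain ⟨D, hD, hDC, hDz⟩ := hf.2 (M₁ + s)
  choose! z hz using hDz
  let A : Matrix (Fin M₁) (Fin S × Fin (q * N + 1)) ℤ := fun m ji =>
    if (ji.2 : ℕ) ≤ m then ((m : ℕ).choose ji.2 : ℤ) * z (m - ji.2 + ji.1) else 0
  have hcα : Fintype.card (Fin M₁) = M₁ := Fintype.card_fin _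
  have hcβ : Fintype.card (Fin S × Fin (q * N + 1)) = M₁ + N + S := by
    rw [Fintype.card_prod, Fintype.card_fin, Fintype.card_fin, hM₁']; ring
  have hM₁0 : 0 < M₁ := by
    rw [hM₁]; apply Nat.mul_pos <;> omega
  have hzb : ∀ i ≤ M₁ + s, |z i| ≤ ((C ^ (2 * (M₁ + s + 1)) : ℕ) : ℤ) := by
    intro i hi
    have h1 : (|z i| : ℚ) = D * |ecoeff i f| := by
      rw [← hz i hi, abs_mul, Nat.abs_cast]
    have h2 : (|z i| : ℚ) ≤ C ^ (M₁ + s + 1) * C ^ (M₁ + s + 1) := by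
      rw [h1]
      have h3 : (D : ℚ) ≤ C ^ (M₁ + s + 1) := by exact_mod_cast hDC
      have h4 : |ecoeff i f| ≤ (C : ℚ) ^ (M₁ + s + 1) :=
        (hf.1 i).trans (pow_le_pow_right₀ (by exact_mod_cast hC) (by omega))
      gcongr
    rw [← pow_add, ← two_mul] at h2
    exact_mod_cast h2
  have hA : ∀ i j, |A i j| ≤ ((2 ^ M₁ * C ^ (2 * (M₁ + s + 1)) : ℕ) : ℤ) := by
    intro m ji
    simp only [A]
    split_ifs with h
    · rw [abs_mul, Nat.abs_cast, Nat.cast_mul]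
      have h1 : (m : ℕ).choose ji.2 ≤ 2 ^ M₁ :=
        (Nat.choose_le_two_pow _ _).trans (Nat.pow_le_pow_right (by norm_num) m.2.le)
      have h2 := hzb ((m : ℕ) - ji.2 + ji.1) (by have := m.2; have := ji.1.2; omega)
      have h3 : (((m : ℕ).choose ji.2 : ℕ) : ℤ) ≤ ((2 ^ M₁ : ℕ) : ℤ) := by exact_mod_cast h1
      exact mul_le_mul h3 h2 (abs_nonneg _) (by positivity)
    · rw [abs_zero]; positivity
  obtain ⟨t, ht0, hAt, ht⟩ := exists_small_int_solution A (by omega) (by omega) (S * q)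
    (2 ^ M₁ * C ^ (2 * (M₁ + s + 1))) (Nat.one_le_iff_ne_zero.2 (by positivity))
    (by rw [hcα, hcβ]
        calc M₁ ≤ S * q * N := by omega
          _ ≤ _ := Nat.mul_le_mul_left _ (by omega)) hA
  refine ⟨fun j i => if h : i < q * N + 1 then t (j, ⟨i, h⟩) else 0, ?_, ?_, ?_, ?_⟩
  · intro h
    apply ht0
    ext ⟨j, i⟩
    have := congrFun (congrFun h j) i
    simpa [Nat.lt_succ_iff.1 i.2] using this
  · intro j i hi
    beta_reduce
    rw [dif_neg (by omega)]
  · intro j i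
    have key : (((Fintype.card (Fin S × Fin (q * N + 1)) *
        (2 ^ M₁ * C ^ (2 * (M₁ + s + 1)))) ^ (S * q) : ℕ) : ℤ) ≤
        (((2 * C) ^ (4 * S * (q + 1) * (S * q)) : ℕ) : ℤ) ^ (N + 1) := by
      rw [← Nat.cast_pow, Nat.cast_le, ← pow_mul]
      rw [show 4 * S * (q + 1) * (S * q) * (N + 1) = 4 * S * (q + 1) * (N + 1) * (S * q) by ring,
        pow_mul (2 * C) _ (S * q)]
      refine Nat.pow_le_pow_left ?_ _
      rw [hcβ]
      calc (M₁ + N + S) * (2 ^ M₁ * C ^ (2 * (M₁ + s + 1)))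
          ≤ 2 ^ (M₁ + N + S) * (2 ^ M₁ * C ^ (2 * (M₁ + s + 1))) := by
            gcongr; exact Nat.lt_two_pow_self.le
        _ = 2 ^ (M₁ + N + S + M₁) * C ^ (2 * (M₁ + s + 1)) := by ring
        _ ≤ 2 ^ (4 * S * (q + 1) * (N + 1)) * C ^ (4 * S * (q + 1) * (N + 1)) := by
            have hb : 4 * S * (q + 1) * (N + 1) = 4 * (S * q * N) + 4 * S * N + 4 * (S * q) + 4 * S := by
              ring
            have hSN : N ≤ S * N := Nat.le_mul_of_pos_left _ (by omega)
            have hb' : 4 * S * N = 4 * (S * N) := by ring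
            refine Nat.mul_le_mul (Nat.pow_le_pow_right (by norm_num) ?_) (Nat.pow_le_pow_right hC ?_) <;>
              rw [hb, hb', ← hM₁'] <;> omega
        _ = _ := by rw [mul_pow]
    beta_reduce
    split_ifs with h
    · exact (ht _).trans (by exact_mod_cast key)
    · rw [abs_zero]; positivity
  · intro m hm
    have h1 := congrFun hAt ⟨m, hm⟩
    have hD' : (D : ℚ) ≠ 0 := by exact_mod_cast hD.ne'
    apply mul_left_cancel₀ hD'
    rw [mul_zero, Finset.mul_sum]
    have h2 : ∑ j : Fin S, ∑ i : Fin (q * N + 1), ((A ⟨m, hm⟩ (j, i) * t (j, i) : ℤ) : ℚ) = 0 := by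
      rw [Matrix.mulVec, dotProduct, Fintype.sum_prod_type] at h1
      exact_mod_cast h1
    rw [← h2]
    refine Finset.sum_congr rfl fun j _ => ?_
    rw [Finset.mul_sum]
    let g : ℕ → ℚ := fun i => if i ≤ m then
      ((m.choose i : ℤ) * z (m - i + j) : ℤ) * (if h : i < q * N + 1 then t (j, ⟨i, h⟩) else 0 : ℤ) else 0
    have e1 : ∑ i : Fin (q * N + 1), ((A ⟨m, hm⟩ (j, i) * t (j, i) : ℤ) : ℚ) =
        ∑ i ∈ Finset.range (q * N + 1), g i := by
      rw [← Fin.sum_univ_eq_sum_range]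
      refine Finset.sum_congr rfl fun i _ => ?_
      simp only [A, g]
      split_ifs with h1 h2
      · simp
      · exact absurd i.2 h2
      · simp
    have e2 : ∑ i ∈ Finset.range (m + 1), g i = ∑ i ∈ Finset.range (q * N + 1), g i := by
      rcases le_total (m + 1) (q * N + 1) with h | h
      · refine Finset.sum_subset (Finset.range_mono h) fun i _ hi => ?_
        simp only [g]; rw [if_neg (by simpa using hi)]
      · symm
        refine Finset.sum_subset (Finset.range_mono h) fun i _ hi => ?_
        simp only [g]; rw [dif_neg (by simpa using hi)]; simp
    rw [e1, ← e2]
    refine Finset.sum_congr rfl fun i hi => ?_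
    have hi : i ≤ m := by simp at hi; omega
    simp only [g]
    rw [if_pos hi]
    push_cast
    rw [← hz (m - i + j) (by have := j.2; omega)]
    ring

/-! ### Coefficientwise linear maps and rational entire series -/

section CoeffMap

variable {k A B : Type*} [CommRing k] [CommRing A] [Algebra k A] [CommRing B] [Algebra k B]

/-- Apply a linear map to every coefficient of a power series. -/
def coeffMap (l : A →ₗ[k] B) : PowerSeries A →ₗ[k] PowerSeries B where
  toFun h := mk fun n => l (coeff n h)
  map_add' g h := by ext n; simp
  map_smul' c h := by
    ext n
    simp

@[simp]
theorem coeff_coeffMap (l : A →ₗ[k] B) (n : ℕ) (h : PowerSeries A) :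
    coeff n (coeffMap l h) = l (coeff n h) := by
  simp [coeffMap]

theorem coeffMap_map_mul (l : A →ₗ[k] B) (p : PowerSeries k) (h : PowerSeries A) :
    coeffMap l (map (algebraMap k A) p * h) = map (algebraMap k B) p * coeffMap l h := by
  ext n
  rw [coeff_coeffMap, coeff_mul, coeff_mul, map_sum]
  refine Finset.sum_congr rfl fun i _ => ?_
  rw [coeff_map, coeff_map, coeff_coeffMap, ← Algebra.smul_def, ← Algebra.smul_def, map_smul]

theorem coeffMap_derivative (l : A →ₗ[k] B) (h : PowerSeries A) :
    coeffMap l (d⁄dX A h) = d⁄dX B (coeffMap l h) := by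
  ext n
  rw [coeff_coeffMap, coeff_derivative, coeff_derivative, coeff_coeffMap]
  have h1 : ∀ x : A, x * ((n : A) + 1) = (n + 1) • x := fun x => by
    rw [nsmul_eq_mul]; push_cast; ring
  have h2 : ∀ x : B, x * ((n : B) + 1) = (n + 1) • x := fun x => by
    rw [nsmul_eq_mul]; push_cast; ring
  rw [h1, h2, map_nsmul]

theorem map_derivative (h : PowerSeries k) :
    map (algebraMap k A) (d⁄dX k h) = d⁄dX A (map (algebraMap k A) h) := by
  ext n
  simp [coeff_derivative]

theorem map_iterate_derivative (j : ℕ) (h : PowerSeries k) :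
    map (algebraMap k A) ((d⁄dX k)^[j] h) = (d⁄dX A)^[j] (map (algebraMap k A) h) := by
  induction j with
  | zero => rfl
  | succ j ih => rw [Function.iterate_succ_apply', Function.iterate_succ_apply', map_derivative, ih]

theorem ecoeff_coeffMap (l : A →ₗ[k] B) (n : ℕ) (h : PowerSeries A) :
    ecoeff n (coeffMap l h) = l (ecoeff n h) := by
  rw [ecoeff, ecoeff, coeff_coeffMap, ← nsmul_eq_mul, ← nsmul_eq_mul, map_nsmul]

theorem ecoeff_map (n : ℕ) (h : PowerSeries k) :
    ecoeff n (map (algebraMap k A) h) = algebraMap k A (ecoeff n h) := by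
  simp [ecoeff]

end CoeffMap

theorem coeff_eq_ecoeff_div {k : Type*} [Field k] [CharZero k] (n : ℕ) (h : PowerSeries k) :
    coeff n h = ecoeff n h / n.factorial := by
  have : (n.factorial : k) ≠ 0 := by exact_mod_cast n.factorial_ne_zero
  rw [ecoeff]; field_simp

/-- Rational power series with infinite radius of convergence. -/
def entireRat : Subring (PowerSeries ℚ) :=
  entirePS.toSubring.comap (PowerSeries.map (algebraMap ℚ ℂ))

theorem mem_entireRat {f : PowerSeries ℚ} :
    f ∈ entireRat ↔ map (algebraMap ℚ ℂ) f ∈ entirePS := Iff.rfl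

theorem derivative_mem_entireRat {f : PowerSeries ℚ} (hf : f ∈ entireRat) :
    d⁄dX ℚ f ∈ entireRat := by
  rw [mem_entireRat, map_derivative]
  exact derivative_mem_entirePS hf

theorem iterate_derivative_mem_entireRat {f : PowerSeries ℚ} (hf : f ∈ entireRat) (k : ℕ) :
    (d⁄dX ℚ)^[k] f ∈ entireRat := by
  rw [mem_entireRat, map_iterate_derivative]
  exact iterate_derivative_mem_entirePS hf k

theorem map_coe_polynomial {k A : Type*} [CommRing k] [CommRing A] [Algebra k A] (p : Polynomial k) :
    map (algebraMap k A) (p : PowerSeries k) = ((p.map (algebraMap k A) : Polynomial A) : PowerSeries A) := by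
  ext n; simp

theorem polynomial_mem_entireRat (p : Polynomial ℚ) : (p : PowerSeries ℚ) ∈ entireRat := by
  rw [mem_entireRat, map_coe_polynomial]
  exact polynomial_mem_entirePS _

theorem diffVal_mem_entireRat {s : ℕ} {f : PowerSeries ℚ} (hf : f ∈ entireRat)
    (c : Fin (s + 1) → Polynomial ℚ) : diffVal f c ∈ entireRat :=
  sum_mem fun _ _ => mul_mem (polynomial_mem_entireRat _) (iterate_derivative_mem_entireRat hf _)

/-- The Taylor expansion at `1` of a rational entire series. -/
def taylorRat : entireRat →+* PowerSeries ℂ :=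
  (taylorHom : entirePS →+* PowerSeries ℂ).comp
    ((PowerSeries.map (algebraMap ℚ ℂ)).restrict entireRat entirePS.toSubring fun _ h => h)

theorem taylorRat_apply (f : entireRat) : taylorRat f = taylorFun (map (algebraMap ℚ ℂ) f.1) := rfl

theorem taylorRat_injective : Function.Injective taylorRat := by
  rw [injective_iff_map_eq_zero]
  intro f hf
  have := taylorFun_eq_zero f.2 hf
  apply Subtype.ext
  exact (map_eq_zero_iff _ (PowerSeries.map_injective _ (algebraMap ℚ ℂ).injective)).1 this

theorem derivative_taylorRat (f : entireRat) :
    d⁄dX ℂ (taylorRat f) = taylorRat ⟨_, derivative_mem_entireRat f.2⟩ := by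
  rw [taylorRat_apply, taylorRat_apply, derivative_taylorFun, map_derivative]

theorem iterate_derivative_taylorRat (f : entireRat) (k : ℕ) :
    (d⁄dX ℂ)^[k] (taylorRat f) = taylorRat ⟨_, iterate_derivative_mem_entireRat f.2 k⟩ := by
  induction k with
  | zero => rfl
  | succ k ih =>
    rw [Function.iterate_succ_apply', ih, derivative_taylorRat]
    congr 1
    apply Subtype.ext
    change _ = (d⁄dX ℚ)^[k + 1] f.1
    rw [Function.iterate_succ_apply']

/-- Translation of the variable by `1`. -/
def shiftPoly (p : Polynomial ℚ) : Polynomial ℚ := p.comp (Polynomial.X + 1)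

theorem taylorRat_polynomial (p : Polynomial ℚ) :
    taylorRat ⟨p, polynomial_mem_entireRat p⟩ = map (algebraMap ℚ ℂ) (shiftPoly p : PowerSeries ℚ) := by
  let φ : Polynomial ℚ →+* PowerSeries ℂ := taylorRat.comp
    ((Polynomial.coeToPowerSeries.ringHom).codRestrict entireRat polynomial_mem_entireRat)
  let ψ : Polynomial ℚ →+* PowerSeries ℂ := (PowerSeries.map (algebraMap ℚ ℂ)).comp
    ((Polynomial.coeToPowerSeries.ringHom).comp (Polynomial.compRingHom (Polynomial.X + 1)))
  have h : φ = ψ := by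
    refine Polynomial.ringHom_ext' (Subsingleton.elim _ _) ?_
    have h1 : φ Polynomial.X = taylorFun X := by
      change taylorFun (map (algebraMap ℚ ℂ) ((Polynomial.X : Polynomial ℚ) : PowerSeries ℚ)) = _
      simp
    rw [h1, taylorFun_X]
    simp [ψ]
  exact RingHom.congr_fun h p

theorem ecoeff_taylorRat (f : entireRat) (k : ℕ) :
    ecoeff k (taylorRat f) = psEval ((d⁄dX ℂ)^[k] (map (algebraMap ℚ ℂ) f.1)) 1 := by
  have : (k.factorial : ℂ) ≠ 0 := by exact_mod_cast k.factorial_ne_zero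
  rw [ecoeff, taylorRat_apply, coeff_taylorFun]
  field_simp

theorem taylorRat_diffVal {s : ℕ} (f : entireRat) (c : Fin (s + 1) → Polynomial ℚ) :
    taylorRat ⟨_, diffVal_mem_entireRat f.2 c⟩ =
      ∑ j, map (algebraMap ℚ ℂ) (shiftPoly (c j) : PowerSeries ℚ) * (d⁄dX ℂ)^[j] (taylorRat f) := by
  have : (⟨_, diffVal_mem_entireRat f.2 c⟩ : entireRat) =
      ∑ j, (⟨_, polynomial_mem_entireRat (c j)⟩ : entireRat) *
        ⟨_, iterate_derivative_mem_entireRat f.2 j⟩ := by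
    apply Subtype.ext
    simp [diffVal]
  rw [this, map_sum]
  refine Finset.sum_congr rfl fun j _ => ?_
  rw [map_mul, taylorRat_polynomial, iterate_derivative_taylorRat]

theorem SizeBound.mem_entireRat {C : ℕ} {f : PowerSeries ℚ} (hf : SizeBound C f) :
    f ∈ entireRat := by
  rw [_root_.mem_entireRat, mem_entirePS]
  intro r hr
  have h := (Real.summable_pow_div_factorial (C * r)).mul_left (C : ℝ)
  refine Summable.of_nonneg_of_le (fun n => by positivity) (fun n => ?_) h
  have h1 := hf.1 n
  have h2 : ((|ecoeff n f| : ℚ) : ℝ) ≤ C ^ (n + 1) := by exact_mod_cast h1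
  rw [coeff_map, coeff_eq_ecoeff_div, eq_ratCast, Rat.cast_div, norm_div, Rat.cast_natCast,
    Complex.norm_natCast, Complex.norm_ratCast, ← Rat.cast_abs]
  rw [mul_pow]
  have h3 : (0 : ℝ) < n.factorial := by exact_mod_cast n.factorial_pos
  calc ((|ecoeff n f| : ℚ) : ℝ) / n.factorial * r ^ n ≤ C ^ (n + 1) / n.factorial * r ^ n := by gcongr
    _ = _ := by ring

/-- An entire series vanishing to high order at the origin has small derivatives at `1`. -/
theorem norm_ecoeff_taylorRat_le {C m₁ k : ℕ} {H : ℝ} (R : entireRat)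
    (hR : ∀ m, ((|ecoeff m R.1| : ℚ) : ℝ) ≤ H * C ^ (m + 1)) (h0 : ∀ m < m₁, ecoeff m R.1 = 0)
    (hk : k ≤ m₁) :
    ‖ecoeff k (taylorRat R)‖ ≤ H * C ^ (m₁ + 1) * Real.exp C / (m₁ - k).factorial := by
  obtain ⟨l, rfl⟩ := Nat.exists_eq_add_of_le hk
  rw [Nat.add_sub_cancel_left, ecoeff_taylorRat]
  have hterm : ∀ m, coeff m ((d⁄dX ℂ)^[k] (map (algebraMap ℚ ℂ) R.1)) * (1 : ℂ) ^ m =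
      ((ecoeff (m + k) R.1 : ℚ) : ℂ) / m.factorial := by
    intro m
    rw [one_pow, mul_one, coeff_eq_ecoeff_div, ecoeff_iterate_derivative, ecoeff_map, eq_ratCast]
  have hs : Summable fun m => ‖coeff m ((d⁄dX ℂ)^[k] (map (algebraMap ℚ ℂ) R.1)) * (1 : ℂ) ^ m‖ :=
    summable_norm_psEval (iterate_derivative_mem_entirePS R.2 k) 1
  rw [psEval]
  have hexp : HasSum (fun n : ℕ => (C : ℝ) ^ n / n.factorial) (Real.exp C) := by
    rw [Real.exp_eq_exp_ℝ]; exact NormedSpace.expSeries_div_hasSum_exp _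
  refine (norm_tsum_le_tsum_norm hs).trans ?_
  rw [← hs.sum_add_tsum_nat_add l]
  have hz : ∑ i ∈ Finset.range l, ‖coeff i ((d⁄dX ℂ)^[k] (map (algebraMap ℚ ℂ) R.1)) * (1 : ℂ) ^ i‖ = 0 := by
    refine Finset.sum_eq_zero fun i hi => ?_
    rw [hterm, h0 _ (by simp at hi; omega)]; simp
  rw [hz, zero_add, mul_div_right_comm, ← hexp.tsum_eq, ← tsum_mul_left]
  refine Summable.tsum_le_tsum (fun i => ?_) ((summable_nat_add_iff l).2 hs) (hexp.summable.mul_left _)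
  rw [hterm, norm_div, Complex.norm_ratCast, ← Rat.cast_abs, Complex.norm_natCast]
  have h1 := hR (i + l + k)
  have hl : (0 : ℝ) < l.factorial := by exact_mod_cast l.factorial_pos
  have hi : (0 : ℝ) < i.factorial := by exact_mod_cast i.factorial_pos
  have h2 : (i.factorial : ℝ) * l.factorial ≤ (i + l).factorial := by
    exact_mod_cast Nat.le_of_dvd (Nat.factorial_pos _) (Nat.factorial_mul_factorial_dvd_factorial_add i l)
  have h3 : 0 ≤ H * C ^ (i + l + k + 1) := le_trans (by positivity) h1
  calc _ ≤ H * C ^ (i + l + k + 1) / (i.factorial * l.factorial) := by gcongr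
    _ = _ := by
      rw [show i + l + k + 1 = (k + l + 1) + i by ring, pow_add]; field_simp

/-! ### Derivatives at `1` of the approximation forms -/

theorem shiftPoly_ne_zero {p : Polynomial ℚ} (hp : p ≠ 0) : shiftPoly p ≠ 0 := by
  have : shiftPoly p = Polynomial.taylor 1 p := by simp [shiftPoly, Polynomial.taylor_apply]
  rw [this]
  simpa using hp

theorem X_pow_dvd_coe_iff {n : ℕ} {p : Polynomial ℚ} :
    (X : PowerSeries ℚ) ^ n ∣ (p : PowerSeries ℚ) ↔ Polynomial.X ^ n ∣ p := by
  rw [PowerSeries.X_pow_dvd_iff, Polynomial.X_pow_dvd_iff]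
  simp

theorem sub_one_pow_dvd_of_X_pow_dvd_shiftPoly {n : ℕ} {p : Polynomial ℚ}
    (h : Polynomial.X ^ n ∣ shiftPoly p) : (Polynomial.X - 1) ^ n ∣ p := by
  obtain ⟨u, hu⟩ := h
  refine ⟨u.comp (Polynomial.X - 1), ?_⟩
  have := congrArg (fun u => u.comp (Polynomial.X - 1)) hu
  simpa [shiftPoly, Polynomial.comp_assoc] using this

theorem X_pow_dvd_of_dvd_mul {n k : ℕ} {p h : PowerSeries ℚ} (hk : coeff k h ≠ 0)
    (hd : X ^ n ∣ p * h) : X ^ (n - k) ∣ p := by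
  have h0 : h ≠ 0 := by rintro rfl; simp at hk
  obtain ⟨u, hu⟩ := X_pow_order_dvd (φ := h)
  set o := h.order.toNat with ho
  have hok : o ≤ k := by
    by_contra hlt
    push Not at hlt
    exact hk (X_pow_dvd_iff.1 ⟨u, hu⟩ k hlt)
  have hXu : ¬ (X : PowerSeries ℚ) ∣ u := by
    rintro ⟨w, rfl⟩
    have h1 : coeff o h = 0 := by
      have hd' : X ^ (o + 1) ∣ h := ⟨w, by rw [hu]; ring⟩
      exact X_pow_dvd_iff.1 hd' o (by omega)
    exact coeff_order h0 h1
  rcases le_total n o with hno | hno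
  · rw [Nat.sub_eq_zero_of_le (by omega)]; simp
  · obtain ⟨j, rfl⟩ := Nat.exists_eq_add_of_le hno
    have hX : (X : PowerSeries ℚ) ^ o ≠ 0 := pow_ne_zero _ X_ne_zero
    have h2 : X ^ j ∣ p * u := by
      rw [hu, pow_add, mul_left_comm] at hd
      exact (mul_dvd_mul_iff_left hX).1 hd
    have h3 : X ^ j ∣ p := X_prime.pow_dvd_of_dvd_mul_right _ hXu h2
    exact (pow_dvd_pow _ (by omega)).trans h3

theorem mul_iterate_mem_entireRat (T : Polynomial ℚ) {R : PowerSeries ℚ} (hR : R ∈ entireRat) (k : ℕ) :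
    (fun x => (T : PowerSeries ℚ) * d⁄dX ℚ x)^[k] R ∈ entireRat := by
  induction k with
  | zero => exact hR
  | succ k ih =>
    rw [Function.iterate_succ_apply']
    exact mul_mem (polynomial_mem_entireRat T) (derivative_mem_entireRat ih)

/-- The Taylor expansion at `1` followed by a coefficientwise linear functional. -/
def taylorFunctional (l : ℂ →ₗ[ℚ] ℚ) (f : entireRat) : PowerSeries ℚ := coeffMap l (taylorRat f)

section

variable (l : ℂ →ₗ[ℚ] ℚ)

theorem taylorFunctional_mul (p : Polynomial ℚ) {f : PowerSeries ℚ} (hf : f ∈ entireRat)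
    (h : (p : PowerSeries ℚ) * f ∈ entireRat) :
    taylorFunctional l ⟨(p : PowerSeries ℚ) * f, h⟩ =
      (shiftPoly p : PowerSeries ℚ) * taylorFunctional l ⟨f, hf⟩ := by
  have : (⟨(p : PowerSeries ℚ) * f, h⟩ : entireRat) =
    ⟨_, polynomial_mem_entireRat p⟩ * ⟨f, hf⟩ := rfl
  rw [taylorFunctional, this, map_mul, taylorRat_polynomial, coeffMap_map_mul]
  simp [taylorFunctional]

theorem taylorFunctional_iterate (T : Polynomial ℚ) (R : entireRat) (k : ℕ) :
    taylorFunctional l ⟨_, mul_iterate_mem_entireRat T R.2 k⟩ =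
      (fun x => (shiftPoly T : PowerSeries ℚ) * d⁄dX ℚ x)^[k] (taylorFunctional l R) := by
  induction k with
  | zero => rfl
  | succ k ih =>
    have hit : (fun x => (shiftPoly T : PowerSeries ℚ) * d⁄dX ℚ x)^[k + 1] (taylorFunctional l R) =
        (shiftPoly T : PowerSeries ℚ) * d⁄dX ℚ
          ((fun x => (shiftPoly T : PowerSeries ℚ) * d⁄dX ℚ x)^[k] (taylorFunctional l R)) :=
      Function.iterate_succ_apply' _ _ _
    rw [hit, ← ih]
    have h := mul_iterate_mem_entireRat T R.2 k
    have h1 := taylorFunctional_mul l T (derivative_mem_entireRat h)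
      (mul_mem (polynomial_mem_entireRat T) (derivative_mem_entireRat h))
    have h2 : taylorFunctional l ⟨_, derivative_mem_entireRat h⟩ =
        d⁄dX ℚ (taylorFunctional l ⟨_, h⟩) := by
      rw [taylorFunctional, taylorFunctional, ← coeffMap_derivative, derivative_taylorRat]
    rw [← h2, ← h1]
    congr 1
    apply Subtype.ext
    change (fun x => (T : PowerSeries ℚ) * d⁄dX ℚ x)^[k + 1] R.1 = _
    rw [Function.iterate_succ_apply']

/-- If the relation `∑ b_k (T ∂)^k R = Δ f` holds and a functional kills many Taylor coefficients
of `R` at `1` but not all those of `f`, then `Δ` vanishes to high order at `1`. -/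
theorem sub_one_pow_dvd_of_functional {s K n₀ : ℕ} {f R : entireRat} {T Δ : Polynomial ℚ}
    {b : Fin (s + 1) → Polynomial ℚ}
    (h : ∑ k, (b k : PowerSeries ℚ) * (fun x => (T : PowerSeries ℚ) * d⁄dX ℚ x)^[k] R.1 = Δ * f.1)
    (hR : ∀ k ≤ K, l (ecoeff k (taylorRat R)) = 0) (hf : l (ecoeff n₀ (taylorRat f)) ≠ 0) :
    (Polynomial.X - 1) ^ (K + 1 - s - n₀) ∣ Δ := by
  refine sub_one_pow_dvd_of_X_pow_dvd_shiftPoly (X_pow_dvd_coe_iff.1 ?_)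
  have hfac : ∀ n : ℕ, (n.factorial : ℚ) ≠ 0 := fun n => by exact_mod_cast n.factorial_ne_zero
  refine X_pow_dvd_of_dvd_mul (h := taylorFunctional l f) ?_ ?_
  · rw [coeff_eq_ecoeff_div, taylorFunctional, ecoeff_coeffMap]
    exact div_ne_zero hf (hfac _)
  · have hRX : X ^ (K + 1) ∣ taylorFunctional l R := by
      rw [X_pow_dvd_iff]
      intro m hm
      rw [coeff_eq_ecoeff_div, taylorFunctional, ecoeff_coeffMap, hR m (by omega), zero_div]
    have e1 := taylorFunctional_mul l Δ f.2 (mul_mem (polynomial_mem_entireRat Δ) f.2)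
    have e2 : (⟨_, mul_mem (polynomial_mem_entireRat Δ) f.2⟩ : entireRat) =
        ∑ k, ⟨_, mul_mem (polynomial_mem_entireRat (b k)) (mul_iterate_mem_entireRat T R.2 k)⟩ := by
      apply Subtype.ext
      rw [AddSubmonoidClass.coe_finsetSum]
      exact h.symm
    rw [← e1, e2, taylorFunctional, map_sum, map_sum]
    refine Finset.dvd_sum fun k _ => ?_
    have e3 := taylorFunctional_mul l (b k) (mul_iterate_mem_entireRat T R.2 k)
      (mul_mem (polynomial_mem_entireRat (b k)) (mul_iterate_mem_entireRat T R.2 k))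
    rw [taylorFunctional] at e3
    rw [e3, taylorFunctional_iterate]
    refine Dvd.dvd.mul_left ((pow_dvd_pow _ ?_).trans
      (X_pow_dvd_iterate_mul_derivative _ hRX k)) _
    omega

end

/-- A sequence satisfying a polynomial recurrence spans a space generated by finitely many terms. -/
theorem exists_span_range_eq_of_recurrence {k V : Type*} [Field k] [CharZero k] [AddCommGroup V]
    [Module k V] (v : ℕ → V) (E : ℕ) (p : ℕ → Polynomial k) (hE : p E ≠ 0)
    (hrec : ∀ n : ℕ, ∑ e ∈ Finset.range (E + 1), (p e).eval (n : k) • v (n + e) = 0) :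
    ∃ n₀, Submodule.span k (Set.range v) = Submodule.span k (v '' Set.Iio n₀) := by
  obtain ⟨n₁, hn₁⟩ := exists_eval_natCast_ne_zero hE
  refine ⟨n₁ + E, le_antisymm (Submodule.span_le.2 ?_) (Submodule.span_mono (Set.image_subset_range _ _))⟩
  rintro _ ⟨m, rfl⟩
  induction m using Nat.strong_induction_on with
  | _ m ih =>
    rcases lt_or_ge m (n₁ + E) with h | h
    · exact Submodule.subset_span ⟨m, h, rfl⟩
    · obtain ⟨n, rfl⟩ : ∃ n, m = n + E := ⟨m - E, by omega⟩
      have h1 := hrec n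
      rw [Finset.sum_range_succ, add_comm, add_eq_zero_iff_eq_neg] at h1
      have h2 : (p E).eval (n : k) • v (n + E) ∈ Submodule.span k (v '' Set.Iio (n₁ + E)) := by
        rw [h1]
        refine neg_mem (sum_mem fun e he => Submodule.smul_mem _ _ (ih _ ?_))
        simp at he; omega
      exact (Submodule.smul_mem_iff _ (hn₁ n (by omega))).1 h2

/-- The Taylor coefficients at `1` of a solution of a differential equation satisfy a recurrence. -/
theorem exists_recurrence_taylorRat {s : ℕ} {f : entireRat} {T : Polynomial ℚ}
    {U : Fin (s + 1) → Polynomial ℚ} (hT0 : T ≠ 0)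
    (hT : (T : PowerSeries ℚ) * (d⁄dX ℚ)^[s + 1] f.1 = diffVal f.1 U) :
    ∃ (E : ℕ) (p : ℕ → Polynomial ℚ), p E ≠ 0 ∧ ∀ n : ℕ, ∑ e ∈ Finset.range (E + 1),
      (p e).eval (n : ℚ) • ecoeff (n + e) (taylorRat f) = 0 := by
  refine exists_recurrence (s + 1)
    (fun j => if h : j < s + 1 then - shiftPoly (U ⟨j, h⟩) else shiftPoly T)
    ⟨s + 1, le_rfl, by simpa using shiftPoly_ne_zero hT0⟩ (taylorRat f) ?_
  rw [Finset.sum_range_succ, ← Fin.sum_univ_eq_sum_range (fun j => (((dite (j < s + 1)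
    (fun h => - shiftPoly (U ⟨j, h⟩)) (fun _ => shiftPoly T)).map (algebraMap ℚ ℂ) : Polynomial ℂ) :
    PowerSeries ℂ) * (d⁄dX ℂ)^[j] (taylorRat f))]
  have h1 := taylorRat_diffVal f U
  have h2 : taylorRat ⟨_, diffVal_mem_entireRat f.2 U⟩ =
      taylorRat (⟨_, polynomial_mem_entireRat T⟩ * ⟨_, iterate_derivative_mem_entireRat f.2 (s + 1)⟩) := by
    congr 1
    exact Subtype.ext hT.symm
  rw [h2, map_mul, taylorRat_polynomial, ← iterate_derivative_taylorRat] at h1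
  rw [dif_neg (lt_irrefl _), ← map_coe_polynomial, h1, ← Finset.sum_add_distrib]
  refine Finset.sum_eq_zero fun j _ => ?_
  rw [dif_pos j.2, Polynomial.map_neg, Polynomial.coe_neg, ← map_coe_polynomial]
  ring

/-! ### Arithmetic of the approximation forms -/

/-- The polynomial with prescribed integral exponential coefficients. -/
def approxPoly (n : ℕ) (x : ℕ → ℤ) : Polynomial ℚ :=
  ∑ i ∈ Finset.range (n + 1), Polynomial.C ((x i : ℚ) / i.factorial) * Polynomial.X ^ i

theorem natDegree_approxPoly_le (n : ℕ) (x : ℕ → ℤ) : (approxPoly n x).natDegree ≤ n := by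
  refine Polynomial.natDegree_sum_le_of_forall_le _ _ fun i hi => ?_
  refine (Polynomial.natDegree_C_mul_X_pow_le _ _).trans ?_
  simp at hi; omega

theorem ecoeff_approxPoly {n : ℕ} {x : ℕ → ℤ} (hx : ∀ i, n < i → x i = 0) (m : ℕ) :
    ecoeff m (approxPoly n x : PowerSeries ℚ) = x m := by
  have hfac : (m.factorial : ℚ) ≠ 0 := by exact_mod_cast m.factorial_ne_zero
  rw [ecoeff, Polynomial.coeff_coe, approxPoly, Polynomial.finsetSum_coeff]
  simp only [Polynomial.coeff_C_mul, Polynomial.coeff_X_pow, mul_ite, mul_one, mul_zero]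
  rw [Finset.sum_ite_eq]
  split_ifs with h
  · field_simp
  · rw [hx m (by simpa using h)]; simp

theorem exists_int_ecoeff_shift_approxPoly {n : ℕ} {x : ℕ → ℤ} {H : ℕ} (hx : ∀ i, |x i| ≤ H) (r : ℕ) :
    ∃ z : ℤ, (n.factorial : ℚ) * ecoeff r (shiftPoly (approxPoly n x) : PowerSeries ℚ) = z ∧
      |z| ≤ ((n + 1) * n.factorial * H : ℕ) := by
  refine ⟨∑ i ∈ Finset.range (n + 1), ((n.factorial / i.factorial * i.descFactorial r : ℕ) : ℤ) * x i,
    ?_, ?_⟩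
  · rw [ecoeff, Polynomial.coeff_coe, shiftPoly, approxPoly, Polynomial.sum_comp,
      Polynomial.finsetSum_coeff, Finset.mul_sum, Finset.mul_sum, Int.cast_sum]
    refine Finset.sum_congr rfl fun i hi => ?_
    have hi : i ≤ n := by simp at hi; omega
    have hfac : (i.factorial : ℚ) ≠ 0 := by exact_mod_cast i.factorial_ne_zero
    rw [Polynomial.mul_comp, Polynomial.C_comp, Polynomial.X_pow_comp, Polynomial.coeff_C_mul,
      Polynomial.coeff_X_add_one_pow, Nat.descFactorial_eq_factorial_mul_choose]
    rw [Int.cast_mul, Int.cast_natCast, Nat.cast_mul, Nat.cast_div (Nat.factorial_dvd_factorial hi) hfac]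
    push_cast
    field_simp
  · refine (Finset.abs_sum_le_sum_abs _ _).trans ?_
    have : ∀ i ∈ Finset.range (n + 1),
        |((n.factorial / i.factorial * i.descFactorial r : ℕ) : ℤ) * x i| ≤ ((n.factorial * H : ℕ) : ℤ) := by
      intro i hi
      have hi : i ≤ n := by simp at hi; omega
      rw [abs_mul, Nat.abs_cast, Nat.cast_mul n.factorial]
      refine mul_le_mul ?_ (hx i) (abs_nonneg _) (by positivity)
      rw [Nat.cast_le]
      have h1 : i.descFactorial r ≤ i.factorial := by
        rcases le_or_gt r i with h | h
        · rw [← Nat.factorial_mul_descFactorial h]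
          exact Nat.le_mul_of_pos_left _ (Nat.factorial_pos _)
        · rw [Nat.descFactorial_of_lt h]; exact Nat.zero_le _
      calc _ ≤ n.factorial / i.factorial * i.factorial := Nat.mul_le_mul_left _ h1
        _ = _ := Nat.div_mul_cancel (Nat.factorial_dvd_factorial hi)
    refine (Finset.sum_le_card_nsmul _ _ _ this).trans ?_
    rw [Finset.card_range]
    push_cast
    rw [nsmul_eq_mul]
    push_cast
    rw [mul_assoc]

theorem exists_int_sum_choose_mul {s K : ℕ} {ι : Type*} {a : Fin (s + 1) → ℕ → ℚ}
    {γ : ℕ → ι → ℚ} {F M Ba G : ℕ} (ha : ∀ j r, ∃ z : ℤ, (F : ℚ) * a j r = z ∧ |z| ≤ Ba)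
    (hγ : ∀ n ≤ K + s, ∀ i, ∃ y : ℤ, (M : ℚ) * γ n i = y ∧ |y| ≤ G) (k : ℕ) (hk : k ≤ K) (i : ι) :
    ∃ z : ℤ, ((F * M : ℕ) : ℚ) * ∑ j, ∑ r ∈ Finset.range (k + 1),
      (k.choose r : ℚ) * a j r * γ (k - r + j) i = z ∧ |z| ≤ ((s + 1) * 2 ^ k * Ba * G : ℕ) := by
  choose za hza hza' using ha
  choose! y hy hy' using hγ
  refine ⟨∑ j, ∑ r ∈ Finset.range (k + 1), (k.choose r : ℤ) * za j r * y (k - r + j) i, ?_, ?_⟩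
  · rw [Finset.mul_sum, Int.cast_sum]
    refine Finset.sum_congr rfl fun j _ => ?_
    rw [Finset.mul_sum, Int.cast_sum]
    refine Finset.sum_congr rfl fun r _ => ?_
    push_cast
    rw [← hza, ← hy _ (by have := j.2; omega)]
    ring
  · have h1 : ∀ j : Fin (s + 1), |∑ r ∈ Finset.range (k + 1), (k.choose r : ℤ) * za j r * y (k - r + j) i| ≤
        2 ^ k * Ba * G := by
      intro j
      refine (Finset.abs_sum_le_sum_abs _ _).trans ?_
      calc _ ≤ ∑ r ∈ Finset.range (k + 1), (k.choose r : ℤ) * (Ba * G) := by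
            refine Finset.sum_le_sum fun r _ => ?_
            rw [abs_mul, abs_mul, Nat.abs_cast, mul_assoc]
            have := hza' j r
            have := hy' (k - r + j) (by have := j.2; omega) i
            gcongr
        _ = _ := by
            rw [← Finset.sum_mul, ← Nat.cast_sum, Nat.sum_range_choose]; push_cast; ring
    refine (Finset.abs_sum_le_sum_abs _ _).trans ((Finset.sum_le_sum fun j _ => h1 j).trans ?_)
    rw [Finset.sum_const, Finset.card_univ, Fintype.card_fin, nsmul_eq_mul]
    push_cast
    rw [mul_assoc, mul_assoc, mul_assoc]

/-- Liouville-type lower bound from a nonsingular system of small integral linear forms. -/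
theorem norm_le_of_det_ne_zero {t : ℕ} (Z : Matrix (Fin (t + 1)) (Fin (t + 1)) ℤ) (hZ : Z.det ≠ 0)
    (ω : Fin (t + 1) → ℂ) {B : ℕ} (hB : ∀ i j, |Z i j| ≤ B) {ε : ℝ}
    (hε : ∀ k, ‖∑ i, (Z k i : ℂ) * ω i‖ ≤ ε) (i : Fin (t + 1)) :
    ‖ω i‖ ≤ (t + 1).factorial * (B ^ t * ε) := by
  set A : Matrix (Fin (t + 1)) (Fin (t + 1)) ℂ := Z.map (Int.cast : ℤ → ℂ) with hA
  have hdet : A.det = (Z.det : ℂ) := by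
    rw [hA]; exact (Int.cast_det Z).symm
  set y := A.mulVec ω with hy
  have h1 : A.det * ω i = (A.updateCol i y).det := by
    rw [← Matrix.cramer_apply, Matrix.cramer_eq_adjugate_mulVec, hy, Matrix.mulVec_mulVec,
      Matrix.adjugate_mul, Matrix.smul_mulVec, Matrix.one_mulVec]
    rfl
  have hminor : ∀ k : Fin (t + 1), ‖(A.submatrix k.succAbove i.succAbove).det‖ ≤
      t.factorial * (B : ℝ) ^ t := by
    intro k
    have := Matrix.det_le (A := A.submatrix k.succAbove i.succAbove) (x := (B : ℝ))
      (abv := NormedField.toAbsoluteValue ℂ) (fun a b => by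
        simp only [hA, Matrix.submatrix_apply, Matrix.map_apply]
        change ‖((Z _ _ : ℤ) : ℂ)‖ ≤ _
        rw [Complex.norm_intCast]
        exact_mod_cast hB _ _)
    rw [Fintype.card_fin, nsmul_eq_mul] at this
    exact this
  have hε0 : 0 ≤ ε := (norm_nonneg _).trans (hε 0)
  have h2 : ‖(A.updateCol i y).det‖ ≤ (t + 1) * (ε * (t.factorial * (B : ℝ) ^ t)) := by
    rw [Matrix.det_succ_column _ i]
    refine (norm_sum_le_of_le _ (f := fun k => _) (fun k _ => ?_ : ∀ k ∈ Finset.univ, _ ≤ ε * (t.factorial * (B : ℝ) ^ t))).trans ?_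
    · rw [Matrix.submatrix_updateCol_succAbove, Matrix.updateCol_self, norm_mul, norm_mul, norm_pow,
        norm_neg, norm_one, one_pow, one_mul]
      have : ‖y k‖ ≤ ε := hε k
      have := hminor k
      gcongr
    · rw [Finset.sum_const, Finset.card_univ, Fintype.card_fin, nsmul_eq_mul]; push_cast; rfl
  have h3 : (1 : ℝ) ≤ ‖A.det‖ := by
    rw [hdet, Complex.norm_intCast]
    exact_mod_cast Int.one_le_abs hZ
  calc ‖ω i‖ ≤ ‖A.det‖ * ‖ω i‖ := le_mul_of_one_le_left (norm_nonneg _) h3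
    _ = ‖(A.updateCol i y).det‖ := by rw [← norm_mul, h1]
    _ ≤ _ := h2
    _ = _ := by rw [Nat.factorial_succ]; push_cast; ring

/-- Geometrically bounded sequences of natural numbers. -/
def GeomBdd (u : ℕ → ℕ) : Prop := ∃ Γ : ℕ, ∀ N, u N ≤ Γ ^ (N + 1)

theorem GeomBdd.mul {u v : ℕ → ℕ} (hu : GeomBdd u) (hv : GeomBdd v) : GeomBdd fun N => u N * v N := by
  obtain ⟨a, ha⟩ := hu
  obtain ⟨b, hb⟩ := hv
  exact ⟨a * b, fun N => by rw [mul_pow]; exact Nat.mul_le_mul (ha N) (hb N)⟩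

theorem GeomBdd.pow {u : ℕ → ℕ} (hu : GeomBdd u) (m : ℕ) : GeomBdd fun N => u N ^ m := by
  obtain ⟨a, ha⟩ := hu
  exact ⟨a ^ m, fun N => by rw [pow_right_comm]; exact Nat.pow_le_pow_left (ha N) _⟩

theorem GeomBdd.mono {u v : ℕ → ℕ} (hu : GeomBdd u) (h : ∀ N, v N ≤ u N) : GeomBdd v := by
  obtain ⟨a, ha⟩ := hu
  exact ⟨a, fun N => (h N).trans (ha N)⟩

theorem geomBdd_const (c : ℕ) : GeomBdd fun _ => c :=
  ⟨c + 1, fun N => (Nat.le_succ c).trans (Nat.le_self_pow (by omega) _)⟩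

theorem geomBdd_pow_linear (c a b : ℕ) : GeomBdd fun N => c ^ (a * N + b) := by
  refine ⟨(c + 1) ^ (a + b), fun N => ?_⟩
  rw [← pow_mul]
  calc c ^ (a * N + b) ≤ (c + 1) ^ (a * N + b) := Nat.pow_le_pow_left (by omega) _
    _ ≤ _ := Nat.pow_le_pow_right (by omega) (by nlinarith)

theorem geomBdd_linear (a b : ℕ) : GeomBdd fun N => a * N + b :=
  (geomBdd_pow_linear 2 a b).mono fun _ => Nat.lt_two_pow_self.le

/-- `(2N+s)!` is `(N!)²` up to a geometric factor. -/
theorem exists_factorial_two_mul_add_le (s : ℕ) :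
    ∃ u, GeomBdd u ∧ ∀ N, (2 * N + s).factorial ≤ u N * N.factorial ^ 2 := by
  refine ⟨fun N => 2 ^ (2 * N + s) * s.factorial * 2 ^ (2 * N + 0), ?_, fun N => ?_⟩
  · exact ((geomBdd_pow_linear 2 2 s).mul (geomBdd_const _)).mul (geomBdd_pow_linear 2 2 0)
  · have h1 := Nat.add_choose_mul_factorial_mul_factorial (2 * N) s
    have h2 := Nat.add_choose_mul_factorial_mul_factorial N N
    rw [← two_mul] at h2
    rw [← h1, ← h2]
    have h3 := Nat.choose_le_two_pow (2 * N + s) s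
    have h4 := Nat.choose_le_two_pow (2 * N) N
    calc _ ≤ 2 ^ (2 * N + s) * (2 ^ (2 * N) * N.factorial * N.factorial) * s.factorial := by gcongr
      _ = _ := by beta_reduce; rw [add_zero]; ring

/-! ### Linear independence of values -/

section

variable {s : ℕ} {f : entireRat} {T : Polynomial ℚ} {U : Fin (s + 1) → Polynomial ℚ}

theorem span_le_span_taylor_diffVal (hT0 : T ≠ 0)
    (hT : (T : PowerSeries ℚ) * (d⁄dX ℚ)^[s + 1] f.1 = diffVal f.1 U)
    (hind : ∀ c : Fin (s + 1) → Polynomial ℚ, diffVal f.1 c = 0 → c = 0) :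
    ∃ c₁ : ℕ, ∀ (n m K : ℕ) (P : Fin (s + 1) → Polynomial ℚ), P ≠ 0 → (∀ j, (P j).natDegree ≤ n) →
      ∀ R : entireRat, R.1 = diffVal f.1 P →
      (X : PowerSeries ℚ) ^ m ∣ R.1 → s * n + c₁ < m → (s + 1) * n + c₁ < K + m →
      Submodule.span ℚ (Set.range fun k => ecoeff k (taylorRat f)) ≤
        Submodule.span ℚ ((fun k => ecoeff k (taylorRat R)) '' Set.Iic K) := by
  obtain ⟨E, p, hE, hrec⟩ := exists_recurrence_taylorRat hT0 hT
  obtain ⟨n₀, hn₀⟩ := exists_span_range_eq_of_recurrence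
    (fun k => ecoeff k (taylorRat f)) E p hE hrec
  obtain ⟨c, hc⟩ := zero_estimate hT0 hT hind
  have hf0 : f.1 ≠ 0 := by
    intro h
    have h1 : diffVal f.1 (fun _ : Fin (s + 1) => (1 : Polynomial ℚ)) = 0 := by
      rw [h]
      exact Finset.sum_eq_zero fun j _ => by rw [iterate_map_zero, mul_zero]
    exact one_ne_zero (congrFun (hind _ h1) 0)
  obtain ⟨o, ho⟩ : ∃ o, coeff o f.1 ≠ 0 := ⟨_, coeff_order hf0⟩
  refine ⟨c + 2 * s + n₀ + o, fun n m K P hP hPn R hR1 hX hm hK => ?_⟩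
  intro x hx
  by_contra hxW
  obtain ⟨l, hlx, hl⟩ := Submodule.exists_le_ker_of_notMem hxW
  obtain ⟨k₀, hk₀, hlk₀⟩ : ∃ k < n₀, l (ecoeff k (taylorRat f)) ≠ 0 := by
    by_contra hcon
    push Not at hcon
    apply hlx
    rw [hn₀] at hx
    have : Submodule.span ℚ ((fun k => ecoeff k (taylorRat f)) '' Set.Iio n₀) ≤ LinearMap.ker l := by
      rw [Submodule.span_le]
      rintro _ ⟨k, hk, rfl⟩
      exact hcon k hk
    exact this hx
  obtain ⟨b, Δ, hΔ0, hΔ, hb⟩ := hc n P hP hPn m (hR1 ▸ hX) (by omega)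
  rw [← hR1] at hb
  have h1 : (Polynomial.X - 1) ^ (K + 1 - s - k₀) ∣ Δ :=
    sub_one_pow_dvd_of_functional l hb
      (fun k hk => hl (Submodule.subset_span ⟨k, hk, rfl⟩)) hlk₀
  have h2 : Polynomial.X ^ (m - s - o) ∣ Δ := by
    refine X_pow_dvd_coe_iff.1 (X_pow_dvd_of_dvd_mul ho ?_)
    rw [← hb]
    refine Finset.dvd_sum fun k _ => Dvd.dvd.mul_left ((pow_dvd_pow _ ?_).trans
      (X_pow_dvd_iterate_mul_derivative _ hX k)) _
    omega
  have hcop : IsCoprime ((Polynomial.X - 1 : Polynomial ℚ) ^ (K + 1 - s - k₀))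
      (Polynomial.X ^ (m - s - o)) := IsCoprime.pow ⟨-1, 1, by ring⟩
  have h3 := Polynomial.natDegree_le_of_dvd (hcop.mul_dvd h1 h2) hΔ0
  have hX1 : (Polynomial.X - 1 : Polynomial ℚ) = Polynomial.X - Polynomial.C 1 := by simp
  rw [Polynomial.natDegree_mul (pow_ne_zero _ (by rw [hX1]; exact Polynomial.X_sub_C_ne_zero 1))
    (pow_ne_zero _ Polynomial.X_ne_zero), Polynomial.natDegree_pow, Polynomial.natDegree_pow, hX1,
    Polynomial.natDegree_X_sub_C, Polynomial.natDegree_X] at h3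
  omega

theorem ecoeff_taylorRat_diffVal (P : Fin (s + 1) → Polynomial ℚ) (k : ℕ) :
    ecoeff k (taylorRat ⟨_, diffVal_mem_entireRat f.2 P⟩) =
      ∑ j, ∑ r ∈ Finset.range (k + 1),
        ((k.choose r : ℚ) * ecoeff r (shiftPoly (P j) : PowerSeries ℚ)) • ecoeff (k - r + j) (taylorRat f) := by
  rw [taylorRat_diffVal, ecoeff_sum]
  refine Finset.sum_congr rfl fun j _ => ?_
  rw [ecoeff_mul]
  refine Finset.sum_congr rfl fun r _ => ?_
  rw [ecoeff_map, ecoeff_iterate_derivative, Algebra.smul_def, map_mul, map_natCast]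

theorem ecoeff_diffVal_approxPoly {n : ℕ} {x : Fin (s + 1) → ℕ → ℤ} (hx : ∀ j i, n < i → x j i = 0)
    (g : PowerSeries ℚ) (m : ℕ) :
    ecoeff m (diffVal g fun j => approxPoly n (x j)) = ∑ j, ∑ i ∈ Finset.range (m + 1),
        (m.choose i : ℚ) * x j i * ecoeff (m - i + j) g := by
  rw [diffVal, ecoeff_sum]
  refine Finset.sum_congr rfl fun j _ => ?_
  rw [ecoeff_mul]
  refine Finset.sum_congr rfl fun r _ => ?_
  rw [ecoeff_approxPoly (hx j), ecoeff_iterate_derivative]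

theorem abs_ecoeff_diffVal_approxPoly_le {C H n : ℕ} (hf : SizeBound C f.1) {x : Fin (s + 1) → ℕ → ℤ}
    (hx : ∀ j i, n < i → x j i = 0) (hH : ∀ j i, |x j i| ≤ H) (m : ℕ) :
    ((|ecoeff m (diffVal f.1 fun j => approxPoly n (x j))| : ℚ) : ℝ) ≤
      (((s + 1) * H * C ^ s : ℕ) : ℝ) * ((2 * C : ℕ) : ℝ) ^ (m + 1) := by
  have hC : (1 : ℚ) ≤ C := by exact_mod_cast hf.one_le
  have key : |ecoeff m (diffVal f.1 fun j => approxPoly n (x j))| ≤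
      (((s + 1) * H * C ^ s : ℕ) : ℚ) * ((2 * C : ℕ) : ℚ) ^ (m + 1) := by
    rw [ecoeff_diffVal_approxPoly hx]
    have h1 : ∀ j : Fin (s + 1), |∑ i ∈ Finset.range (m + 1),
        (m.choose i : ℚ) * x j i * ecoeff (m - i + j) f.1| ≤ 2 ^ m * (H * C ^ (m + s + 1)) := by
      intro j
      refine (Finset.abs_sum_le_sum_abs _ _).trans ?_
      calc _ ≤ ∑ i ∈ Finset.range (m + 1), (m.choose i : ℚ) * (H * C ^ (m + s + 1)) := by
            refine Finset.sum_le_sum fun i _ => ?_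
            rw [abs_mul, abs_mul, Nat.abs_cast, mul_assoc]
            have e1 : |(x j i : ℚ)| ≤ H := by exact_mod_cast hH j i
            have e2 : |ecoeff (m - i + j) f.1| ≤ (C : ℚ) ^ (m + s + 1) :=
              (hf.1 _).trans (pow_le_pow_right₀ hC (by have := j.2; omega))
            gcongr
        _ = _ := by rw [← Finset.sum_mul, ← Nat.cast_sum, Nat.sum_range_choose]; push_cast; ring
    refine (Finset.abs_sum_le_sum_abs _ _).trans ((Finset.sum_le_sum fun j _ => h1 j).trans ?_)
    rw [Finset.sum_const, Finset.card_univ, Fintype.card_fin, nsmul_eq_mul]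
    push_cast
    have e3 : (2 : ℚ) ^ m ≤ 2 ^ (m + 1) := pow_le_pow_right₀ (by norm_num) (by omega)
    calc ((s : ℚ) + 1) * (2 ^ m * (H * C ^ (m + s + 1)))
        ≤ (s + 1) * (2 ^ (m + 1) * (H * C ^ (m + s + 1))) := by gcongr
      _ = _ := by rw [mul_pow]; ring
  exact_mod_cast key

end

theorem norm_mul_factorial_le {C H n m₁ K s t M G : ℕ} {f R : entireRat} (hf : SizeBound C f.1)
    {x : Fin (s + 1) → ℕ → ℤ} (hx : ∀ j i, n < i → x j i = 0) (hH : ∀ j i, |x j i| ≤ H)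
    (hR : R = ⟨_, diffVal_mem_entireRat f.2 fun j => approxPoly n (x j)⟩)
    (h0 : ∀ m < m₁, ecoeff m R.1 = 0) (hK : K ≤ m₁) {ω : Fin (t + 1) → ℂ} {γ : ℕ → Fin (t + 1) → ℚ}
    (hγω : ∀ k, ecoeff k (taylorRat f) = ∑ i, γ k i • ω i) (hM : 0 < M) (hMG : M ≤ G)
    (hγ : ∀ n ≤ K + s, ∀ i, ∃ y : ℤ, (M : ℚ) * γ n i = y ∧ |y| ≤ G)
    {κ : Fin (t + 1) → ℕ} (hκ : ∀ i, κ i ≤ K)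
    (hind : LinearIndependent ℚ fun i => ecoeff (κ i) (taylorRat R)) (i : Fin (t + 1)) :
    ‖ω i‖ * (m₁ - K).factorial ≤ (t + 1).factorial *
      ((((s + 1) * 2 ^ K * ((n + 1) * n.factorial * H) * G : ℕ) : ℝ) ^ t *
        (n.factorial * G * ((((s + 1) * H * C ^ s : ℕ) : ℝ) * ((2 * C : ℕ) : ℝ) ^ (m₁ + 1) *
          Real.exp (2 * C : ℕ)))) := by
  have hZ := fun k => exists_int_sum_choose_mul (K := K) (F := n.factorial) (M := M)
    (Ba := (n + 1) * n.factorial * H) (G := G) (γ := γ)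
    (a := fun j r => ecoeff r (shiftPoly (approxPoly n (x j)) : PowerSeries ℚ))
    (fun j r => exists_int_ecoeff_shift_approxPoly (hH j) r) hγ (κ k) (hκ k)
  choose Z hZ1 hZ2 using hZ
  have hsum : ∀ k, ∑ i, (Z k i : ℂ) * ω i =
      ((n.factorial * M : ℕ) : ℂ) * ecoeff (κ k) (taylorRat R) := by
    intro k
    rw [hR, ecoeff_taylorRat_diffVal]
    simp_rw [hγω, Finset.smul_sum, smul_smul]
    have : ∀ i, (Z k i : ℂ) = ((Z k i : ℚ) : ℂ) := fun i => by simp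
    simp_rw [this, ← hZ1]
    simp_rw [Finset.mul_sum, Rat.cast_sum, Finset.sum_mul]
    rw [Finset.sum_comm]
    refine Finset.sum_congr rfl fun j _ => ?_
    rw [Finset.sum_comm]
    refine Finset.sum_congr rfl fun r _ => Finset.sum_congr rfl fun i _ => ?_
    rw [Algebra.smul_def]
    simp only [eq_ratCast]
    push_cast
    ring
  have hFM : ((n.factorial * M : ℕ) : ℂ) ≠ 0 := by
    exact_mod_cast (Nat.mul_pos n.factorial_pos hM).ne'
  have hdet : (Matrix.of Z).det ≠ 0 := by
    intro hd
    obtain ⟨c, hc0, hc⟩ := Matrix.exists_vecMul_eq_zero_iff.2 hd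
    have h1 : ∑ k, (c k : ℚ) • ecoeff (κ k) (taylorRat R) = 0 := by
      apply mul_left_cancel₀ hFM
      rw [mul_zero, Finset.mul_sum]
      calc _ = ∑ k, (c k : ℂ) * ∑ i, (Z k i : ℂ) * ω i := by
            refine Finset.sum_congr rfl fun k _ => ?_
            rw [hsum, Algebra.smul_def]
            simp only [eq_ratCast]
            push_cast; ring
        _ = ∑ i, ((∑ k, c k * Z k i : ℤ) : ℂ) * ω i := by
            simp_rw [Finset.mul_sum]
            rw [Finset.sum_comm]
            refine Finset.sum_congr rfl fun i _ => ?_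
            push_cast
            rw [Finset.sum_mul]
            exact Finset.sum_congr rfl fun k _ => by ring
        _ = 0 := by
            refine Finset.sum_eq_zero fun i _ => ?_
            have : ∑ k, c k * Z k i = 0 := congrFun hc i
            rw [this]; simp
    have h2 := Fintype.linearIndependent_iff.1 hind _ h1
    exact hc0 (funext fun k => by exact_mod_cast h2 k)
  have hfac : (0 : ℝ) < (m₁ - K).factorial := by exact_mod_cast Nat.factorial_pos _
  set D : ℝ := (((s + 1) * H * C ^ s : ℕ) : ℝ) * ((2 * C : ℕ) : ℝ) ^ (m₁ + 1) *
          Real.exp (2 * C : ℕ) with hD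
  have hD0 : 0 ≤ D := by positivity
  have hnorm : ∀ k, ‖∑ i, ((Matrix.of Z) k i : ℂ) * ω i‖ ≤
      n.factorial * G * D / (m₁ - K).factorial := by
    intro k
    have e0 := norm_ecoeff_taylorRat_le (C := 2 * C) (m₁ := m₁) (k := κ k)
      (H := (((s + 1) * H * C ^ s : ℕ) : ℝ)) R (fun m => by
        rw [hR]; exact abs_ecoeff_diffVal_approxPoly_le hf hx hH m) h0 ((hκ k).trans hK)
    rw [← hD] at e0
    have e1 : D / ((m₁ - κ k).factorial : ℝ) ≤ D / (m₁ - K).factorial := by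
      gcongr
      exact hκ k
    simp only [Matrix.of_apply]
    rw [hsum, norm_mul, Complex.norm_natCast, mul_div_assoc]
    push_cast
    have hMG' : (M : ℝ) ≤ G := by exact_mod_cast hMG
    have e2 := e0.trans e1
    gcongr
  have hfin := norm_le_of_det_ne_zero (Matrix.of Z) hdet ω
    (B := (s + 1) * 2 ^ K * ((n + 1) * n.factorial * H) * G) (fun k i => by
      refine (hZ2 k i).trans ?_
      have := Nat.pow_le_pow_right (n := 2) (by norm_num) (hκ k)
      exact_mod_cast (by gcongr :
        (s + 1) * 2 ^ (κ k) * ((n + 1) * n.factorial * H) * G ≤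
          (s + 1) * 2 ^ K * ((n + 1) * n.factorial * H) * G)) hnorm i
  calc ‖ω i‖ * (m₁ - K).factorial ≤ _ := mul_le_mul_of_nonneg_right hfin hfac.le
    _ = _ := by field_simp

theorem GeomBdd.exists_mul_factorial_gt {u : ℕ → ℕ} (hu : GeomBdd u) {w : ℝ} (hw : 0 < w) (N₀ : ℕ) :
    ∃ N ≥ N₀, (u N : ℝ) < w * N.factorial := by
  obtain ⟨Γ, hΓ⟩ := hu
  have h := (FloorSemiring.tendsto_pow_div_factorial_atTop (Γ : ℝ)).mul_const (Γ : ℝ)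
  rw [zero_mul] at h
  obtain ⟨N, hN, hN₀⟩ := ((h.eventually (gt_mem_nhds hw)).and (Filter.eventually_ge_atTop N₀)).exists
  refine ⟨N, hN₀, ?_⟩
  have hpos : (0 : ℝ) < N.factorial := by exact_mod_cast N.factorial_pos
  calc (u N : ℝ) ≤ (Γ : ℝ) ^ (N + 1) := by exact_mod_cast hΓ N
    _ = (Γ : ℝ) ^ N / N.factorial * Γ * N.factorial := by field_simp; ring
    _ < _ := by gcongr

theorem factorial_pow_mul_factorial_pow_le (a b N s p : ℕ) (ha : a * s + b * p ≤ N) :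
    a.factorial ^ s * b.factorial ^ p ≤ N.factorial := by
  have h : ∀ a s : ℕ, a.factorial ^ s ≤ (a * s).factorial := by
    intro a s
    induction s with
    | zero => simp
    | succ s ih =>
      rw [pow_succ, Nat.mul_succ]
      exact (Nat.mul_le_mul_right _ ih).trans (Nat.factorial_mul_factorial_dvd_factorial_add _ _
        |> Nat.le_of_dvd (Nat.factorial_pos _))
  calc _ ≤ (a * s).factorial * (b * p).factorial := Nat.mul_le_mul (h a s) (h b p)
    _ ≤ (a * s + b * p).factorial := Nat.le_of_dvd (Nat.factorial_pos _)
        (Nat.factorial_mul_factorial_dvd_factorial_add _ _)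
    _ ≤ _ := Nat.factorial_le ha

theorem exists_geomBdd_arith {s t : ℕ} (hts : t + 1 ≤ s) (A B C C' Ex : ℕ) :
    ∃ u, GeomBdd u ∧ ∀ N : ℕ, ∀ n m₁ H G : ℕ, n = (2 * B * s + 4) * N →
      m₁ = ((s + 1) * (2 * B * s + 4) - 1) * N → H = C' ^ (N + 1) →
      G = A ^ (2 * N + s + 1) * (2 * N + s).factorial ^ B →
      (t + 1).factorial * (((s + 1) * 2 ^ (2 * N) * ((n + 1) * n.factorial * H) * G) ^ t *
        (n.factorial * G * ((s + 1) * H * C ^ s * (2 * C) ^ (m₁ + 1) * Ex))) * N.factorial ≤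
      u N * (m₁ - 2 * N).factorial := by
  obtain ⟨v, hv, hvf⟩ := exists_factorial_two_mul_add_le s
  set q := 2 * B * s + 4 with hq
  have hA := (geomBdd_pow_linear A 2 (s + 1)).mul (hv.pow B)
  have hH := geomBdd_pow_linear C' 1 1
  refine ⟨fun N => (t + 1).factorial * (((s + 1) * 2 ^ (2 * N + 0) * ((q * N + 1) * C' ^ (1 * N + 1)) *
      (A ^ (2 * N + (s + 1)) * v N ^ B)) ^ t * ((A ^ (2 * N + (s + 1)) * v N ^ B) *
      ((s + 1) * C' ^ (1 * N + 1) * C ^ s * (2 * C) ^ (((s + 1) * q - 1) * N + 1) * Ex))), ?_, ?_⟩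
  · exact (geomBdd_const _).mul ((((((geomBdd_const _).mul (geomBdd_pow_linear 2 2 0)).mul
      ((geomBdd_linear q 1).mul hH)).mul hA).pow t).mul (hA.mul ((((((geomBdd_const _).mul hH).mul
      (geomBdd_const _)).mul (geomBdd_pow_linear _ _ _)).mul (geomBdd_const _)))))
  · intro N n m₁ H G hn hm hH hG
    beta_reduce
    have hG' : G ≤ (A ^ (2 * N + (s + 1)) * v N ^ B) * N.factorial ^ (2 * B) := by
      rw [hG, pow_mul, mul_assoc, ← mul_pow]
      exact Nat.mul_le_mul_left _ (Nat.pow_le_pow_left (hvf N) B)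
    have hfac : n.factorial ^ (t + 1) * N.factorial ^ (2 * B * (t + 1) + 1) ≤
        (m₁ - 2 * N).factorial := by
      refine factorial_pow_mul_factorial_pow_le _ _ _ _ _ ?_
      have e1 : m₁ = s * (q * N) + (2 * B * s + 3) * N := by
        rw [hm]
        have : (s + 1) * q - 1 = s * q + (2 * B * s + 3) := by rw [add_mul, hq]; omega
        rw [this]; ring
      have e2 : q * N * (t + 1) ≤ s * (q * N) := by
        rw [mul_comm s]; exact Nat.mul_le_mul_left _ hts
      have e3 : N * (2 * B * (t + 1) + 1) ≤ (2 * B * s + 1) * N := by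
        rw [mul_comm]
        exact Nat.mul_le_mul_right _ (by have := Nat.mul_le_mul_left (2 * B) hts; omega)
      have e4 : (2 * B * s + 3) * N = (2 * B * s + 1) * N + 2 * N := by ring
      rw [hn]
      omega
    rw [← hm, ← hn, one_mul, ← hH, add_zero]
    set g := A ^ (2 * N + (s + 1)) * v N ^ B
    calc _ ≤ (t + 1).factorial * (((s + 1) * 2 ^ (2 * N) * ((n + 1) * n.factorial * H) *
            (g * N.factorial ^ (2 * B))) ^ t * (n.factorial * (g * N.factorial ^ (2 * B)) *
            ((s + 1) * H * C ^ s * (2 * C) ^ (m₁ + 1) * Ex))) * N.factorial := by gcongr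
      _ = (t + 1).factorial * (((s + 1) * 2 ^ (2 * N) * ((n + 1) * H) * g) ^ t *
            (g * ((s + 1) * H * C ^ s * (2 * C) ^ (m₁ + 1) * Ex))) *
            (n.factorial ^ (t + 1) * N.factorial ^ (2 * B * (t + 1) + 1)) := by
          have : N.factorial ^ (2 * B * (t + 1) + 1) =
            (N.factorial ^ (2 * B)) ^ (t + 1) * N.factorial := by rw [pow_succ, pow_mul]
          rw [this]
          generalize N.factorial ^ (2 * B) = y
          generalize n.factorial = z
          simp only [mul_pow, pow_succ]
          ring
      _ ≤ _ := Nat.mul_le_mul_left _ hfac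

/-- The values at `1` of the derivatives of a function satisfying a minimal equation of order
`s + 1` with suitable size conditions span a space of dimension at least `s + 1`. -/
theorem shidlovskii {C s : ℕ} {f : entireRat} {T : Polynomial ℚ} {U : Fin (s + 1) → Polynomial ℚ}
    (hf : SizeBound C f.1) (hT0 : T ≠ 0)
    (hT : (T : PowerSeries ℚ) * (d⁄dX ℚ)^[s + 1] f.1 = diffVal f.1 U)
    (hind : ∀ c : Fin (s + 1) → Polynomial ℚ, diffVal f.1 c = 0 → c = 0) :
    FiniteDimensional ℚ (Submodule.span ℚ (Set.range fun k => ecoeff k (taylorRat f))) ∧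
      s + 1 ≤ Module.finrank ℚ (Submodule.span ℚ (Set.range fun k => ecoeff k (taylorRat f))) := by
  obtain ⟨E, p, hE, hrec⟩ := exists_recurrence_taylorRat hT0 hT
  obtain ⟨n₀, hn₀⟩ := exists_span_range_eq_of_recurrence
    (fun k => ecoeff k (taylorRat f)) E p hE hrec
  set V := Submodule.span ℚ (Set.range fun k => ecoeff k (taylorRat f)) with hV
  have hFD : FiniteDimensional ℚ V := by
    rw [hn₀]
    exact FiniteDimensional.span_of_finite ℚ ((Set.finite_Iio n₀).image _)
  refine ⟨hFD, ?_⟩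
  by_contra hlt
  have hvV : ∀ k, ecoeff k (taylorRat f) ∈ V := fun k => Submodule.subset_span ⟨k, rfl⟩
  obtain ⟨t, ht⟩ : ∃ t, Module.finrank ℚ V = t + 1 := by
    refine Nat.exists_eq_succ_of_ne_zero fun h0 => ?_
    have hbot : V = ⊥ := Submodule.finrank_eq_zero.1 h0
    have hz : taylorRat f = 0 := by
      ext k
      have := hvV k
      rw [hbot, Submodule.mem_bot] at this
      rw [coeff_eq_ecoeff_div, this]; simp
    have hf0 : f = 0 := taylorRat_injective (by rw [hz, map_zero])
    have h1 : diffVal f.1 (fun _ : Fin (s + 1) => (1 : Polynomial ℚ)) = 0 := by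
      rw [hf0]
      exact Finset.sum_eq_zero fun j _ => by
        rw [show (0 : entireRat).1 = 0 from rfl, iterate_map_zero, mul_zero]
    exact one_ne_zero (congrFun (hind _ h1) 0)
  let b := Module.finBasisOfFinrankEq ℚ V ht
  set ω : Fin (t + 1) → ℂ := fun i => (b i : ℂ) with hω
  set γ : ℕ → Fin (t + 1) → ℚ := fun k i => b.repr ⟨_, hvV k⟩ i with hγ
  have hγω : ∀ k, ecoeff k (taylorRat f) = ∑ i, γ k i • ω i := by
    intro k
    have := congrArg (Subtype.val) (b.sum_repr ⟨_, hvV k⟩)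
    rw [AddSubmonoidClass.coe_finsetSum] at this
    exact this.symm
  have hγrec : ∀ (n : ℕ) i, ∑ e ∈ Finset.range (E + 1), (p e).eval (n : ℚ) * γ (n + e) i = 0 := by
    intro n i
    have h1 : ∑ e ∈ Finset.range (E + 1), (p e).eval (n : ℚ) • (⟨_, hvV (n + e)⟩ : V) = 0 := by
      apply Subtype.ext
      rw [AddSubmonoidClass.coe_finsetSum]
      exact hrec n
    have h2 := congrArg (b.coord i) h1
    rw [map_sum, map_zero] at h2
    simp_rw [map_smul] at h2
    exact h2
  obtain ⟨A, B, hAB⟩ := exists_denominator_bound γ E p hE hγrec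
  obtain ⟨C', hC'⟩ := hf.exists_approximation s (2 * B * s + 4) (by omega)
  obtain ⟨c₁, hc₁⟩ := span_le_span_taylor_diffVal hT0 hT hind
  obtain ⟨u, hu, hbound⟩ := exists_geomBdd_arith (s := s) (t := t) (by omega) A B C C'
    ⌈Real.exp (2 * C : ℕ)⌉₊
  have hw : 0 < ‖ω 0‖ := by
    rw [norm_pos_iff]
    exact fun h => b.ne_zero 0 (Subtype.ext h)
  obtain ⟨N, hN, huN⟩ := hu.exists_mul_factorial_gt hw (c₁ + 1)
  obtain ⟨x, hx0, hxs, hxH, hxv⟩ := hC' N (by omega)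
  obtain ⟨M, hM, hMG, hMγ⟩ := hAB (2 * N + s)
  set q := 2 * B * s + 4 with hq
  set R : entireRat := ⟨_, diffVal_mem_entireRat f.2 fun j => approxPoly (q * N) (x j)⟩ with hR
  set m₁ := ((s + 1) * q - 1) * N with hm₁
  have hm₁' : m₁ = s * (q * N) + (2 * B * s + 3) * N := by
    have : (s + 1) * q - 1 = s * q + (2 * B * s + 3) := by rw [add_mul, hq]; omega
    rw [hm₁, this]; ring
  have hRv : ∀ m < m₁, ecoeff m R.1 = 0 := fun m hm => by
    rw [hR, ecoeff_diffVal_approxPoly hxs]; exact hxv m hm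
  have hK : 2 * N ≤ m₁ := by rw [hm₁']; nlinarith [Nat.zero_le (B * s * N), Nat.zero_le (s * (q * N))]
  have hspan : V = Submodule.span ℚ ((fun k => ecoeff k (taylorRat R)) '' Set.Iic (2 * N)) := by
    refine le_antisymm ?_ ?_
    · refine hc₁ (q * N) m₁ (2 * N) (fun j => approxPoly (q * N) (x j)) ?_
        (fun j => natDegree_approxPoly_le _ _) R rfl ?_ ?_ ?_
      · intro h
        apply hx0
        ext j i
        have h1 := ecoeff_approxPoly (hxs j) i
        rw [show approxPoly (q * N) (x j) = 0 from congrFun h j] at h1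
        simp [ecoeff] at h1
        simpa using h1.symm
      · rw [PowerSeries.X_pow_dvd_iff]
        intro m hm
        rw [coeff_eq_ecoeff_div, hRv m hm, zero_div]
      · rw [hm₁']; nlinarith [Nat.zero_le (B * s * N)]
      · rw [hm₁']
        have : (s + 1) * (q * N) = s * (q * N) + (2 * B * s + 4) * N := by rw [hq]; ring
        rw [this]
        have : (2 * B * s + 4) * N = (2 * B * s + 3) * N + N := by ring
        omega
    · rw [Submodule.span_le]
      rintro _ ⟨k, -, rfl⟩
      beta_reduce
      rw [hR, ecoeff_taylorRat_diffVal]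
      exact Submodule.sum_mem _ fun j _ => Submodule.sum_mem _ fun r _ =>
        Submodule.smul_mem _ _ (hvV _)
  have hFD' : Module.Finite ℚ
      (Submodule.span ℚ ((fun k => ecoeff k (taylorRat R)) '' Set.Iic (2 * N))) := hspan ▸ hFD
  obtain ⟨y, hy, -, hyi⟩ := Submodule.exists_fun_fin_finrank_span_eq ℚ
    ((fun k => ecoeff k (taylorRat R)) '' Set.Iic (2 * N))
  have hfr : t + 1 = Module.finrank ℚ
      (Submodule.span ℚ ((fun k => ecoeff k (taylorRat R)) '' Set.Iic (2 * N))) := by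
    rw [← hspan, ht]
  choose κ hκ hκy using hy
  have hyi' : LinearIndependent ℚ fun i => ecoeff (κ (Fin.cast hfr i)) (taylorRat R) := by
    have : (fun i => ecoeff (κ (Fin.cast hfr i)) (taylorRat R)) = y ∘ Fin.cast hfr :=
      funext fun i => hκy _
    rw [this]
    exact hyi.comp (Fin.cast hfr) (Fin.cast_injective hfr)
  have hmain := norm_mul_factorial_le (C := C) (H := C' ^ (N + 1)) (n := q * N) (m₁ := m₁)
    (K := 2 * N) (G := A ^ (2 * N + s + 1) * (2 * N + s).factorial ^ B) hf hxs
    (fun j i => by exact_mod_cast hxH j i) hR hRv hK hγω hM (by exact_mod_cast hMG)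
    (fun n hn i => by
      obtain ⟨y, hy, hy'⟩ := hMγ n hn i
      exact ⟨y, hy, by exact_mod_cast hy'⟩) (fun i => hκ _) hyi' 0
  have hb := hbound N _ _ _ _ rfl rfl rfl rfl
  rw [← hm₁] at hb
  have hpos : (0 : ℝ) < (m₁ - 2 * N).factorial := by exact_mod_cast Nat.factorial_pos _
  have hposN : (0 : ℝ) < N.factorial := by exact_mod_cast Nat.factorial_pos _
  have hb' : ((_ : ℕ) : ℝ) ≤ ((_ : ℕ) : ℝ) := Nat.cast_le.2 hb
  have hex : Real.exp (2 * C : ℕ) ≤ (⌈Real.exp (2 * C : ℕ)⌉₊ : ℝ) := Nat.le_ceil _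
  have hcon : ‖ω 0‖ * N.factorial * (m₁ - 2 * N).factorial ≤ u N * (m₁ - 2 * N).factorial := by
    calc _ = ‖ω 0‖ * (m₁ - 2 * N).factorial * N.factorial := by ring
      _ ≤ _ := mul_le_mul_of_nonneg_right hmain hposN.le
      _ ≤ _ := by
        push_cast at hb' hex ⊢
        refine le_trans ?_ hb'
        gcongr
  have := le_of_mul_le_mul_right hcon hpos
  linarith

section

open scoped TensorProduct

/-- Over a principal ideal domain, a linear system with a nonzero solution in a torsion-free module
has a nonzero solution in the ring. -/
lemma exists_ne_zero_solution_of_torsionFree {R M ι κ : Type*} [CommRing R] [IsDomain R]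
    [IsPrincipalIdealRing R] [AddCommGroup M] [Module R M] [Module.IsTorsionFree R M]
    [Fintype ι] (D : ι → κ → R) (a : ι → M) (ha : a ≠ 0)
    (h : ∀ b, ∑ i, D i b • a i = 0) :
    ∃ c : ι → R, c ≠ 0 ∧ ∀ b, ∑ i, D i b * c i = 0 := by
  classical
  set N := Submodule.span R (Set.range a) with hN
  have : Module.Finite R N := Module.Finite.span_of_finite R (Set.finite_range a)
  obtain ⟨n, b⟩ := Module.basisOfFiniteTypeTorsionFree' (R := R) (M := N)
  let a' : ι → N := fun i => ⟨a i, Submodule.subset_span ⟨i, rfl⟩⟩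
  have ha' : a' ≠ 0 := by
    intro h0
    apply ha
    funext i
    exact congrArg Subtype.val (congrFun h0 i)
  obtain ⟨i, hi⟩ := Function.ne_iff.1 ha'
  obtain ⟨j, hj⟩ : ∃ j, b.coord j (a' i) ≠ 0 := by
    by_contra hcon
    push Not at hcon
    apply hi
    apply b.ext_elem
    intro j
    have := hcon j
    rw [Module.Basis.coord_apply] at this
    simpa using this
  refine ⟨fun i => b.coord j (a' i), fun h0 => hj (congrFun h0 i), fun k => ?_⟩
  have hk : ∑ i, D i k • a' i = 0 := by
    apply Subtype.ext
    have := h k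
    simpa [a'] using this
  have := congrArg (b.coord j) hk
  simpa only [map_sum, map_smul, smul_eq_mul, map_zero] using this

/-- An irreducible monic polynomial stays irreducible over an extension in which the base field
is algebraically closed. -/
lemma irreducible_map_of_algebraicallyClosed {k F : Type*} [Field k] [Field F] [Algebra k F]
    (hF : ∀ x : F, IsIntegral k x → x ∈ (algebraMap k F).range)
    {p : Polynomial k} (hp : p.Monic) (hirr : Irreducible p) :
    Irreducible (p.map (algebraMap k F)) := by
  have hlift : ∀ g : Polynomial F, g.Monic → g ∣ p.map (algebraMap k F) →
      ∃ g0 : Polynomial k, g0.map (algebraMap k F) = g ∧ g0.Monic := by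
    intro g hg hd
    have h1 := integralClosure.mem_lifts_of_monic_of_dvd_map F hp hg hd
    have h2 : g ∈ Polynomial.lifts (algebraMap k F) := by
      rw [Polynomial.lifts_iff_coeff_lifts] at h1 ⊢
      intro n
      obtain ⟨x, hx⟩ := h1 n
      rw [← hx]
      exact hF _ x.2
    obtain ⟨g0, hg0, -, hm⟩ := Polynomial.lifts_and_degree_eq_and_monic h2 hg
    exact ⟨g0, hg0, hm⟩
  have hinj : Function.Injective (Polynomial.map (algebraMap k F)) :=
    Polynomial.map_injective _ (algebraMap k F).injective
  have hp1 : p.map (algebraMap k F) ≠ 1 := by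
    intro h
    apply hirr.not_isUnit
    have : p = 1 := hinj (by rw [h, Polynomial.map_one])
    rw [this]
    exact isUnit_one
  rw [Polynomial.irreducible_of_monic (hp.map (algebraMap k F)) hp1]
  intro f g hf hg hfg
  obtain ⟨f0, rfl, hf0⟩ := hlift f hf ⟨g, hfg.symm⟩
  obtain ⟨g0, rfl, hg0⟩ := hlift g hg ⟨_, by rw [← hfg, mul_comm]⟩
  rw [← Polynomial.map_mul] at hfg
  have h0 : f0 * g0 = p := hinj hfg
  rcases hirr.isUnit_or_isUnit h0.symm with h | h
  · left
    rw [hf0.eq_one_of_isUnit h, Polynomial.map_one]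
  · right
    rw [hg0.eq_one_of_isUnit h, Polynomial.map_one]

lemma isDomain_adjoinRoot_of_equiv {S F : Type*} [CommRing S] [Field F] (e : S ≃+* F)
    {q : Polynomial S} (hq : Irreducible (q.map e.toRingHom)) : IsDomain (AdjoinRoot q) := by
  have hdom : IsDomain S := e.toMulEquiv.isDomain
  have hqp : Prime q :=
    (MulEquiv.prime_iff (Polynomial.mapEquiv e).toMulEquiv).1 hq.prime
  change IsDomain (Polynomial S ⧸ Ideal.span {q})
  rw [Ideal.Quotient.isDomain_iff_prime, Ideal.span_singleton_prime hqp.ne_zero]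
  exact hqp

/-- A field in which `k` is algebraically closed stays a domain after a finite base change. -/
lemma isDomain_tensorProduct_of_finite {k F k' : Type*} [Field k] [CharZero k] [Field F]
    [Algebra k F] [Field k'] [Algebra k k'] [FiniteDimensional k k']
    (hF : ∀ x : F, IsIntegral k x → x ∈ (algebraMap k F).range) :
    IsDomain (F ⊗[k] k') := by
  obtain ⟨β, hβ⟩ := Field.exists_primitive_element k k'
  have hInt : IsIntegral k β := Algebra.IsIntegral.isIntegral β
  let p := minpoly k β
  let e0 : AdjoinRoot p ≃ₐ[k] k' :=
    (IntermediateField.adjoinRootEquivAdjoin k hInt).trans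
      ((IntermediateField.equivOfEq hβ).trans IntermediateField.topEquiv)
  let e1 : F ⊗[k] AdjoinRoot p ≃ₐ[F] F ⊗[k] k' :=
    Algebra.TensorProduct.congr AlgEquiv.refl e0
  let q : Polynomial (F ⊗[k] k) := p.map Algebra.TensorProduct.includeRight.toRingHom
  let e2 := AdjoinRoot.tensorAlgEquiv (R := k) (T := F) p q rfl
  let e3 : F ⊗[k] k ≃ₐ[F] F := Algebra.TensorProduct.rid k F F
  have hirr : Irreducible (p.map (algebraMap k F)) :=
    irreducible_map_of_algebraicallyClosed hF (minpoly.monic hInt) (minpoly.irreducible hInt)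
  have hq : (Polynomial.mapEquiv e3.toRingEquiv) q = p.map (algebraMap k F) := by
    change Polynomial.map _ _ = _
    rw [Polynomial.map_map]
    congr 1
    ext x
    simp [e3, Algebra.algebraMap_eq_smul_one]
  have : IsDomain (AdjoinRoot q) := isDomain_adjoinRoot_of_equiv e3.toRingEquiv (by
    change Irreducible (Polynomial.mapEquiv e3.toRingEquiv q)
    rw [hq]
    exact hirr)
  exact (e1.symm.trans e2).toMulEquiv.isDomain

set_option maxHeartbeats 1000000 in
/-- A field in which `k` is algebraically closed stays without zero divisors after any base
change to a field. -/
lemma noZeroDivisors_tensorProduct {k F L : Type*} [Field k] [CharZero k] [Field F]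
    [Algebra k F] [Field L] [Algebra k L]
    (hF : ∀ x : F, IsIntegral k x → x ∈ (algebraMap k F).range) :
    NoZeroDivisors (L ⊗[k] F) := by
  classical
  refine ⟨fun {a b} hab => ?_⟩
  by_contra hcon
  push Not at hcon
  obtain ⟨ha, hb⟩ := hcon
  let B := Module.Basis.ofVectorSpace k F
  let BL := Algebra.TensorProduct.basis L B
  let S : Set L := Set.range (fun i => BL.repr a i) ∪ Set.range (fun i => BL.repr b i)
  have hfin : ∀ x : L ⊗[k] F, (Set.range (fun i => BL.repr x i)).Finite :=
    fun x => (BL.repr x).finite_range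
  have hS : S.Finite := (hfin a).union (hfin b)
  let A := Algebra.adjoin k S
  have hft : Algebra.FiniteType k A := by
    rw [← Subalgebra.fg_iff_finiteType]
    exact Subalgebra.fg_def.2 ⟨S, hS, rfl⟩
  let BA := Algebra.TensorProduct.basis A B
  let φ : A ⊗[k] F →ₐ[k] L ⊗[k] F := Algebra.TensorProduct.map A.val (AlgHom.id k F)
  have hφ : Function.Injective φ :=
    Module.Flat.rTensor_preserves_injective_linearMap A.val.toLinearMap Subtype.val_injective
  have hpre : ∀ x : L ⊗[k] F, (∀ i, BL.repr x i ∈ A) → ∃ y, φ y = x := by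
    intro x hx
    refine ⟨∑ i ∈ (BL.repr x).support, (⟨BL.repr x i, hx i⟩ : A) ⊗ₜ[k] B i, ?_⟩
    conv_rhs => rw [← BL.linearCombination_repr x, Finsupp.linearCombination_apply, Finsupp.sum]
    rw [map_sum]
    refine Finset.sum_congr rfl fun i _ => ?_
    simp [φ, BL, TensorProduct.smul_tmul']
  obtain ⟨a', ha'⟩ := hpre a fun i => Algebra.subset_adjoin (Or.inl ⟨i, rfl⟩)
  obtain ⟨b', hb'⟩ := hpre b fun i => Algebra.subset_adjoin (Or.inr ⟨i, rfl⟩)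
  have hab' : a' * b' = 0 := hφ (by rw [map_mul, ha', hb', hab, map_zero])
  have hne : ∀ x : A ⊗[k] F, x ≠ 0 → ∃ i, BA.repr x i ≠ 0 := by
    intro x hx
    by_contra hcon
    push Not at hcon
    exact hx (BA.ext_elem fun i => by rw [hcon i]; simp)
  obtain ⟨i, hi⟩ := hne a' (by rintro rfl; exact ha (by rw [← ha', map_zero]))
  obtain ⟨j, hj⟩ := hne b' (by rintro rfl; exact hb (by rw [← hb', map_zero]))
  have hJ : IsJacobsonRing A := isJacobsonRing_of_finiteType (A := k)
  obtain ⟨m, hm, hmem⟩ : ∃ m : Ideal A, m.IsMaximal ∧ BA.repr a' i * BA.repr b' j ∉ m := by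
    by_contra hcon
    push Not at hcon
    have h1 : BA.repr a' i * BA.repr b' j ∈ (⊥ : Ideal A).jacobson := by
      rw [Ideal.jacobson, Submodule.mem_sInf]
      exact fun I hI => hcon I hI.2
    rw [(hJ.out Ideal.isRadical_bot : (⊥ : Ideal A).jacobson = ⊥), Ideal.mem_bot] at h1
    exact mul_ne_zero hi hj h1
  let : Field (A ⧸ m) := Ideal.Quotient.field m
  have hfd : Module.Finite k (A ⧸ m) := finite_of_finite_type_of_isJacobsonRing k (A ⧸ m)
  have hdom : IsDomain (F ⊗[k] (A ⧸ m)) := isDomain_tensorProduct_of_finite hF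
  let ψ : A ⊗[k] F →ₐ[k] F ⊗[k] (A ⧸ m) :=
    (Algebra.TensorProduct.comm k (A ⧸ m) F).toAlgHom.comp
      (Algebra.TensorProduct.map (Ideal.Quotient.mkₐ k m) (AlgHom.id k F))
  let Bm := Algebra.TensorProduct.basis (A ⧸ m) B
  have h2 : ∀ (x : A ⊗[k] F) i,
      Bm.repr (Algebra.TensorProduct.map (Ideal.Quotient.mkₐ k m) (AlgHom.id k F) x) i
        = Ideal.Quotient.mk m (BA.repr x i) := by
    intro x i
    induction x using TensorProduct.induction_on with
    | zero => simp
    | tmul r y => simp [Bm, BA]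
    | add x y hx hy => simp only [map_add, Finsupp.add_apply, hx, hy]
  have hψ : ∀ (x : A ⊗[k] F) i, BA.repr x i ∉ m → ψ x ≠ 0 := by
    intro x i hxi h0
    apply hxi
    have h1 : Algebra.TensorProduct.map (Ideal.Quotient.mkₐ k m) (AlgHom.id k F) x = 0 := by
      apply (Algebra.TensorProduct.comm k (A ⧸ m) F).injective
      rw [map_zero]
      exact h0
    rw [← Ideal.Quotient.eq_zero_iff_mem, ← h2 x i, h1]
    simp
  have h0 : ψ a' * ψ b' = 0 := by rw [← map_mul, hab', map_zero]
  rcases mul_eq_zero.1 h0 with h | h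
  · exact hψ a' i (fun h' => hmem (m.mul_mem_right _ h')) h
  · exact hψ b' j (fun h' => hmem (m.mul_mem_left _ h')) h

end

/-! ### Quotients of entire series that are algebraic over the rational functions -/

lemma norm_le_of_pow_eq_sum {e : ℕ} {q : ℕ → ℂ} {W y : ℂ}
    (h : W ^ (e + 1) = ∑ i ∈ Finset.range (e + 1), q i * W ^ i * y ^ (e + 1 - i)) :
    ‖W‖ ≤ ‖y‖ * (1 + ∑ i ∈ Finset.range (e + 1), ‖q i‖) := by
  have hs : 0 ≤ ∑ i ∈ Finset.range (e + 1), ‖q i‖ := Finset.sum_nonneg fun _ _ => norm_nonneg _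
  by_cases hW : ‖W‖ ≤ ‖y‖
  · nlinarith [norm_nonneg y]
  push Not at hW
  have hW0 : 0 < ‖W‖ := (norm_nonneg y).trans_lt hW
  have h1 : ‖W‖ ^ (e + 1) ≤ ‖W‖ ^ e * (‖y‖ * ∑ i ∈ Finset.range (e + 1), ‖q i‖) := by
    calc ‖W‖ ^ (e + 1) = ‖∑ i ∈ Finset.range (e + 1), q i * W ^ i * y ^ (e + 1 - i)‖ := by
          rw [← h, norm_pow]
      _ ≤ ∑ i ∈ Finset.range (e + 1), ‖q i * W ^ i * y ^ (e + 1 - i)‖ := norm_sum_le _ _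
      _ ≤ ∑ i ∈ Finset.range (e + 1), ‖W‖ ^ e * (‖y‖ * ‖q i‖) := by
          refine Finset.sum_le_sum fun i hi => ?_
          have hie : i ≤ e := Nat.lt_succ_iff.1 (Finset.mem_range.1 hi)
          have h2 : e + 1 - i = (e - i) + 1 := by omega
          have h3 : ‖W‖ ^ e = ‖W‖ ^ i * ‖W‖ ^ (e - i) := by
            rw [← pow_add]; congr 1; omega
          rw [norm_mul, norm_mul, norm_pow, norm_pow, h2, pow_succ, h3]
          have h4 : ‖y‖ ^ (e - i) ≤ ‖W‖ ^ (e - i) := pow_le_pow_left₀ (norm_nonneg _) hW.le _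
          calc ‖q i‖ * ‖W‖ ^ i * (‖y‖ ^ (e - i) * ‖y‖)
              ≤ ‖q i‖ * ‖W‖ ^ i * (‖W‖ ^ (e - i) * ‖y‖) := by gcongr
            _ = _ := by ring
      _ = _ := by rw [← Finset.mul_sum, ← Finset.mul_sum]
  rw [pow_succ] at h1
  have h2 := le_of_mul_le_mul_left h1 (pow_pos hW0 e)
  nlinarith [norm_nonneg y]

lemma exists_norm_eval_le (p : Polynomial ℂ) :
    ∃ (A : ℝ) (N : ℕ), 0 ≤ A ∧ ∀ z, ‖p.eval z‖ ≤ A * (1 + ‖z‖) ^ N := by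
  refine ⟨∑ i ∈ Finset.range (p.natDegree + 1), ‖p.coeff i‖, p.natDegree,
    Finset.sum_nonneg fun _ _ => norm_nonneg _, fun z => ?_⟩
  rw [Polynomial.eval_eq_sum_range, Finset.sum_mul]
  refine (norm_sum_le _ _).trans (Finset.sum_le_sum fun i hi => ?_)
  rw [norm_mul, norm_pow]
  gcongr
  calc ‖z‖ ^ i ≤ (1 + ‖z‖) ^ i := by gcongr; linarith
    _ ≤ _ := pow_le_pow_right₀ (by linarith [norm_nonneg z]) (by simpa [Nat.lt_succ_iff] using hi)

lemma exists_sum_norm_eval_le (s : Finset ℕ) (p : ℕ → Polynomial ℂ) :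
    ∃ (A : ℝ) (N : ℕ), 0 ≤ A ∧ ∀ z, 1 + ∑ i ∈ s, ‖(p i).eval z‖ ≤ A * (1 + ‖z‖) ^ N := by
  classical
  induction s using Finset.induction_on with
  | empty => exact ⟨1, 0, zero_le_one, fun z => by simp⟩
  | insert a s ha ih =>
    obtain ⟨A, N, hA, h⟩ := ih
    obtain ⟨A', N', hA', hle⟩ := exists_norm_eval_le (p a)
    refine ⟨A + A', N + N', by positivity, fun z => ?_⟩
    have hz : (1 : ℝ) ≤ 1 + ‖z‖ := by linarith [norm_nonneg z]
    rw [Finset.sum_insert ha]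
    have h1 : A * (1 + ‖z‖) ^ N ≤ A * (1 + ‖z‖) ^ (N + N') := by gcongr; omega
    have h2 : A' * (1 + ‖z‖) ^ N' ≤ A' * (1 + ‖z‖) ^ (N + N') := by gcongr; omega
    linarith [h z, hle z]

/-- An entire function of polynomial growth is a polynomial. -/
lemma exists_polynomial_of_norm_le {h : ℂ → ℂ} (hd : Differentiable ℂ h) {A : ℝ} {N : ℕ}
    (hb : ∀ z, ‖h z‖ ≤ A * (1 + ‖z‖) ^ N) : ∃ p : Polynomial ℂ, ∀ z, h z = p.eval z := by
  have hA : 0 ≤ A := by simpa using (norm_nonneg _).trans (hb 0)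
  have hz : ∀ n, N < n → iteratedDeriv n h 0 = 0 := by
    intro n hn
    rw [← norm_le_zero_iff]
    have hR : ∀ R : ℝ, 1 ≤ R → ‖iteratedDeriv n h 0‖ ≤ (n.factorial * (A * 2 ^ N)) / R := by
      intro R hR
      have hR0 : 0 < R := by linarith
      have h1 := Complex.norm_iteratedDeriv_le_of_forall_mem_sphere_norm_le (c := 0) (R := R)
        (C := A * (2 * R) ^ N) n hR0 hd.diffContOnCl (fun z hz => by
          refine (hb z).trans ?_
          have : ‖z‖ = R := by simpa using hz
          gcongr
          linarith)
      refine h1.trans ?_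
      rw [div_le_div_iff₀ (by positivity) hR0, mul_pow]
      have : R ^ N * R ≤ R ^ n := by
        rw [← pow_succ]
        exact pow_le_pow_right₀ hR hn
      calc (n.factorial : ℝ) * (A * (2 ^ N * R ^ N)) * R
          = (n.factorial : ℝ) * (A * 2 ^ N) * (R ^ N * R) := by ring
        _ ≤ _ := by gcongr
    have ht : Filter.Tendsto (fun R : ℝ => (n.factorial * (A * 2 ^ N)) / R) Filter.atTop (nhds 0) :=
      Filter.Tendsto.const_div_atTop Filter.tendsto_id _
    exact ge_of_tendsto ht (Filter.eventually_atTop.2 ⟨1, hR⟩)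
  refine ⟨∑ n ∈ Finset.range (N + 1),
    Polynomial.C ((n.factorial : ℂ)⁻¹ * iteratedDeriv n h 0) * Polynomial.X ^ n, fun z => ?_⟩
  rw [← Complex.taylorSeries_eq_of_entire' 0 z hd, tsum_eq_sum (s := Finset.range (N + 1)),
    Polynomial.eval_finsetSum]
  · refine Finset.sum_congr rfl fun n _ => ?_
    simp
  · intro n hn
    rw [hz n (by simpa using hn)]
    simp

/-- If `U` is bounded by `v` times a function of polynomial growth, then `U` is a polynomial
multiple of `v`. -/
lemma exists_polynomial_mul_of_norm_le {U v : ℂ → ℂ} (hU : Differentiable ℂ U)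
    (hv : Differentiable ℂ v) (hv0 : ∃ z, v z ≠ 0) {A : ℝ} {N : ℕ}
    (hb : ∀ z, ‖U z‖ ≤ ‖v z‖ * (A * (1 + ‖z‖) ^ N)) :
    ∃ p : Polynomial ℂ, ∀ z, U z = p.eval z * v z := by
  classical
  have han : AnalyticOnNhd ℂ v Set.univ := hv.differentiableOn.analyticOnNhd isOpen_univ
  have hne : ∀ c, ∀ᶠ z in nhdsWithin c {c}ᶜ, v z ≠ 0 := by
    intro c
    rcases (han c trivial).eventually_eq_zero_or_eventually_ne_zero with h | h
    · obtain ⟨z, hz⟩ := hv0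
      exact absurd (han.eqOn_zero_of_preconnected_of_eventuallyEq_zero isPreconnected_univ
        (Set.mem_univ c) h (Set.mem_univ z)) hz
    · exact h
  let q : ℂ → ℂ := fun z => U z / v z
  let h : ℂ → ℂ := fun z => if v z = 0 then (nhdsWithin z {z}ᶜ).limUnder q else q z
  have hqb : ∀ z, v z ≠ 0 → ‖q z‖ ≤ A * (1 + ‖z‖) ^ N := by
    intro z hz
    change ‖U z / v z‖ ≤ _
    rw [norm_div, div_le_iff₀ (norm_pos_iff.2 hz), mul_comm]
    exact hb z
  have hd : Differentiable ℂ h := by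
    intro c
    obtain ⟨ε, hε, hball⟩ := Metric.mem_nhdsWithin_iff.1 (hne c)
    set s := Metric.ball c (min ε 1) with hs
    have hvs : ∀ z ∈ s \ {c}, v z ≠ 0 := fun z hz =>
      hball ⟨Metric.ball_subset_ball (min_le_left _ _) hz.1, hz.2⟩
    have hsc : s ∈ nhds c := Metric.ball_mem_nhds c (lt_min hε one_pos)
    by_cases hvc : v c = 0
    · have hA : 0 ≤ A := by
        obtain ⟨z, hz⟩ := hv0
        have h1 := (norm_nonneg _).trans (hqb z hz)
        have h2 : 0 < (1 + ‖z‖) ^ N := by positivity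
        nlinarith
      have h1 := Complex.differentiableOn_update_limUnder_of_bddAbove (f := q) hsc
        (fun z hz => ((hU z).div (hv z) (hvs z hz)).differentiableWithinAt)
        ⟨A * (1 + (‖c‖ + 1)) ^ N, by
          rintro _ ⟨z, hz, rfl⟩
          refine (hqb z (hvs z hz)).trans ?_
          have h3 : dist z c < 1 := (Metric.mem_ball.1 hz.1).trans_le (min_le_right _ _)
          have h4 : ‖z‖ ≤ ‖c‖ + 1 := by
            have := norm_le_norm_add_norm_sub' z c
            rw [dist_eq_norm] at h3
            linarith
          gcongr⟩
      refine (h1.differentiableAt hsc).congr_of_eventuallyEq ?_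
      filter_upwards [hsc] with z hz
      by_cases hzc : z = c
      · subst hzc
        simp [h, hvc]
      · rw [Function.update_of_ne hzc]
        simp [h, hvs z ⟨hz, hzc⟩]
    · refine ((hU c).div (hv c) hvc).congr_of_eventuallyEq ?_
      filter_upwards [(hv c).continuousAt.eventually_ne hvc] with z hz
      simp [h, hz, q]
  have hh : ∀ z, ‖h z‖ ≤ A * (1 + ‖z‖) ^ N := by
    intro c
    have h1 : Filter.Tendsto (fun z => ‖h z‖) (nhdsWithin c {c}ᶜ) (nhds ‖h c‖) :=
      ((hd c).continuousAt.norm).tendsto.mono_left nhdsWithin_le_nhds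
    have h2 : Filter.Tendsto (fun z : ℂ => A * (1 + ‖z‖) ^ N) (nhdsWithin c {c}ᶜ)
        (nhds (A * (1 + ‖c‖) ^ N)) := by
      have : Continuous fun z : ℂ => A * (1 + ‖z‖) ^ N := by fun_prop
      exact this.continuousAt.tendsto.mono_left nhdsWithin_le_nhds
    refine le_of_tendsto_of_tendsto h1 h2 ?_
    filter_upwards [hne c] with z hz
    simpa [h, hz] using hqb z hz
  obtain ⟨p, hp⟩ := exists_polynomial_of_norm_le hd hh
  refine ⟨p, fun z => ?_⟩
  by_cases hz : v z = 0
  · have := hb z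
    rw [hz, norm_zero, zero_mul, norm_le_zero_iff] at this
    rw [this, hz, mul_zero]
  · rw [← hp z]
    simp [h, hz, q]

/-- A homogeneous relation between two entire series over the polynomials makes their quotient
rational. -/
lemma exists_polynomial_of_homogeneous_relation {u v : PowerSeries ℂ} (hu : u ∈ entirePS)
    (hv : v ∈ entirePS) (hv0 : v ≠ 0) {e : ℕ} {p : ℕ → Polynomial ℂ}
    (h : ∑ i ∈ Finset.range (e + 2), (p i : PowerSeries ℂ) * u ^ i * v ^ (e + 1 - i) = 0) :
    ∃ q : Polynomial ℂ, (p (e + 1) : PowerSeries ℂ) * u = q * v := by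
  let c := p (e + 1)
  let b : ℕ → Polynomial ℂ := fun i => - (p i * c ^ (e - i))
  have hcu : (c : PowerSeries ℂ) * u ∈ entirePS := mul_mem (polynomial_mem_entirePS c) hu
  have hW : ((c : PowerSeries ℂ) * u) ^ (e + 1)
      = ∑ i ∈ Finset.range (e + 1), (b i : PowerSeries ℂ) * ((c : PowerSeries ℂ) * u) ^ i
        * v ^ (e + 1 - i) := by
    rw [Finset.sum_range_succ] at h
    have h1 : (c : PowerSeries ℂ) * u ^ (e + 1)
        = - ∑ i ∈ Finset.range (e + 1), (p i : PowerSeries ℂ) * u ^ i * v ^ (e + 1 - i) := by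
      rw [eq_neg_iff_add_eq_zero, add_comm]
      simpa [c] using h
    have h2 : ((c : PowerSeries ℂ) * u) ^ (e + 1) = (c : PowerSeries ℂ) ^ e * (c * u ^ (e + 1)) := by
      ring
    rw [h2, h1, mul_neg, Finset.mul_sum, ← Finset.sum_neg_distrib]
    refine Finset.sum_congr rfl fun i hi => ?_
    have hie : i ≤ e := Nat.lt_succ_iff.1 (Finset.mem_range.1 hi)
    have h3 : (c : PowerSeries ℂ) ^ e = (c : PowerSeries ℂ) ^ (e - i) * (c : PowerSeries ℂ) ^ i := by
      rw [← pow_add]; congr 1; omega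
    simp only [b, Polynomial.coe_neg, Polynomial.coe_mul, Polynomial.coe_pow]
    rw [h3]
    ring
  have hpow : ∀ {g : PowerSeries ℂ}, g ∈ entirePS → ∀ n z, psEval (g ^ n) z = psEval g z ^ n := by
    intro g hg n z
    induction n with
    | zero => simpa using psEval_coe 1 z
    | succ n ih => rw [pow_succ, psEval_mul (pow_mem hg n) hg, ih, pow_succ]
  have hsum : ∀ (s : Finset ℕ) (g : ℕ → PowerSeries ℂ), (∀ i, g i ∈ entirePS) → ∀ z,
      psEval (∑ i ∈ s, g i) z = ∑ i ∈ s, psEval (g i) z := by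
    classical
    intro s g hg z
    induction s using Finset.induction_on with
    | empty => simpa using psEval_coe 0 z
    | insert a s ha ih =>
      rw [Finset.sum_insert ha, Finset.sum_insert ha, psEval_add (hg a) (sum_mem fun i _ => hg i), ih]
  obtain ⟨A, N, hA, hAN⟩ := exists_sum_norm_eval_le (Finset.range (e + 1)) b
  have hterm : ∀ i, (b i : PowerSeries ℂ) * ((c : PowerSeries ℂ) * u) ^ i ∈ entirePS :=
    fun i => mul_mem (polynomial_mem_entirePS _) (pow_mem hcu i)
  obtain ⟨q, hq⟩ := exists_polynomial_mul_of_norm_le (U := psEval ((c : PowerSeries ℂ) * u))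
    (v := psEval v) (A := A) (N := N) (differentiable_psEval hcu) (differentiable_psEval hv)
    (by
      by_contra hcon
      push Not at hcon
      exact hv0 (eq_zero_of_psEval_eq_zero hv hcon))
    (fun z => by
      have h1 := congrArg (fun g => psEval g z) hW
      beta_reduce at h1
      rw [hpow hcu, hsum _ _ (fun i => mul_mem (hterm i) (pow_mem hv _))] at h1
      have h2 : psEval ((c : PowerSeries ℂ) * u) z ^ (e + 1) = ∑ i ∈ Finset.range (e + 1),
          (b i).eval z * psEval ((c : PowerSeries ℂ) * u) z ^ i * psEval v z ^ (e + 1 - i) := by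
        rw [h1]
        refine Finset.sum_congr rfl fun i _ => ?_
        rw [psEval_mul (hterm i) (pow_mem hv _), psEval_mul (polynomial_mem_entirePS _)
          (pow_mem hcu i), hpow hcu, hpow hv, psEval_coe]
      refine (norm_le_of_pow_eq_sum h2).trans ?_
      gcongr
      exact hAN z)
  refine ⟨q, ?_⟩
  rw [← sub_eq_zero]
  have hqv : (q : PowerSeries ℂ) * v ∈ entirePS := mul_mem (polynomial_mem_entirePS q) hv
  refine eq_zero_of_psEval_eq_zero (sub_mem hcu hqv) fun z => ?_
  have h1 : psEval ((c : PowerSeries ℂ) * u - q * v + q * v) z = psEval ((c : PowerSeries ℂ) * u) z := by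
    rw [sub_add_cancel]
  rw [psEval_add (sub_mem hcu hqv) hqv, hq z, psEval_mul (polynomial_mem_entirePS q) hv,
    psEval_coe] at h1
  exact add_eq_right.1 h1

/-- The rational version of `exists_polynomial_of_homogeneous_relation`. -/
lemma exists_rat_polynomial_of_homogeneous_relation {u v : PowerSeries ℚ} (hu : u ∈ entireRat)
    (hv : v ∈ entireRat) (hv0 : v ≠ 0) {e : ℕ} {p : ℕ → Polynomial ℚ}
    (h : ∑ i ∈ Finset.range (e + 2), (p i : PowerSeries ℚ) * u ^ i * v ^ (e + 1 - i) = 0) :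
    ∃ q : Polynomial ℚ, (p (e + 1) : PowerSeries ℚ) * u = q * v := by
  obtain ⟨q, hq⟩ := exists_polynomial_of_homogeneous_relation (p := fun i => (p i).map (algebraMap ℚ ℂ))
    (e := e) (mem_entireRat.1 hu) (mem_entireRat.1 hv)
    (fun h0 => hv0 (map_injective _ (algebraMap ℚ ℂ).injective (by rw [h0, map_zero])))
    (by
      have := congrArg (PowerSeries.map (algebraMap ℚ ℂ)) h
      simpa only [map_sum, map_mul, map_pow, map_zero, map_coe_polynomial] using this)
  obtain ⟨l, hl⟩ := (Algebra.linearMap ℚ ℂ).exists_leftInverse_of_injective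
    (LinearMap.ker_eq_bot.2 (algebraMap ℚ ℂ).injective)
  have hl1 : ∀ x : ℚ, l (algebraMap ℚ ℂ x) = x := fun x => LinearMap.congr_fun hl x
  refine ⟨PowerSeries.trunc (q.natDegree + 1) (coeffMap l (q : PowerSeries ℂ)), ?_⟩
  have hr : ((PowerSeries.trunc (q.natDegree + 1) (coeffMap l (q : PowerSeries ℂ)) :
      Polynomial ℚ) : PowerSeries ℚ) = coeffMap l (q : PowerSeries ℂ) := by
    ext n
    rw [Polynomial.coeff_coe, PowerSeries.coeff_trunc]
    split_ifs with hn
    · rfl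
    · rw [coeff_coeffMap, Polynomial.coeff_coe, Polynomial.coeff_eq_zero_of_natDegree_lt (by omega),
        map_zero]
  have hone : coeffMap l (1 : PowerSeries ℂ) = 1 := by
    ext n
    rw [coeff_coeffMap, coeff_one, coeff_one]
    split_ifs
    · simpa using hl1 1
    · exact map_zero l
  have h1 := congrArg (coeffMap l) hq
  rw [← map_coe_polynomial, ← map_mul, mul_comm (q : PowerSeries ℂ), coeffMap_map_mul,
    ← mul_one (PowerSeries.map (algebraMap ℚ ℂ) _), coeffMap_map_mul, hone, mul_one] at h1
  rw [hr, mul_comm (coeffMap l _)]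
  simpa using h1

/-! ### Holonomic series and the ring of rational `E`-functions -/

theorem derivative_polynomial_smul {k A : Type*} [CommRing k] [CommRing A] [Algebra k A] (p : Polynomial k)
    (x : PowerSeries A) :
    d⁄dX A (p • x) = Polynomial.derivative p • x + p • d⁄dX A x := by
  have h : d⁄dX A (algebraMap (Polynomial k) (PowerSeries A) p)
      = algebraMap (Polynomial k) (PowerSeries A) (Polynomial.derivative p) := by
    rw [PowerSeries.algebraMap_apply', PowerSeries.algebraMap_apply',
      ← derivative_coe, map_derivative]
  rw [Algebra.smul_def, Algebra.smul_def, Algebra.smul_def, Derivation.leibniz, h, smul_eq_mul,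
    smul_eq_mul]
  ring

theorem coeffMap_polynomial_smul {k A B : Type*} [CommRing k] [CommRing A] [Algebra k A] [CommRing B] [Algebra k B]
    (l : A →ₗ[k] B) (p : Polynomial k) (x : PowerSeries A) :
    coeffMap l (p • x) = p • coeffMap l x := by
  rw [Algebra.smul_def, Algebra.smul_def, PowerSeries.algebraMap_apply',
    PowerSeries.algebraMap_apply', coeffMap_map_mul]

section Holonomic

variable {A : Type*} [CommRing A] [Algebra ℚ A]

/-- A power series is holonomic if it lies in a finitely generated `ℚ[X]`-module of power series
which is stable under some nonzero multiple of the derivation. -/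
def IsHolonomic (g : PowerSeries A) : Prop :=
  ∃ N : Submodule (Polynomial ℚ) (PowerSeries A), N.FG ∧ g ∈ N ∧
    ∃ q : Polynomial ℚ, q ≠ 0 ∧ ∀ x ∈ N, q • d⁄dX A x ∈ N

theorem IsHolonomic.add {g h : PowerSeries A} (hg : IsHolonomic g) (hh : IsHolonomic h) :
    IsHolonomic (g + h) := by
  obtain ⟨N, hN, hgN, q, hq, hqN⟩ := hg
  obtain ⟨M, hM, hhM, r, hr, hrM⟩ := hh
  refine ⟨N ⊔ M, hN.sup hM, Submodule.add_mem_sup hgN hhM, q * r, mul_ne_zero hq hr, ?_⟩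
  intro x hx
  obtain ⟨y, hy, z, hz, rfl⟩ := Submodule.mem_sup.1 hx
  rw [map_add, smul_add]
  refine Submodule.add_mem_sup ?_ ?_
  · rw [mul_comm, mul_smul]
    exact N.smul_mem _ (hqN y hy)
  · rw [mul_smul]
    exact M.smul_mem _ (hrM z hz)

theorem IsHolonomic.mul {g h : PowerSeries A} (hg : IsHolonomic g) (hh : IsHolonomic h) :
    IsHolonomic (g * h) := by
  obtain ⟨N, hN, hgN, q, hq, hqN⟩ := hg
  obtain ⟨M, hM, hhM, r, hr, hrM⟩ := hh
  refine ⟨N * M, hN.mul hM, Submodule.mul_mem_mul hgN hhM, q * r, mul_ne_zero hq hr, ?_⟩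
  intro x hx
  induction hx using Submodule.mul_induction_on' with
  | mem_mul_mem y hy z hz =>
    have h1 : (q * r) • d⁄dX A (y * z) = q • (y * (r • d⁄dX A z)) + r • ((q • d⁄dX A y) * z) := by
      rw [Derivation.leibniz, smul_eq_mul, smul_eq_mul]
      simp only [Algebra.smul_def, map_mul]
      ring
    rw [h1]
    exact add_mem (Submodule.smul_mem _ _ (Submodule.mul_mem_mul hy (hrM z hz)))
      (Submodule.smul_mem _ _ (Submodule.mul_mem_mul (hqN y hy) hz))
  | add x _ y _ hx hy =>
    rw [map_add, smul_add]
    exact add_mem hx hy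

theorem IsHolonomic.derivative {g : PowerSeries A} (hg : IsHolonomic g) :
    IsHolonomic (d⁄dX A g) := by
  obtain ⟨N, ⟨S, rfl⟩, hgN, q, hq, hqN⟩ := hg
  set N := Submodule.span (Polynomial ℚ) (S : Set (PowerSeries A)) with hN
  set N' := Submodule.span (Polynomial ℚ) ((S : Set (PowerSeries A)) ∪ d⁄dX A '' S) with hN'
  have hNN' : N ≤ N' := Submodule.span_mono Set.subset_union_left
  have hdN : ∀ x ∈ N, d⁄dX A x ∈ N' := by
    intro x hx
    induction hx using Submodule.span_induction with
    | mem x hx => exact Submodule.subset_span (Or.inr ⟨x, hx, rfl⟩)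
    | zero => rw [map_zero]; exact zero_mem _
    | add x y _ _ hx hy => rw [map_add]; exact add_mem hx hy
    | smul p x hx h =>
      rw [derivative_polynomial_smul]
      exact add_mem (N'.smul_mem _ (hNN' hx)) (N'.smul_mem _ h)
  have hdd : ∀ x ∈ N, q • d⁄dX A (d⁄dX A x) ∈ N' := by
    intro x hx
    have h1 := hdN _ (hqN x hx)
    rw [derivative_polynomial_smul] at h1
    exact (N'.add_mem_iff_right (N'.smul_mem _ (hdN x hx))).1 h1
  refine ⟨N', ?_, hdN g hgN, q, hq, ?_⟩
  · refine Submodule.fg_span (S.finite_toSet.union (S.finite_toSet.image _))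
  intro x hx
  induction hx using Submodule.span_induction with
  | mem x hx =>
    rcases hx with hx | ⟨y, hy, rfl⟩
    · exact N'.smul_mem _ (hdN x (Submodule.subset_span hx))
    · exact hdd y (Submodule.subset_span hy)
  | zero => rw [map_zero, smul_zero]; exact zero_mem _
  | add x y _ _ hx hy => rw [map_add, smul_add]; exact add_mem hx hy
  | smul p x hx h =>
    rw [derivative_polynomial_smul, smul_add, smul_comm q p]
    exact add_mem (N'.smul_mem _ (N'.smul_mem _ hx)) (N'.smul_mem _ h)

theorem isHolonomic_algebraMap (p : Polynomial ℚ) :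
    IsHolonomic (algebraMap (Polynomial ℚ) (PowerSeries A) p) := by
  refine ⟨Submodule.span (Polynomial ℚ) {1}, Submodule.fg_span_singleton _,
    Submodule.mem_span_singleton.2 ⟨p, by rw [Algebra.smul_def, mul_one]⟩, 1, one_ne_zero, ?_⟩
  intro x hx
  obtain ⟨r, rfl⟩ := Submodule.mem_span_singleton.1 hx
  rw [derivative_polynomial_smul, (d⁄dX A).map_one_eq_zero, smul_zero, add_zero, one_smul]
  exact Submodule.smul_mem _ _ (Submodule.mem_span_singleton_self _)

theorem IsHolonomic.coeffMap {B : Type*} [CommRing B] [Algebra ℚ B] {g : PowerSeries A}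
    (hg : IsHolonomic g) (l : A →ₗ[ℚ] B) : IsHolonomic (coeffMap l g) := by
  obtain ⟨N, hN, hgN, q, hq, hqN⟩ := hg
  let φ : PowerSeries A →ₗ[Polynomial ℚ] PowerSeries B :=
    { toFun := _root_.coeffMap l
      map_add' := map_add _
      map_smul' := coeffMap_polynomial_smul l }
  refine ⟨N.map φ, hN.map φ, ⟨g, hgN, rfl⟩, q, hq, ?_⟩
  rintro _ ⟨x, hx, rfl⟩
  refine ⟨q • d⁄dX A x, hqN x hx, ?_⟩
  rw [map_smul]
  change q • _root_.coeffMap l _ = q • d⁄dX B (_root_.coeffMap l x)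
  rw [coeffMap_derivative]

end Holonomic

section SizeBound

variable {C : ℕ} {f g : PowerSeries ℚ}

theorem SizeBound.mono {C' : ℕ} (h : SizeBound C f) (hC : C ≤ C') : SizeBound C' f := by
  refine ⟨fun n => (h.1 n).trans (by gcongr), fun n => ?_⟩
  obtain ⟨D, hD, hDC, hz⟩ := h.2 n
  exact ⟨D, hD, hDC.trans (by gcongr), hz⟩

theorem SizeBound.exists_common_denominator (hf : SizeBound C f) (hg : SizeBound C g) (n : ℕ) :
    ∃ D : ℕ, 0 < D ∧ D ≤ C ^ (n + 1) * C ^ (n + 1) ∧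
      ∀ i ≤ n, ∀ j ≤ n, (∃ z : ℤ, (D : ℚ) * (ecoeff i f * ecoeff j g) = z) ∧
      (∃ z : ℤ, (D : ℚ) * (ecoeff i f) = z) ∧ (∃ z : ℤ, (D : ℚ) * (ecoeff i g) = z) := by
  obtain ⟨D, hD, hDC, hz⟩ := hf.2 n
  obtain ⟨E, hE, hEC, hw⟩ := hg.2 n
  refine ⟨D * E, Nat.mul_pos hD hE, Nat.mul_le_mul hDC hEC, fun i hi j hj => ?_⟩
  obtain ⟨a, ha⟩ := hz i hi
  obtain ⟨b, hb⟩ := hw j hj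
  obtain ⟨c, hc⟩ := hw i hi
  refine ⟨⟨a * b, ?_⟩, ⟨a * E, ?_⟩, ⟨c * D, ?_⟩⟩
  · push_cast; rw [← ha, ← hb]; ring
  · push_cast; rw [← ha]; ring
  · push_cast; rw [← hc]; ring

theorem SizeBound.add_self (hf : SizeBound C f) (hg : SizeBound C g) :
    SizeBound (2 * C ^ 2) (f + g) := by
  have hC := hf.one_le
  have hC' : (1 : ℚ) ≤ C := by exact_mod_cast hC
  refine ⟨fun n => ?_, fun n => ?_⟩
  · rw [ecoeff_add]
    have h1 := hf.1 n
    have h2 := hg.1 n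
    have h3 : (C : ℚ) ^ (n + 1) ≤ (C ^ 2 : ℚ) ^ (n + 1) := by
      gcongr
      nlinarith
    have h4 : (2 : ℚ) ≤ 2 ^ (n + 1) := by
      rw [pow_succ]
      have : (1 : ℚ) ≤ 2 ^ n := one_le_pow₀ (by norm_num)
      linarith
    calc |ecoeff n f + ecoeff n g| ≤ |ecoeff n f| + |ecoeff n g| := abs_add_le _ _
      _ ≤ 2 * (C : ℚ) ^ (n + 1) := by linarith
      _ ≤ 2 ^ (n + 1) * (C ^ 2 : ℚ) ^ (n + 1) := by gcongr
      _ = _ := by push_cast; rw [mul_pow]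
  · obtain ⟨D, hD, hDC, h⟩ := hf.exists_common_denominator hg n
    refine ⟨D, hD, hDC.trans ?_, fun i hi => ?_⟩
    · rw [← mul_pow]
      exact Nat.pow_le_pow_left (by nlinarith) _
    · obtain ⟨-, ⟨a, ha⟩, ⟨b, hb⟩⟩ := h i hi i hi
      refine ⟨a + b, ?_⟩
      rw [ecoeff_add, mul_add, ha, hb]
      push_cast; rfl

theorem SizeBound.mul_self (hf : SizeBound C f) (hg : SizeBound C g) :
    SizeBound (2 * C ^ 2) (f * g) := by
  have hC := hf.one_le
  have hC' : (1 : ℚ) ≤ C := by exact_mod_cast hC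
  refine ⟨fun n => ?_, fun n => ?_⟩
  · rw [ecoeff_mul]
    calc |∑ r ∈ Finset.range (n + 1), (n.choose r : ℚ) * ecoeff r f * ecoeff (n - r) g|
        ≤ ∑ r ∈ Finset.range (n + 1), |(n.choose r : ℚ) * ecoeff r f * ecoeff (n - r) g| :=
          Finset.abs_sum_le_sum_abs _ _
      _ ≤ ∑ r ∈ Finset.range (n + 1), (n.choose r : ℚ) * (C : ℚ) ^ (n + 2) := by
          refine Finset.sum_le_sum fun r hr => ?_
          have hr : r ≤ n := Nat.lt_succ_iff.1 (Finset.mem_range.1 hr)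
          rw [abs_mul, abs_mul, Nat.abs_cast, mul_assoc]
          have h1 : (C : ℚ) ^ (n + 2) = C ^ (r + 1) * C ^ (n - r + 1) := by
            rw [← pow_add]; congr 1; omega
          rw [h1]
          gcongr
          · exact hf.1 r
          · exact hg.1 (n - r)
      _ = 2 ^ n * (C : ℚ) ^ (n + 2) := by
          rw [← Finset.sum_mul, ← Nat.cast_sum, Nat.sum_range_choose]
          push_cast; rfl
      _ ≤ 2 ^ (n + 1) * (C : ℚ) ^ (2 * (n + 1)) := by
          gcongr
          · norm_num
          · omega
          · omega
      _ = _ := by push_cast; rw [mul_pow, pow_mul]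
  · obtain ⟨D, hD, hDC, h⟩ := hf.exists_common_denominator hg n
    refine ⟨D, hD, hDC.trans ?_, fun i hi => ?_⟩
    · rw [← mul_pow]
      exact Nat.pow_le_pow_left (by nlinarith) _
    · rw [ecoeff_mul]
      have h' : ∀ r, ∃ z : ℤ, r ∈ Finset.range (i + 1) →
          (D : ℚ) * ((i.choose r : ℚ) * ecoeff r f * ecoeff (i - r) g) = z := by
        intro r
        by_cases hr : r ∈ Finset.range (i + 1)
        · obtain ⟨⟨a, ha⟩, -, -⟩ := h r (by simp at hr; omega) (i - r) (by omega)
          refine ⟨i.choose r * a, fun _ => ?_⟩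
          push_cast
          rw [← ha]
          ring
        · exact ⟨0, fun h => absurd h hr⟩
      choose z hz using h'
      refine ⟨∑ r ∈ Finset.range (i + 1), z r, ?_⟩
      rw [Finset.mul_sum]
      push_cast
      exact Finset.sum_congr rfl fun r hr => hz r hr

theorem SizeBound.derivative (hf : SizeBound C f) : SizeBound (C ^ 2) (d⁄dX ℚ f) := by
  have hC := hf.one_le
  have hC' : (1 : ℚ) ≤ C := by exact_mod_cast hC
  refine ⟨fun n => ?_, fun n => ?_⟩
  · rw [ecoeff_derivative]
    refine (hf.1 _).trans ?_
    push_cast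
    rw [← pow_mul]
    exact pow_le_pow_right₀ hC' (by omega)
  · obtain ⟨D, hD, hDC, h⟩ := hf.2 (n + 1)
    refine ⟨D, hD, hDC.trans ?_, fun i hi => ?_⟩
    · rw [← pow_mul]
      exact Nat.pow_le_pow_right hC (by omega)
    · rw [ecoeff_derivative]
      exact h (i + 1) (by omega)

theorem exists_sizeBound_C (c : ℚ) : ∃ C, SizeBound C (PowerSeries.C c) := by
  have hval : ∀ n, ecoeff n (PowerSeries.C c) = if n = 0 then c else 0 := by
    intro n
    rw [ecoeff, coeff_C]
    split_ifs with h
    · subst h; simp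
    · simp
  refine ⟨c.num.natAbs + c.den, fun n => ?_, fun n => ⟨c.den, c.den_pos, ?_, fun i hi => ?_⟩⟩
  · rw [hval]
    have hd : (1 : ℚ) ≤ c.den := by exact_mod_cast c.den_pos
    split_ifs with h
    · subst h
      rw [zero_add, pow_one]
      push_cast
      have h1 : |c| = |(c.num : ℚ)| / c.den := by
        conv_lhs => rw [← c.num_div_den]
        rw [abs_div, Nat.abs_cast]
      have h2 : |(c.num : ℚ)| = (c.num.natAbs : ℚ) := by
        rw [Nat.cast_natAbs]; push_cast; rfl
      rw [h1, ← h2]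
      have : |(c.num : ℚ)| / c.den ≤ |(c.num : ℚ)| := div_le_self (abs_nonneg _) hd
      linarith
    · rw [abs_zero]; positivity
  · have : 1 ≤ c.num.natAbs + c.den := by have := c.den_pos; omega
    calc c.den ≤ c.num.natAbs + c.den := by omega
      _ = (c.num.natAbs + c.den) ^ 1 := (pow_one _).symm
      _ ≤ _ := Nat.pow_le_pow_right this (by omega)
  · rw [hval]
    split_ifs
    · exact ⟨c.num, by rw [mul_comm]; exact c.mul_den_eq_num⟩
    · exact ⟨0, by simp⟩

theorem sizeBound_X : SizeBound 1 (X : PowerSeries ℚ) := by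
  have hval : ∀ n, ecoeff n (X : PowerSeries ℚ) = if n = 1 then 1 else 0 := by
    intro n
    rw [ecoeff, coeff_X]
    split_ifs with h
    · subst h; simp
    · simp
  refine ⟨fun n => ?_, fun n => ⟨1, one_pos, by simp, fun i hi => ?_⟩⟩
  · rw [hval]
    split_ifs <;> simp
  · rw [hval]
    split_ifs
    · exact ⟨1, by simp⟩
    · exact ⟨0, by simp⟩

end SizeBound

theorem exists_sizeBound_add {f g : PowerSeries ℚ} (hf : ∃ C, SizeBound C f)
    (hg : ∃ C, SizeBound C g) : ∃ C, SizeBound C (f + g) := by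
  obtain ⟨C, hC⟩ := hf
  obtain ⟨D, hD⟩ := hg
  exact ⟨_, (hC.mono (le_max_left C D)).add_self (hD.mono (le_max_right C D))⟩

theorem exists_sizeBound_mul {f g : PowerSeries ℚ} (hf : ∃ C, SizeBound C f)
    (hg : ∃ C, SizeBound C g) : ∃ C, SizeBound C (f * g) := by
  obtain ⟨C, hC⟩ := hf
  obtain ⟨D, hD⟩ := hg
  exact ⟨_, (hC.mono (le_max_left C D)).mul_self (hD.mono (le_max_right C D))⟩

theorem exists_sizeBound_polynomial (p : Polynomial ℚ) : ∃ C, SizeBound C (p : PowerSeries ℚ) := by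
  induction p using Polynomial.induction_on' with
  | add p q hp hq => rw [Polynomial.coe_add]; exact exists_sizeBound_add hp hq
  | monomial n a =>
    rw [← Polynomial.C_mul_X_pow_eq_monomial, Polynomial.coe_mul, Polynomial.coe_C,
      Polynomial.coe_pow, Polynomial.coe_X]
    refine exists_sizeBound_mul (exists_sizeBound_C a) ?_
    induction n with
    | zero => simpa using exists_sizeBound_C 1
    | succ n ih => rw [pow_succ]; exact exists_sizeBound_mul ih ⟨1, sizeBound_X⟩

theorem polynomial_coe_eq_algebraMap (p : Polynomial ℚ) :
    (p : PowerSeries ℚ) = algebraMap (Polynomial ℚ) (PowerSeries ℚ) p := by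
  rw [PowerSeries.algebraMap_apply']
  simp

/-- The ring of `E`-functions with rational coefficients. -/
def ratE : Subring (PowerSeries ℚ) where
  carrier := {g | (∃ C, SizeBound C g) ∧ IsHolonomic g}
  add_mem' hf hg := ⟨exists_sizeBound_add hf.1 hg.1, hf.2.add hg.2⟩
  mul_mem' hf hg := ⟨exists_sizeBound_mul hf.1 hg.1, hf.2.mul hg.2⟩
  zero_mem' := ⟨by simpa using exists_sizeBound_polynomial 0, by
    simpa using isHolonomic_algebraMap (A := ℚ) 0⟩
  one_mem' := ⟨by simpa using exists_sizeBound_polynomial 1, by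
    simpa using isHolonomic_algebraMap (A := ℚ) 1⟩
  neg_mem' {f} hf := by
    have h : -f = ((-1 : Polynomial ℚ) : PowerSeries ℚ) * f := by simp
    rw [h]
    refine ⟨exists_sizeBound_mul (exists_sizeBound_polynomial _) hf.1, IsHolonomic.mul ?_ hf.2⟩
    rw [polynomial_coe_eq_algebraMap]
    exact isHolonomic_algebraMap _

theorem mem_ratE {f : PowerSeries ℚ} : f ∈ ratE ↔ (∃ C, SizeBound C f) ∧ IsHolonomic f := Iff.rfl

theorem polynomial_mem_ratE (p : Polynomial ℚ) : (p : PowerSeries ℚ) ∈ ratE :=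
  ⟨exists_sizeBound_polynomial p, by
    rw [polynomial_coe_eq_algebraMap]; exact isHolonomic_algebraMap _⟩

theorem derivative_mem_ratE {f : PowerSeries ℚ} (hf : f ∈ ratE) : d⁄dX ℚ f ∈ ratE := by
  obtain ⟨⟨C, hC⟩, h⟩ := hf
  exact ⟨⟨_, hC.derivative⟩, h.derivative⟩

theorem ratE_le_entireRat : ratE ≤ entireRat := by
  rintro f ⟨⟨C, hC⟩, -⟩
  exact hC.mem_entireRat

/-! ### Ranks of the derivative modules of rational `E`-functions at the point `1` -/

theorem derivative_mem_satSpan {k A ι : Type*} [Field k] [CommRing A] [Algebra k A]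
    {v : ι → PowerSeries A} (hv : ∀ i, d⁄dX A (v i) ∈ satSpan (Polynomial k) v)
    {x : PowerSeries A} (hx : x ∈ satSpan (Polynomial k) v) :
    d⁄dX A x ∈ satSpan (Polynomial k) v := by
  obtain ⟨c, hc, hcx⟩ := hx
  have hspan : ∀ y ∈ Submodule.span (Polynomial k) (Set.range v),
      y ∈ satSpan (Polynomial k) v ∧ d⁄dX A y ∈ satSpan (Polynomial k) v := by
    intro y hy
    induction hy using Submodule.span_induction with
    | mem y hy =>
      obtain ⟨i, rfl⟩ := hy
      exact ⟨subset_satSpan v i, hv i⟩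
    | zero => rw [map_zero]; exact ⟨zero_mem _, zero_mem _⟩
    | add y z _ _ hy hz => rw [map_add]; exact ⟨add_mem hy.1 hz.1, add_mem hy.2 hz.2⟩
    | smul p y _ hy =>
      refine ⟨Submodule.smul_mem _ _ hy.1, ?_⟩
      rw [derivative_polynomial_smul]
      exact add_mem (Submodule.smul_mem _ _ hy.1) (Submodule.smul_mem _ _ hy.2)
  refine mem_satSpan_of_smul hc ?_
  have h1 := (hspan _ hcx).2
  rw [derivative_polynomial_smul] at h1
  refine (Submodule.add_mem_iff_right _ (Submodule.smul_mem _ _ ?_)).1 h1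
  exact mem_satSpan_of_smul hc (hspan _ hcx).1

theorem iterate_derivative_mem_satSpan {k A ι : Type*} [Field k] [CommRing A] [Algebra k A]
    {v : ι → PowerSeries A} (hv : ∀ i, d⁄dX A (v i) ∈ satSpan (Polynomial k) v)
    {x : PowerSeries A} (hx : x ∈ satSpan (Polynomial k) v) (n : ℕ) :
    (d⁄dX A)^[n] x ∈ satSpan (Polynomial k) v := by
  induction n with
  | zero => exact hx
  | succ n ih =>
    rw [Function.iterate_succ_apply']
    exact derivative_mem_satSpan hv ih

theorem IsHolonomic.exists_diffVal_eq_zero {f : PowerSeries ℚ} (hf : IsHolonomic f) :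
    ∃ (n : ℕ) (c : Fin (n + 1) → Polynomial ℚ), c ≠ 0 ∧ diffVal f c = 0 := by
  obtain ⟨N, hN, hfN, q, hq, hqN⟩ := hf
  obtain ⟨n, v, hv⟩ := Submodule.fg_iff_exists_fin_generating_family.1 hN
  have hle : ∀ x ∈ N, x ∈ satSpan (Polynomial ℚ) v := by
    intro x hx
    refine ⟨1, one_ne_zero, ?_⟩
    rw [one_smul, hv]
    exact hx
  have hd : ∀ i, d⁄dX ℚ (v i) ∈ satSpan (Polynomial ℚ) v := fun i =>
    mem_satSpan_of_smul hq (hle _ (hqN _ (hv ▸ Submodule.subset_span ⟨i, rfl⟩)))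
  obtain ⟨g, hg, i, hi⟩ := exists_relation_of_mem_satSpan
    (w := fun i : Fin (n + 1) => (d⁄dX ℚ)^[(i : ℕ)] f)
    (fun i => iterate_derivative_mem_satSpan hd (hle f hfN) i)
  refine ⟨n, g, fun h => hi (congrFun h i), ?_⟩
  rw [diffVal, ← hg]
  refine Finset.sum_congr rfl fun j _ => ?_
  rw [Algebra.smul_def, polynomial_coe_eq_algebraMap]

/-- The module over `K[X]` spanned by all the derivatives of a complex power series. -/
def derivSpan (K : Type*) [Field K] [Algebra K ℂ] (g : PowerSeries ℂ) :
    Submodule (Polynomial K) (PowerSeries ℂ) :=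
  Submodule.span (Polynomial K) (Set.range fun k => (d⁄dX ℂ)^[k] g)

/-- The vector space over `K` spanned by the values at `0` of all the derivatives of a complex
power series. -/
def valueSpan (K : Type*) [Field K] [Algebra K ℂ] (g : PowerSeries ℂ) : Submodule K ℂ :=
  Submodule.span K (Set.range fun k => ecoeff k g)

/-- The derivative module of `g` has rank at most the dimension of `valueSpan K g`. -/
def HasValueRank (K : Type*) [Field K] [Algebra K ℂ] (g : PowerSeries ℂ) : Prop :=
  FiniteDimensional K (valueSpan K g) ∧
    ∀ w : Fin (Module.finrank K (valueSpan K g) + 1) → PowerSeries ℂ,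
      (∀ i, w i ∈ derivSpan K g) → ¬ LinearIndependent (Polynomial K) w

theorem taylorRat_polynomial_mul (p : Polynomial ℚ) (f : entireRat) :
    taylorRat (⟨p, polynomial_mem_entireRat p⟩ * f) = shiftPoly p • taylorRat f := by
  rw [map_mul, taylorRat_polynomial, Algebra.smul_def, PowerSeries.algebraMap_apply']

theorem hasValueRank_taylorRat {f : PowerSeries ℚ} (hf : f ∈ ratE) :
    HasValueRank ℚ (taylorRat ⟨f, ratE_le_entireRat hf⟩) := by
  classical
  set F : entireRat := ⟨f, ratE_le_entireRat hf⟩ with hF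
  set g := taylorRat F with hg
  obtain rfl | hf0 := eq_or_ne f 0
  · have hg0 : g = 0 := by
      have : F = 0 := rfl
      rw [hg, this, map_zero]
    have hzero : ∀ k, (d⁄dX ℂ)^[k] g = 0 := by
      intro k
      rw [hg0]
      exact iterate_map_zero _ k
    have hV : valueSpan ℚ g = ⊥ := by
      rw [valueSpan, Submodule.span_eq_bot]
      rintro _ ⟨k, rfl⟩
      rw [hg0]
      simp [ecoeff]
    have hD : derivSpan ℚ g = ⊥ := by
      rw [derivSpan, Submodule.span_eq_bot]
      rintro _ ⟨k, rfl⟩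
      exact hzero k
    refine ⟨by rw [hV]; infer_instance, fun w hw hli => ?_⟩
    have h0 := hw 0
    rw [hD, Submodule.mem_bot] at h0
    exact hli.ne_zero 0 h0
  have hex := ((mem_ratE.1 hf).2).exists_diffVal_eq_zero
  obtain ⟨C, hC⟩ := (mem_ratE.1 hf).1
  obtain ⟨c, hc0, hc⟩ := Nat.find_spec hex
  have hmin := fun m => Nat.find_min hex (m := m)
  revert c hmin
  rcases Nat.find hex with _ | s
  · intro c hc0 hc _
    exfalso
    rw [diffVal, Fin.sum_univ_one] at hc
    rcases mul_eq_zero.1 hc with h | h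
    · apply hc0
      funext i
      have hi : i = 0 := Fin.ext (by omega)
      rw [hi]
      exact Polynomial.coe_eq_zero_iff.1 h
    · exact hf0 h
  intro c hc0 hc hmin
  have hind : ∀ c : Fin (s + 1) → Polynomial ℚ, diffVal f c = 0 → c = 0 := by
    intro c hc
    by_contra h
    exact hmin s (Nat.lt_succ_self s) ⟨c, h, hc⟩
  rw [diffVal, Fin.sum_univ_castSucc] at hc
  have hT0 : c (Fin.last _) ≠ 0 := by
    intro h
    rw [h, Polynomial.coe_zero, zero_mul, add_zero] at hc
    have h1 := hind (fun i => c i.castSucc) hc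
    apply hc0
    funext i
    refine Fin.lastCases ?_ (fun i => ?_) i
    · exact h
    · exact congrFun h1 i
  have hT : (c (Fin.last _) : PowerSeries ℚ) * (d⁄dX ℚ)^[s + 1] F.1
      = diffVal F.1 (fun i => -c i.castSucc) := by
    rw [diffVal, eq_comm]
    simp only [Polynomial.coe_neg, neg_mul, Finset.sum_neg_distrib]
    rw [neg_eq_iff_add_eq_zero]
    exact hc
  obtain ⟨hfd, hrk⟩ := shidlovskii (f := F) hC hT0 hT hind
  refine ⟨hfd, fun w hw hli => ?_⟩
  have hTg : shiftPoly (c (Fin.last _)) • (d⁄dX ℂ)^[s + 1] g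
      = ∑ j : Fin (s + 1), shiftPoly (-c j.castSucc) • (d⁄dX ℂ)^[(j : ℕ)] g := by
    have h1 := congrArg taylorRat (Subtype.ext hT :
      (⟨c (Fin.last _), polynomial_mem_entireRat _⟩ : entireRat) *
        ⟨_, iterate_derivative_mem_entireRat F.2 (s + 1)⟩
        = ⟨_, diffVal_mem_entireRat F.2 _⟩)
    rw [taylorRat_polynomial_mul, ← iterate_derivative_taylorRat] at h1
    rw [hg, h1, taylorRat_diffVal]
    refine Finset.sum_congr rfl fun j _ => ?_
    rw [Algebra.smul_def, PowerSeries.algebraMap_apply']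
  have hv : ∀ i : Fin (s + 1), d⁄dX ℂ ((d⁄dX ℂ)^[(i : ℕ)] g) ∈ satSpan (Polynomial ℚ)
      (fun i : Fin (s + 1) => (d⁄dX ℂ)^[(i : ℕ)] g) := by
    intro i
    rw [← Function.iterate_succ_apply' (d⁄dX ℂ) i g]
    rcases lt_or_eq_of_le (Nat.lt_succ_iff.1 i.2) with h | h
    · exact subset_satSpan (fun i : Fin (s + 1) => (d⁄dX ℂ)^[(i : ℕ)] g) ⟨i + 1, by omega⟩
    · rw [h]
      refine mem_satSpan_of_smul (shiftPoly_ne_zero hT0) ?_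
      rw [hTg]
      exact sum_mem fun j _ => Submodule.smul_mem _ _
        (subset_satSpan (fun i : Fin (s + 1) => (d⁄dX ℂ)^[(i : ℕ)] g) j)
  have hle : derivSpan ℚ g ≤ satSpan (Polynomial ℚ)
      (fun i : Fin (s + 1) => (d⁄dX ℂ)^[(i : ℕ)] g) := by
    rw [derivSpan, Submodule.span_le]
    rintro _ ⟨k, rfl⟩
    exact iterate_derivative_mem_satSpan hv
      (subset_satSpan (fun i : Fin (s + 1) => (d⁄dX ℂ)^[(i : ℕ)] g) 0) k
  have := card_le_of_mem_satSpan (fun i => hle (hw i)) hli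
  have h2 : s + 1 ≤ Module.finrank ℚ (valueSpan ℚ g) := hrk
  omega

/-- The ring of Taylor expansions at `1` of rational `E`-functions. -/
def taylorE : Subring (PowerSeries ℂ) :=
  (taylorRat.comp (Subring.inclusion ratE_le_entireRat)).range

theorem mem_taylorE {g : PowerSeries ℂ} :
    g ∈ taylorE ↔ ∃ (f : PowerSeries ℚ) (hf : f ∈ ratE),
      taylorRat ⟨f, ratE_le_entireRat hf⟩ = g := by
  constructor
  · rintro ⟨⟨f, hf⟩, h⟩
    exact ⟨f, hf, h⟩
  · rintro ⟨f, hf, h⟩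
    exact ⟨⟨f, hf⟩, h⟩

theorem hasValueRank_of_mem_taylorE {g : PowerSeries ℂ} (hg : g ∈ taylorE) :
    HasValueRank ℚ g := by
  obtain ⟨f, hf, rfl⟩ := mem_taylorE.1 hg
  exact hasValueRank_taylorRat hf

theorem derivative_mem_taylorE {g : PowerSeries ℂ} (hg : g ∈ taylorE) :
    d⁄dX ℂ g ∈ taylorE := by
  obtain ⟨f, hf, rfl⟩ := mem_taylorE.1 hg
  rw [derivative_taylorRat]
  exact mem_taylorE.2 ⟨_, derivative_mem_ratE hf, rfl⟩

theorem algebraMap_mem_taylorE (p : Polynomial ℚ) :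
    algebraMap (Polynomial ℚ) (PowerSeries ℂ) p ∈ taylorE := by
  refine mem_taylorE.2 ⟨_, polynomial_mem_ratE (p.comp (Polynomial.X - 1)), ?_⟩
  rw [taylorRat_polynomial, PowerSeries.algebraMap_apply', shiftPoly, Polynomial.comp_assoc]
  simp

theorem polynomial_smul_mem_taylorE (p : Polynomial ℚ) {g : PowerSeries ℂ} (hg : g ∈ taylorE) :
    p • g ∈ taylorE := by
  rw [Algebra.smul_def]
  exact mul_mem (algebraMap_mem_taylorE p) hg

theorem derivSpan_subset_taylorE {g x : PowerSeries ℂ} (hg : g ∈ taylorE)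
    (hx : x ∈ derivSpan ℚ g) : x ∈ taylorE := by
  induction hx using Submodule.span_induction with
  | mem y hy =>
    obtain ⟨k, rfl⟩ := hy
    beta_reduce
    induction k with
    | zero => exact hg
    | succ k ih => rw [Function.iterate_succ_apply']; exact derivative_mem_taylorE ih
  | zero => exact zero_mem _
  | add y z _ _ hy hz => exact add_mem hy hz
  | smul p y _ hy => exact polynomial_smul_mem_taylorE p hy

/-! ### Local structure of derivative modules -/

section Local

variable {K : Type*} [Field K] [Algebra K ℂ]

theorem polynomial_smul_eq (p : Polynomial K) (x : PowerSeries ℂ) :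
    p • x = PowerSeries.map (algebraMap K ℂ) (p : PowerSeries K) * x := by
  rw [Algebra.smul_def, PowerSeries.algebraMap_apply']

theorem powerSeries_smul_eq (c : PowerSeries K) (x : PowerSeries ℂ) :
    c • x = PowerSeries.map (algebraMap K ℂ) c * x := by
  rw [Algebra.smul_def]
  rfl

theorem polynomial_X_smul_eq (x : PowerSeries ℂ) :
    (Polynomial.X : Polynomial K) • x = X * x := by
  rw [polynomial_smul_eq]
  simp

theorem constantCoeff_polynomial_smul (p : Polynomial K) (x : PowerSeries ℂ) :
    constantCoeff (p • x) = p.coeff 0 • constantCoeff x := by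
  rw [polynomial_smul_eq, map_mul, Algebra.smul_def]
  congr 1

theorem constantCoeff_powerSeries_smul (p : PowerSeries K) (x : PowerSeries ℂ) :
    constantCoeff (p • x) = constantCoeff p • constantCoeff x := by
  rw [powerSeries_smul_eq, map_mul, Algebra.smul_def]
  congr 1

theorem isTorsionFree_polynomial_powerSeries :
    Module.IsTorsionFree (Polynomial K) (PowerSeries ℂ) := by
  rw [Module.isTorsionFree_iff_algebraMap_injective]
  intro p q h
  rw [PowerSeries.algebraMap_apply', PowerSeries.algebraMap_apply'] at h
  exact Polynomial.coe_injective _ (PowerSeries.map_injective _ (algebraMap K ℂ).injective h)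

theorem polynomial_smul_powerSeries_smul (p : Polynomial K) (a : PowerSeries K)
    (x : PowerSeries ℂ) : (p • a) • x = a • p • x := by
  have h : p • a = (p : PowerSeries K) * a := by
    rw [Algebra.smul_def, PowerSeries.algebraMap_apply', Algebra.algebraMap_self, PowerSeries.map_id]
    rfl
  rw [h, powerSeries_smul_eq, powerSeries_smul_eq, polynomial_smul_eq, map_mul]
  ring

theorem isTorsionFree_polynomial_powerSeries_self {K : Type*} [Field K] :
    Module.IsTorsionFree (Polynomial K) (PowerSeries K) := by
  rw [Module.isTorsionFree_iff_algebraMap_injective]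
  intro p q h
  rw [PowerSeries.algebraMap_apply', PowerSeries.algebraMap_apply'] at h
  exact Polynomial.coe_injective _ (PowerSeries.map_injective _ (algebraMap K K).injective h)

/-- Power series with independent constant coefficients are independent. -/
theorem linearIndependent_of_constantCoeff {ι : Type*} [Fintype ι] {e : ι → PowerSeries ℂ}
    (he : LinearIndependent K fun i => constantCoeff (e i)) :
    LinearIndependent (PowerSeries K) e := by
  rw [Fintype.linearIndependent_iff] at he ⊢
  intro c hc
  have key : ∀ n, ∃ c' : ι → PowerSeries K, (∀ i, c i = X ^ n * c' i) ∧ ∑ i, c' i • e i = 0 := by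
    intro n
    induction n with
    | zero => exact ⟨c, fun i => by simp, hc⟩
    | succ n ih =>
      obtain ⟨c', h1, h2⟩ := ih
      have h3 := congrArg constantCoeff h2
      simp only [map_sum, constantCoeff_powerSeries_smul, map_zero] at h3
      have h4 := he _ h3
      have h5 : ∀ i, ∃ d, c' i = X * d := fun i => X_dvd_iff.2 (h4 i)
      choose d hd using h5
      refine ⟨d, fun i => by rw [h1, hd, pow_succ, mul_assoc], ?_⟩
      have h6 : X * ∑ i, d i • e i = 0 := by
        rw [← h2, Finset.mul_sum]
        refine Finset.sum_congr rfl fun i _ => ?_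
        rw [powerSeries_smul_eq, powerSeries_smul_eq, hd, map_mul, map_X, mul_assoc]
      exact (mul_eq_zero.1 h6).resolve_left X_ne_zero
  intro i
  ext n
  obtain ⟨c', h1, -⟩ := key (n + 1)
  rw [h1, coeff_X_pow_mul']
  simp

theorem linearIndependent_polynomial_of_powerSeries {ι : Type*} [Fintype ι]
    {e : ι → PowerSeries ℂ} (he : LinearIndependent (PowerSeries K) e) :
    LinearIndependent (Polynomial K) e := by
  rw [Fintype.linearIndependent_iff] at he ⊢
  intro c hc i
  refine Polynomial.coe_eq_zero_iff.1 (he (fun i => (c i : PowerSeries K)) ?_ i)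
  rw [← hc]
  exact Finset.sum_congr rfl fun i _ => by rw [polynomial_smul_eq, powerSeries_smul_eq]

theorem derivSpan_self (g : PowerSeries ℂ) : g ∈ derivSpan K g :=
  Submodule.subset_span ⟨0, rfl⟩

/-- The saturation of a module of power series with respect to polynomials not vanishing at the
origin. -/
def locSat (N : Submodule (Polynomial K) (PowerSeries ℂ)) :
    Submodule (Polynomial K) (PowerSeries ℂ) where
  carrier := {x | ∃ c : Polynomial K, c.coeff 0 ≠ 0 ∧ c • x ∈ N}
  add_mem' := by
    rintro x y ⟨c, hc, hx⟩ ⟨d, hd, hy⟩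
    refine ⟨c * d, by rw [Polynomial.mul_coeff_zero]; exact mul_ne_zero hc hd, ?_⟩
    rw [smul_add, mul_smul, mul_smul, smul_comm c d x]
    exact add_mem (N.smul_mem _ hx) (N.smul_mem _ hy)
  zero_mem' := ⟨1, by simp, by simp⟩
  smul_mem' := by
    rintro a x ⟨c, hc, hx⟩
    exact ⟨c, hc, by rw [smul_comm]; exact N.smul_mem _ hx⟩

theorem locSat_mono {N M : Submodule (Polynomial K) (PowerSeries ℂ)} (h : N ≤ M) :
    locSat N ≤ locSat M := fun _ ⟨c, hc, hx⟩ => ⟨c, hc, h hx⟩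

theorem exists_regular_relation {t : ℕ} {x : PowerSeries ℂ} {e : Fin t → PowerSeries ℂ}
    (he : LinearIndependent K fun i => constantCoeff (e i)) (n : ℕ) :
    ∀ (c : Polynomial K) (d : Fin t → Polynomial K), c.natDegree ≤ n → c ≠ 0 →
      c • x + ∑ i, d i • e i = 0 → x ∈ locSat (Submodule.span (Polynomial K) (Set.range e)) := by
  induction n with
  | zero =>
    intro c d hc hc0 h
    refine ⟨c, ?_, ?_⟩
    · intro h0
      apply hc0
      rw [Polynomial.eq_C_of_natDegree_le_zero hc, h0, map_zero]
    · rw [eq_neg_of_add_eq_zero_left h]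
      exact neg_mem (sum_mem fun i _ => Submodule.smul_mem _ _ (Submodule.subset_span ⟨i, rfl⟩))
  | succ n ih =>
    intro c d hc hc0 h
    by_cases h0 : c.coeff 0 = 0
    · have h3 := congrArg constantCoeff h
      simp only [map_add, map_sum, constantCoeff_polynomial_smul, map_zero, h0, zero_smul,
        zero_add] at h3
      have h4 := Fintype.linearIndependent_iff.1 he _ h3
      have hX : ∀ p : Polynomial K, p.coeff 0 = 0 → p = Polynomial.X * p.divX := by
        intro p hp
        conv_lhs => rw [← Polynomial.divX_mul_X_add p, hp]
        rw [map_zero, add_zero, mul_comm]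
      refine ih c.divX (fun i => (d i).divX) ?_ ?_ ?_
      · rw [Polynomial.natDegree_divX_eq_natDegree_tsub_one]
        omega
      · intro h5
        apply hc0
        rw [hX c h0, h5, mul_zero]
      · have h6 : X * (c.divX • x + ∑ i, (d i).divX • e i) = 0 := by
          rw [← h, mul_add, Finset.mul_sum, ← polynomial_X_smul_eq (K := K), ← mul_smul, ← hX c h0]
          congr 1
          refine Finset.sum_congr rfl fun i _ => ?_
          rw [← polynomial_X_smul_eq (K := K), ← mul_smul, ← hX _ (h4 i)]
        exact (mul_eq_zero.1 h6).resolve_left X_ne_zero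
    · refine ⟨c, h0, ?_⟩
      rw [eq_neg_of_add_eq_zero_left h]
      exact neg_mem (sum_mem fun i _ => Submodule.smul_mem _ _ (Submodule.subset_span ⟨i, rfl⟩))

theorem constantCoeff_iterate_derivative_eq (k : ℕ) (g : PowerSeries ℂ) :
    constantCoeff ((d⁄dX ℂ)^[k] g) = ecoeff k g :=
  constantCoeff_iterate_derivative_eq_ecoeff ..

/-- A derivative module of maximal rank has a local frame at the origin. -/
theorem HasValueRank.exists_frame {g : PowerSeries ℂ} (h : HasValueRank K g) :
    ∃ (t : ℕ) (e : Fin t → PowerSeries ℂ), (∀ i, e i ∈ derivSpan K g) ∧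
      (LinearIndependent K fun i => constantCoeff (e i)) ∧
      derivSpan K g ≤ locSat (Submodule.span (Polynomial K) (Set.range e)) := by
  obtain ⟨hfd, hdep⟩ := h
  have : Module.Finite K (Submodule.span K (Set.range fun k => ecoeff k g)) := hfd
  obtain ⟨v, hv, -, hvi⟩ := Submodule.exists_fun_fin_finrank_span_eq K
    (Set.range fun k => ecoeff k g)
  choose k hk using hv
  have he : LinearIndependent K fun i => constantCoeff ((d⁄dX ℂ)^[k i] g) := by
    simp only [constantCoeff_iterate_derivative_eq, hk]
    exact hvi
  have hmem : ∀ i, (d⁄dX ℂ)^[k i] g ∈ derivSpan K g := fun i => Submodule.subset_span ⟨k i, rfl⟩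
  refine ⟨_, fun i => (d⁄dX ℂ)^[k i] g, hmem, he, fun x hx => ?_⟩
  have h1 := hdep (Fin.cons x fun i => (d⁄dX ℂ)^[k i] g) (by
    intro i
    refine Fin.cases ?_ (fun i => ?_) i
    · exact hx
    · exact hmem i)
  rw [Fintype.linearIndependent_iff] at h1
  push Not at h1
  obtain ⟨c, hc, i, hi⟩ := h1
  rw [Fin.sum_univ_succ] at hc
  simp only [Fin.cons_zero, Fin.cons_succ] at hc
  refine exists_regular_relation he _ (c 0) (fun i => c i.succ) le_rfl ?_ hc
  intro h0
  rw [h0, zero_smul, zero_add] at hc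
  have h2 := Fintype.linearIndependent_iff.1
    (linearIndependent_polynomial_of_powerSeries (linearIndependent_of_constantCoeff he)) _ hc
  apply hi
  refine Fin.cases ?_ (fun i => ?_) i
  · exact h0
  · exact h2 i

theorem exists_eq_X_smul_of_smul {N : Submodule (Polynomial K) (PowerSeries ℂ)}
    {x y : PowerSeries ℂ} {c : Polynomial K} (hc : c.coeff 0 ≠ 0) (hx : x ∈ N) (hy : y ∈ N)
    (h : c • x = (Polynomial.X : Polynomial K) • y) :
    ∃ m ∈ N, x = (Polynomial.X : Polynomial K) • m := by
  refine ⟨Polynomial.C (c.coeff 0)⁻¹ • (y - c.divX • x),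
    N.smul_mem _ (sub_mem hy (N.smul_mem _ hx)), ?_⟩
  rw [smul_comm, smul_sub, ← h, ← mul_smul, ← sub_smul]
  have : c - Polynomial.X * c.divX = Polynomial.C (c.coeff 0) := by
    conv_lhs => lhs; rw [← Polynomial.divX_mul_X_add c]
    ring
  rw [this, ← mul_smul, ← Polynomial.C_mul, inv_mul_cancel₀ hc, map_one, one_smul]

theorem HasValueRank.exists_eq_X_smul {g : PowerSeries ℂ} (h : HasValueRank K g)
    (h0 : constantCoeff g = 0) :
    ∃ m ∈ derivSpan K g, g = (Polynomial.X : Polynomial K) • m := by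
  obtain ⟨t, e, hmem, he, hloc⟩ := h.exists_frame
  obtain ⟨c, hc, hcg⟩ := hloc (derivSpan_self g)
  obtain ⟨d, hd⟩ := (Submodule.mem_span_range_iff_exists_fun _).1 hcg
  have h1 := congrArg constantCoeff hd
  simp only [map_sum, constantCoeff_polynomial_smul, h0, smul_zero] at h1
  have h2 := Fintype.linearIndependent_iff.1 he _ h1
  refine exists_eq_X_smul_of_smul hc (derivSpan_self g)
    (y := ∑ i, (d i).divX • e i) (sum_mem fun i _ => Submodule.smul_mem _ _ (hmem i)) ?_
  rw [← hd, Finset.smul_sum]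
  refine Finset.sum_congr rfl fun i _ => ?_
  rw [← mul_smul]
  congr 1
  conv_lhs => rw [← Polynomial.divX_mul_X_add (d i), h2 i]
  rw [map_zero, add_zero, mul_comm]

end Local

theorem derivSpan_le_of_mem {M : Submodule (Polynomial ℚ) (PowerSeries ℂ)}
    (hM : ∀ x ∈ M, d⁄dX ℂ x ∈ M) {x : PowerSeries ℂ} (hx : x ∈ M) : derivSpan ℚ x ≤ M := by
  rw [derivSpan, Submodule.span_le]
  rintro _ ⟨k, rfl⟩
  beta_reduce
  induction k with
  | zero => exact hx
  | succ k ih => rw [Function.iterate_succ_apply']; exact hM _ ih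

theorem derivative_mem_iSup_derivSpan {n : ℕ} (y : Fin n → PowerSeries ℂ) (x : PowerSeries ℂ)
    (hx : x ∈ ⨆ i, derivSpan ℚ (y i)) : d⁄dX ℂ x ∈ ⨆ i, derivSpan ℚ (y i) := by
  induction hx using Submodule.iSup_induction' with
  | mem i x hx =>
    refine Submodule.mem_iSup_of_mem i ?_
    induction hx using Submodule.span_induction with
    | mem x hx =>
      obtain ⟨k, rfl⟩ := hx
      exact Submodule.subset_span ⟨k + 1, Function.iterate_succ_apply' ..⟩
    | zero => rw [map_zero]; exact zero_mem _
    | add x z _ _ hx hz => rw [map_add]; exact add_mem hx hz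
    | smul p x hx hx' =>
      rw [derivative_polynomial_smul]
      exact add_mem (Submodule.smul_mem _ _ hx) (Submodule.smul_mem _ _ hx')
  | zero => rw [map_zero]; exact zero_mem _
  | add x z _ _ hx hz => rw [map_add]; exact add_mem hx hz

/-- Finitely many expansions of rational `E`-functions are polynomial combinations of power series
with independent constant coefficients. -/
theorem exists_lattice_of_taylorE {n : ℕ} {y : Fin n → PowerSeries ℂ} (hy : ∀ i, y i ∈ taylorE) :
    ∃ (m : ℕ) (b : Fin m → PowerSeries ℂ) (D : Fin n → Fin m → Polynomial ℚ),
      (∀ j, b j ∈ taylorE) ∧ LinearIndependent (PowerSeries ℚ) b ∧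
        ∀ i, y i = ∑ j, D i j • b j := by
  classical
  choose t e hmem he hloc using fun i => (hasValueRank_of_mem_taylorE (hy i)).exists_frame
  set S : Set (PowerSeries ℂ) := Set.range y ∪ ⋃ i, Set.range (e i) with hS
  have hSfin : S.Finite := (Set.finite_range y).union (Set.finite_iUnion fun i => Set.finite_range _)
  set N := Submodule.span (Polynomial ℚ) S with hN
  set D := ⨆ i, derivSpan ℚ (y i) with hD
  have hyD : ∀ i, derivSpan ℚ (y i) ≤ D := fun i => le_iSup (fun i => derivSpan ℚ (y i)) i
  have hND : N ≤ D := by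
    rw [hN, Submodule.span_le, hS, Set.union_subset_iff, Set.iUnion_subset_iff]
    refine ⟨?_, fun i => ?_⟩
    · rintro _ ⟨i, rfl⟩
      exact hyD i (derivSpan_self _)
    · rintro _ ⟨j, rfl⟩
      exact hyD i (hmem i j)
  have hDE : ∀ x ∈ D, x ∈ taylorE := by
    intro x hx
    induction hx using Submodule.iSup_induction' with
    | mem i x hx => exact derivSpan_subset_taylorE (hy i) hx
    | zero => exact zero_mem _
    | add x z _ _ hx hz => exact add_mem hx hz
  have hDloc : D ≤ locSat N := iSup_le fun i => (hloc i).trans (locSat_mono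
    (Submodule.span_mono (Set.subset_union_of_subset_right (Set.subset_iUnion
      (fun i => Set.range (e i)) i) _)))
  have hsat : ∀ x ∈ N, constantCoeff x = 0 →
      ∃ m ∈ N, x = (Polynomial.X : Polynomial ℚ) • m := by
    intro x hx hx0
    obtain ⟨m, hm, hxm⟩ := (hasValueRank_of_mem_taylorE (hDE x (hND hx))).exists_eq_X_smul hx0
    obtain ⟨c, hc, hcm⟩ := hDloc (derivSpan_le_of_mem (derivative_mem_iSup_derivSpan y) (hND hx) hm)
    refine exists_eq_X_smul_of_smul hc hx hcm ?_
    rw [smul_comm, ← hxm]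
  have := isTorsionFree_polynomial_powerSeries (K := ℚ)
  have : Module.Finite (Polynomial ℚ) N := Module.Finite.span_of_finite _ hSfin
  obtain ⟨m, b⟩ := Module.basisOfFiniteTypeTorsionFree' (R := Polynomial ℚ) (M := N)
  have hb : LinearIndependent ℚ fun i => constantCoeff (b i : PowerSeries ℂ) := by
    rw [Fintype.linearIndependent_iff]
    intro q hq i
    have h1 : constantCoeff ((∑ i, Polynomial.C (q i) • b i : N) : PowerSeries ℂ) = 0 := by
      rw [← hq, AddSubmonoidClass.coe_finsetSum, map_sum]
      refine Finset.sum_congr rfl fun i _ => ?_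
      rw [Submodule.coe_smul, constantCoeff_polynomial_smul, Polynomial.coeff_C_zero]
    obtain ⟨z, hz, hxz⟩ := hsat _ (Subtype.property _) h1
    have h2 : (∑ i, Polynomial.C (q i) • b i : N) = (Polynomial.X : Polynomial ℚ) • ⟨z, hz⟩ :=
      Subtype.ext hxz
    have h3 := congrArg (b.coord i) h2
    simp only [map_sum, map_smul, Module.Basis.coord_apply, b.repr_self, smul_eq_mul] at h3
    have h4 := congrArg (fun p => Polynomial.coeff p 0) h3
    simpa [Finsupp.single_apply] using h4
  have hbli := linearIndependent_of_constantCoeff hb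
  have hyN : ∀ i, y i ∈ N := fun i => Submodule.subset_span (Or.inl ⟨i, rfl⟩)
  have hyb : ∀ i, y i = ∑ j, b.repr ⟨y i, hyN i⟩ j • (b j : PowerSeries ℂ) := by
    intro i
    have := congrArg Subtype.val (b.sum_repr ⟨y i, hyN i⟩)
    rw [AddSubmonoidClass.coe_finsetSum] at this
    exact this.symm
  exact ⟨m, fun j => b j, fun i j => b.repr ⟨y i, hyN i⟩ j,
    fun j => hDE _ (hND (b j).2), hbli, hyb⟩

/-- Independence over polynomials of polynomial combinations of power series which are independent
over power series. -/
theorem linearIndependent_powerSeries_of_lattice {K : Type*} [Field K] [Algebra K ℂ] {n m : ℕ}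
    {y : Fin n → PowerSeries ℂ} {b : Fin m → PowerSeries ℂ} {D : Fin n → Fin m → Polynomial K}
    (hbli : LinearIndependent (PowerSeries K) b) (hyb : ∀ i, y i = ∑ j, D i j • b j)
    (hli : LinearIndependent (Polynomial K) y) : LinearIndependent (PowerSeries K) y := by
  have := isTorsionFree_polynomial_powerSeries_self (K := K)
  rw [Fintype.linearIndependent_iff]
  intro a ha
  by_contra hne
  push Not at hne
  obtain ⟨i₀, hi₀⟩ := hne
  have hrel : ∀ j, ∑ i, D i j • a i = 0 := by
    refine Fintype.linearIndependent_iff.1 hbli _ ?_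
    rw [← ha]
    simp only [Finset.sum_smul]
    rw [Finset.sum_comm]
    refine Finset.sum_congr rfl fun i _ => ?_
    conv_rhs => rw [hyb i, Finset.smul_sum]
    refine Finset.sum_congr rfl fun j _ => ?_
    exact polynomial_smul_powerSeries_smul _ _ _
  have ha0 : a ≠ 0 := fun h => hi₀ (congrFun h i₀)
  have hsol := exists_ne_zero_solution_of_torsionFree (R := Polynomial K) (M := PowerSeries K)
    D a ha0
  obtain ⟨c, hc0, hc⟩ := hsol hrel
  apply hc0
  funext i
  refine Fintype.linearIndependent_iff.1 hli c ?_ i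
  have : ∀ i, c i • y i = ∑ j, (D i j * c i) • b j := by
    intro i
    conv_lhs => rw [hyb i, Finset.smul_sum]
    refine Finset.sum_congr rfl fun j _ => ?_
    rw [← mul_smul, mul_comm]
  rw [Finset.sum_congr rfl fun i _ => this i, Finset.sum_comm]
  refine Finset.sum_eq_zero fun j _ => ?_
  rw [← Finset.sum_smul, hc j, zero_smul]

/-- Expansions of rational `E`-functions which are independent over `ℚ[X]` are independent over
`ℚ⟦X⟧`. -/
theorem linearIndependent_powerSeries_of_taylorE {n : ℕ} {y : Fin n → PowerSeries ℂ}
    (hy : ∀ i, y i ∈ taylorE) (hli : LinearIndependent (Polynomial ℚ) y) :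
    LinearIndependent (PowerSeries ℚ) y := by
  obtain ⟨m, b, D, -, hbli, hyb⟩ := exists_lattice_of_taylorE hy
  exact linearIndependent_powerSeries_of_lattice hbli hyb hli

section

open scoped TensorProduct

/-! ### Linear disjointness and algebraic extensions -/

theorem linearDisjoint_of_isIntegral {k Ω : Type*} [Field k] [CharZero k] [Field Ω] [Algebra k Ω]
    {F L L' : IntermediateField k Ω} (hd : L.LinearDisjoint F)
    (hF : ∀ x : F, IsIntegral k x → x ∈ (algebraMap k F).range) (hLL' : L ≤ L')
    (halg : ∀ x ∈ L', IsIntegral L x) : L'.LinearDisjoint F := by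
  rw [IntermediateField.linearDisjoint_iff', Subalgebra.linearDisjoint_iff_injective] at hd ⊢
  have : NoZeroDivisors (L'.toSubalgebra ⊗[k] F.toSubalgebra) :=
    noZeroDivisors_tensorProduct (L := L') hF
  have : Nontrivial (L.toSubalgebra ⊗[k] F.toSubalgebra) := ⟨0, 1, fun h => by
    have := congrArg (L.toSubalgebra.mulMap F.toSubalgebra) h
    rw [map_zero, map_one] at this
    exact zero_ne_one this⟩
  set ψ := L'.toSubalgebra.mulMap F.toSubalgebra with hψ
  have : Nontrivial (L'.toSubalgebra ⊗[k] F.toSubalgebra) := ⟨0, 1, fun h => by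
    have := congrArg ψ h
    rw [map_zero, map_one] at this
    exact zero_ne_one this⟩
  have : IsDomain (L'.toSubalgebra ⊗[k] F.toSubalgebra) := NoZeroDivisors.to_isDomain _
  let i : L.toSubalgebra →ₐ[k] L'.toSubalgebra := Subalgebra.inclusion hLL'
  let j : (L.toSubalgebra ⊗[k] F.toSubalgebra) →ₐ[k] (L'.toSubalgebra ⊗[k] F.toSubalgebra) :=
    Algebra.TensorProduct.map i (AlgHom.id k _)
  have hcomp : ∀ x, ψ (j x) = L.toSubalgebra.mulMap F.toSubalgebra x := by
    intro x
    induction x using TensorProduct.induction_on with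
    | zero => rw [map_zero, map_zero, map_zero]
    | add x y hx hy => rw [map_add, map_add, map_add, hx, hy]
    | tmul l f => rfl
  let _ : Algebra (L.toSubalgebra ⊗[k] F.toSubalgebra) (L'.toSubalgebra ⊗[k] F.toSubalgebra) :=
    j.toRingHom.toAlgebra
  have hj : ∀ x, algebraMap (L.toSubalgebra ⊗[k] F.toSubalgebra)
      (L'.toSubalgebra ⊗[k] F.toSubalgebra) x = j x := fun _ => rfl
  have hleft : ∀ l : L'.toSubalgebra,
      IsIntegral (L.toSubalgebra ⊗[k] F.toSubalgebra) (l ⊗ₜ[k] (1 : F.toSubalgebra)) := by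
    intro l
    obtain ⟨p, hp, hpl⟩ := halg l.1 l.2
    have hpl' : Polynomial.eval₂ (i : L.toSubalgebra →+* L'.toSubalgebra) l p = 0 := by
      apply Subtype.val_injective
      have h1 := Polynomial.hom_eval₂ p (i : L.toSubalgebra →+* L'.toSubalgebra)
        (L'.toSubalgebra.val : L'.toSubalgebra →+* Ω) l
      refine Eq.trans h1 ?_
      exact hpl
    let a : L.toSubalgebra →+* L.toSubalgebra ⊗[k] F.toSubalgebra :=
      (Algebra.TensorProduct.includeLeft :
        L.toSubalgebra →ₐ[k] L.toSubalgebra ⊗[k] F.toSubalgebra)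
    let a' : L'.toSubalgebra →+* L'.toSubalgebra ⊗[k] F.toSubalgebra :=
      (Algebra.TensorProduct.includeLeft :
        L'.toSubalgebra →ₐ[k] L'.toSubalgebra ⊗[k] F.toSubalgebra)
    refine ⟨Polynomial.map a p, hp.map _, ?_⟩
    rw [Polynomial.eval₂_map]
    have h2 := Polynomial.hom_eval₂ p (i : L.toSubalgebra →+* L'.toSubalgebra) a' l
    rw [hpl', map_zero] at h2
    have h3 : (algebraMap (L.toSubalgebra ⊗[k] F.toSubalgebra)
        (L'.toSubalgebra ⊗[k] F.toSubalgebra)).comp a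
        = a'.comp (i : L.toSubalgebra →+* L'.toSubalgebra) := by
      ext x
      change j (x ⊗ₜ 1) = (i x) ⊗ₜ 1
      simp [j]
    rw [h3]
    exact h2.symm
  have : Algebra.IsIntegral (L.toSubalgebra ⊗[k] F.toSubalgebra)
      (L'.toSubalgebra ⊗[k] F.toSubalgebra) := by
    refine ⟨fun x => ?_⟩
    induction x using TensorProduct.induction_on with
    | zero => exact isIntegral_zero
    | add x y hx hy => exact hx.add hy
    | tmul l f =>
      have h1 : l ⊗ₜ[k] f = (l ⊗ₜ[k] 1) * algebraMap (L.toSubalgebra ⊗[k] F.toSubalgebra)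
          (L'.toSubalgebra ⊗[k] F.toSubalgebra) (1 ⊗ₜ f) := by
        rw [hj]
        simp [j]
      rw [h1]
      exact (hleft l).mul isIntegral_algebraMap
  rw [injective_iff_map_eq_zero]
  intro x hx
  have hbot : RingHom.ker (ψ : L'.toSubalgebra ⊗[k] F.toSubalgebra →+* Ω) = ⊥ := by
    refine Ideal.eq_bot_of_comap_eq_bot (R := L.toSubalgebra ⊗[k] F.toSubalgebra) ?_
    rw [eq_bot_iff]
    intro y hy
    rw [Ideal.mem_comap, RingHom.mem_ker, hj] at hy
    have hy' : ψ (j y) = 0 := hy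
    rw [hcomp] at hy'
    rw [Ideal.mem_bot]
    exact (injective_iff_map_eq_zero _).1 hd y hy'
  have : x ∈ RingHom.ker (ψ : L'.toSubalgebra ⊗[k] F.toSubalgebra →+* Ω) := hx
  rwa [hbot, Ideal.mem_bot] at this

end

/-! ### Linear disjointness over subrings of a field -/

/-- Linear independence of a finite family of elements of a field with respect to coefficients in a
subset. -/
def IndepOver {Ω : Type*} [Field Ω] (A : Set Ω) {n : ℕ} (y : Fin n → Ω) : Prop :=
  ∀ a : Fin n → Ω, (∀ i, a i ∈ A) → ∑ i, a i * y i = 0 → ∀ i, a i = 0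

section

variable {Ω : Type*} [Field Ω]

theorem exists_common_denominator (R : Subring Ω) {ι : Type*} (s : Finset ι) (a : ι → Ω)
    (ha : ∀ i ∈ s, a i ∈ Subfield.closure (R : Set Ω)) :
    ∃ d ∈ R, d ≠ 0 ∧ ∀ i ∈ s, d * a i ∈ R := by
  classical
  induction s using Finset.induction_on with
  | empty => exact ⟨1, one_mem _, one_ne_zero, by simp⟩
  | insert i s _ ih =>
    obtain ⟨d, hd, hd0, h⟩ := ih fun i hi => ha i (Finset.mem_insert_of_mem hi)
    obtain ⟨y, hy, z, hz, hyz⟩ := Subfield.mem_closure_iff.1 (ha i (Finset.mem_insert_self i s))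
    rw [Subring.closure_eq] at hy hz
    by_cases hz0 : z = 0
    · refine ⟨d, hd, hd0, fun j hj => ?_⟩
      rcases Finset.mem_insert.1 hj with rfl | hj
      · rw [← hyz, hz0, div_zero, mul_zero]
        exact zero_mem _
      · exact h j hj
    · refine ⟨z * d, mul_mem hz hd, mul_ne_zero hz0 hd0, fun j hj => ?_⟩
      rcases Finset.mem_insert.1 hj with rfl | hj
      · have : z * d * a j = d * y := by
          rw [← hyz]
          field_simp
        rw [this]
        exact mul_mem hd hy
      · rw [mul_assoc]
        exact mul_mem hz (h j hj)

theorem IndepOver.closure {R : Subring Ω} {n : ℕ} {y : Fin n → Ω} (h : IndepOver (R : Set Ω) y) :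
    IndepOver (Subfield.closure (R : Set Ω) : Set Ω) y := by
  intro a ha hs i
  obtain ⟨d, -, hd0, hd⟩ := exists_common_denominator R Finset.univ a fun i _ => ha i
  have h1 := h (fun i => d * a i) (fun i => hd i (Finset.mem_univ i)) (by
    simp only [mul_assoc]
    rw [← Finset.mul_sum, hs, mul_zero]) i
  exact (mul_eq_zero.1 h1).resolve_left hd0

theorem linearIndependent_of_indepOver {k : Type*} [Field k] [Algebra k Ω] {L : IntermediateField k Ω}
    {n : ℕ} {y : Fin n → Ω} (h : IndepOver (L : Set Ω) y) : LinearIndependent L y := by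
  rw [Fintype.linearIndependent_iff]
  intro g hg i
  exact Subtype.ext (h (fun i => (g i : Ω)) (fun i => (g i).2) hg i)

/-- A subring `E` whose fraction field is linearly disjoint from that of `S` and has no nontrivial
elements algebraic over the base remains independent over all elements integral over `S`. -/
theorem IndepOver.of_isIntegral [CharZero Ω] {R E S : Subring Ω} (hRE : R ≤ E) (hRS : R ≤ S)
    (hind : ∀ (n : ℕ) (y : Fin n → Ω), (∀ i, y i ∈ E) → IndepOver (R : Set Ω) y →
      IndepOver (S : Set Ω) y)
    (hclosed : ∀ u ∈ E, ∀ v ∈ E, v ≠ 0 → ∀ (e : ℕ) (q : ℕ → Ω), (∀ i, q i ∈ R) →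
      ∑ i ∈ Finset.range (e + 2), q i * u ^ i * v ^ (e + 1 - i) = 0 →
      ∃ r ∈ R, q (e + 1) * u = r * v)
    {n : ℕ} {y : Fin n → Ω} (hyE : ∀ i, y i ∈ E) (hy : IndepOver (R : Set Ω) y) :
    IndepOver {x : Ω | IsIntegral S x} y := by
  classical
  set k : Subfield Ω := Subfield.closure (R : Set Ω) with hk
  have hkE : k ≤ Subfield.closure (E : Set Ω) := Subfield.closure_mono hRE
  have hkS : k ≤ Subfield.closure (S : Set Ω) := Subfield.closure_mono hRS
  let F : IntermediateField k Ω :=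
    (Subfield.closure (E : Set Ω)).toIntermediateField fun x => hkE x.2
  let L : IntermediateField k Ω :=
    (Subfield.closure (S : Set Ω)).toIntermediateField fun x => hkS x.2
  have hFmem : ∀ x, x ∈ F ↔ x ∈ Subfield.closure (E : Set Ω) := fun _ => Iff.rfl
  have hLmem : ∀ x, x ∈ L ↔ x ∈ Subfield.closure (S : Set Ω) := fun _ => Iff.rfl
  have hEF : ∀ x ∈ E, x ∈ F := fun x hx => Subfield.subset_closure hx
  have hRk : ∀ x ∈ R, x ∈ k := fun x hx => Subfield.subset_closure hx
  have hfin : ∀ (m : ℕ) (v : Fin m → F), LinearIndependent k v →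
      LinearIndependent L fun i => (v i : Ω) := by
    intro m v hv
    obtain ⟨d, hdE, hd0, hd⟩ := exists_common_denominator E Finset.univ (fun i => (v i : Ω))
      fun i _ => (v i).2
    have h1 : IndepOver (R : Set Ω) fun i => d * (v i : Ω) := by
      intro a ha hs i
      have h2 : ∑ i, (⟨a i, hRk _ (ha i)⟩ : k) • v i = 0 := by
        apply Subtype.ext
        rw [AddSubmonoidClass.coe_finsetSum]
        have h3 : d * ∑ i, a i * (v i : Ω) = 0 := by
          rw [← hs, Finset.mul_sum]
          exact Finset.sum_congr rfl fun i _ => by ring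
        exact (mul_eq_zero.1 h3).resolve_left hd0
      exact congrArg Subtype.val (Fintype.linearIndependent_iff.1 hv _ h2 i)
    have h4 := (hind m _ (fun i => hd i (Finset.mem_univ i)) h1).closure
    refine linearIndependent_of_indepOver (L := L) fun a ha hs i => ?_
    refine h4 a ha ?_ i
    have : ∑ i, a i * (d * (v i : Ω)) = d * ∑ i, a i * (v i : Ω) := by
      rw [Finset.mul_sum]
      exact Finset.sum_congr rfl fun i _ => by ring
    rw [this, hs, mul_zero]
  have hd : F.LinearDisjoint L := by
    refine IntermediateField.LinearDisjoint.of_basis_left (Module.Basis.ofVectorSpace k F) ?_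
    rw [linearIndependent_iff_finset_linearIndependent]
    intro s
    rw [← linearIndependent_equiv s.equivFin.symm]
    refine hfin _ (fun i => Module.Basis.ofVectorSpace k F (s.equivFin.symm i : _)) ?_
    exact (Module.Basis.ofVectorSpace k F).linearIndependent.comp _
      (Subtype.val_injective.comp s.equivFin.symm.injective)
  have hF : ∀ x : F, IsIntegral k x → x ∈ (algebraMap k F).range := by
    rintro ⟨x, hx⟩ hxi
    obtain ⟨p, hp, hpx⟩ := (hxi.map F.val : IsIntegral k x)
    obtain ⟨u, hu, v, hv, huv⟩ := Subfield.mem_closure_iff.1 ((hFmem x).1 hx)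
    rw [Subring.closure_eq] at hu hv
    by_cases hv0 : v = 0
    · refine ⟨0, ?_⟩
      apply Subtype.ext
      rw [map_zero]
      change (0 : Ω) = x
      rw [← huv, hv0, div_zero]
    have hdeg : p.natDegree ≠ 0 := by
      intro h0
      have := (Polynomial.Monic.natDegree_eq_zero (show p.Monic from hp)).1 h0
      rw [this, Polynomial.eval₂_one] at hpx
      exact one_ne_zero hpx
    obtain ⟨e, he⟩ := Nat.exists_eq_succ_of_ne_zero hdeg
    obtain ⟨d, hdR, hd0, hdq⟩ := exists_common_denominator R (Finset.range (e + 2))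
      (fun i => (p.coeff i : Ω)) fun i _ => (p.coeff i).2
    have hq : ∀ i, d * (p.coeff i : Ω) ∈ R := by
      intro i
      by_cases hi : i < e + 2
      · exact hdq i (Finset.mem_range.2 hi)
      · rw [Polynomial.coeff_eq_zero_of_natDegree_lt (by omega)]
        change d * (0 : Ω) ∈ R
        rw [mul_zero]
        exact zero_mem _
    rw [Polynomial.eval₂_eq_sum_range, he] at hpx
    have hrel : ∑ i ∈ Finset.range (e + 2), d * (p.coeff i : Ω) * u ^ i * v ^ (e + 1 - i) = 0 := by
      have h1 : ∑ i ∈ Finset.range (e + 2), d * (p.coeff i : Ω) * u ^ i * v ^ (e + 1 - i)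
          = d * v ^ (e + 1) * ∑ i ∈ Finset.range (e + 2), (p.coeff i : Ω) * x ^ i := by
        rw [Finset.mul_sum]
        refine Finset.sum_congr rfl fun i hi => ?_
        have hi' : i ≤ e + 1 := Nat.lt_succ_iff.1 (Finset.mem_range.1 hi)
        have h2 : v ^ (e + 1) = v ^ (e + 1 - i) * v ^ i := by rw [← pow_add]; congr 1; omega
        rw [h2, ← huv, div_pow]
        field_simp
      rw [h1]
      refine mul_eq_zero_of_right _ ?_
      exact hpx
    obtain ⟨r, hr, hru⟩ := hclosed u hu v hv hv0 e _ hq hrel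
    have hlead : (p.coeff (e + 1) : Ω) = 1 := by
      have : p.coeff (e + 1) = 1 := by
        rw [← Nat.succ_eq_add_one, ← he]
        exact hp
      rw [this]
      rfl
    rw [hlead, mul_one] at hru
    have hxk : x ∈ k := by
      have : x = r / d := by
        rw [← huv]
        field_simp
        linear_combination hru
      rw [this]
      exact div_mem (hRk _ hr) (hRk _ hdR)
    exact ⟨⟨x, hxk⟩, Subtype.ext rfl⟩
  let L' : IntermediateField k Ω := (algebraicClosure L Ω).restrictScalars k
  have hL' : ∀ x, x ∈ L' ↔ IsIntegral L x := fun x => mem_algebraicClosure_iff'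
  have hdis : L'.LinearDisjoint F := by
    refine linearDisjoint_of_isIntegral hd.symm hF (fun x hx => ?_) fun x hx => (hL' x).1 hx
    rw [hL']
    exact isIntegral_algebraMap (x := (⟨x, hx⟩ : L))
  have hyk : LinearIndependent k fun i => (⟨y i, hEF _ (hyE i)⟩ : F) := by
    rw [Fintype.linearIndependent_iff]
    intro g hg i
    have h1 := congrArg Subtype.val hg
    rw [AddSubmonoidClass.coe_finsetSum] at h1
    exact Subtype.ext (hy.closure (fun i => (g i : Ω)) (fun i => (g i).2) h1 i)
  have hfinal := hdis.symm.linearIndependent_left hyk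
  intro a ha hs i
  have hiL : ∀ i, IsIntegral L (a i) := by
    intro i
    obtain ⟨p, hp, hpa⟩ := ha i
    let j : S →+* L := (S.subtype).codRestrict L fun x => Subfield.subset_closure x.2
    refine ⟨p.map j, hp.map _, ?_⟩
    rw [Polynomial.eval₂_map]
    exact hpa
  have h5 := Fintype.linearIndependent_iff.1 hfinal (fun i => ⟨a i, (hL' _).2 (hiL i)⟩) hs i
  exact congrArg Subtype.val h5

end

/-! ### Independence over number fields -/

theorem taylorRat_polynomial_eq (p : Polynomial ℚ) :
    taylorRat ⟨p, polynomial_mem_entireRat p⟩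
      = algebraMap (Polynomial ℚ) (PowerSeries ℂ) (shiftPoly p) := by
  rw [taylorRat_polynomial, PowerSeries.algebraMap_apply']

theorem algebraMap_eq_taylorRat (p : Polynomial ℚ) :
    algebraMap (Polynomial ℚ) (PowerSeries ℂ) p
      = taylorRat ⟨_, polynomial_mem_entireRat (p.comp (Polynomial.X - 1))⟩ := by
  rw [taylorRat_polynomial_eq, shiftPoly, Polynomial.comp_assoc]
  simp

theorem exists_polynomial_of_taylorE_relation {u v : PowerSeries ℂ} (hu : u ∈ taylorE)
    (hv : v ∈ taylorE) (hv0 : v ≠ 0) {e : ℕ} {p : ℕ → Polynomial ℚ}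
    (h : ∑ i ∈ Finset.range (e + 2),
      algebraMap (Polynomial ℚ) (PowerSeries ℂ) (p i) * u ^ i * v ^ (e + 1 - i) = 0) :
    ∃ q : Polynomial ℚ, algebraMap (Polynomial ℚ) (PowerSeries ℂ) (p (e + 1)) * u
      = algebraMap (Polynomial ℚ) (PowerSeries ℂ) q * v := by
  obtain ⟨f, hf, rfl⟩ := mem_taylorE.1 hu
  obtain ⟨g, hg, rfl⟩ := mem_taylorE.1 hv
  have hf' := ratE_le_entireRat hf
  have hg' := ratE_le_entireRat hg
  have hg0 : g ≠ 0 := by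
    rintro rfl
    exact hv0 (map_zero taylorRat)
  simp only [algebraMap_eq_taylorRat (p _), ← map_pow, ← map_mul, ← map_sum] at h
  have h1 := congrArg Subtype.val (taylorRat_injective (h.trans (map_zero taylorRat).symm))
  rw [AddSubmonoidClass.coe_finsetSum] at h1
  obtain ⟨q, hq⟩ := exists_rat_polynomial_of_homogeneous_relation hf' hg' hg0
    (p := fun i => (p i).comp (Polynomial.X - 1)) h1
  refine ⟨shiftPoly q, ?_⟩
  rw [algebraMap_eq_taylorRat (p _), ← taylorRat_polynomial_eq, ← map_mul, ← map_mul]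
  exact congrArg taylorRat (Subtype.ext hq)

section

variable {K : IntermediateField ℚ ℂ} [FiniteDimensional ℚ K]

theorem map_eq_sum_coord (c : PowerSeries K) :
    PowerSeries.map (algebraMap K ℂ) c
      = ∑ j, C ((Module.finBasis ℚ K j : K) : ℂ) * PowerSeries.map (algebraMap ℚ ℂ)
        (coeffMap ((Module.finBasis ℚ K).coord j) c) := by
  ext n
  rw [map_sum, coeff_map]
  simp only [coeff_C_mul, coeff_map, coeff_coeffMap]
  conv_lhs => rw [← (Module.finBasis ℚ K).sum_repr (coeff n c)]
  rw [map_sum]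
  refine Finset.sum_congr rfl fun j _ => ?_
  rw [Algebra.smul_def, map_mul, mul_comm]
  rfl

theorem linearIndependent_powerSeries_numberField {n : ℕ} {y : Fin n → PowerSeries ℂ}
    (hy : ∀ i, y i ∈ taylorE) (hli : LinearIndependent (Polynomial ℚ) y) :
    LinearIndependent (PowerSeries K) y := by
  let Ω := FractionRing (PowerSeries ℂ)
  let φ : PowerSeries ℂ →+* Ω := algebraMap (PowerSeries ℂ) Ω
  have hφ : Function.Injective φ := IsFractionRing.injective _ _
  have : CharZero Ω := charZero_of_injective_ringHom (f := φ.comp (C (R := ℂ)))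
    (hφ.comp C_injective)
  let R : Subring Ω := (φ.comp (algebraMap (Polynomial ℚ) (PowerSeries ℂ))).range
  let S : Subring Ω := (φ.comp (PowerSeries.map (algebraMap ℚ ℂ))).range
  let E : Subring Ω := taylorE.map φ
  have hRE : R ≤ E := by
    rintro _ ⟨p, rfl⟩
    exact ⟨_, algebraMap_mem_taylorE p, rfl⟩
  have hRS : R ≤ S := by
    rintro _ ⟨p, rfl⟩
    refine ⟨p, ?_⟩
    rw [RingHom.comp_apply, RingHom.comp_apply, PowerSeries.algebraMap_apply']
  have hind : ∀ (n : ℕ) (y : Fin n → Ω), (∀ i, y i ∈ E) → IndepOver (R : Set Ω) y →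
      IndepOver (S : Set Ω) y := by
    intro n y hy hR
    choose x hx hxy using hy
    have h1 : LinearIndependent (Polynomial ℚ) x := by
      rw [Fintype.linearIndependent_iff]
      intro c hc i
      have h2 := hR (fun i => φ (algebraMap _ _ (c i))) (fun i => ⟨c i, rfl⟩) (by
        have := congrArg φ hc
        rw [map_sum, map_zero] at this
        rw [← this]
        refine Finset.sum_congr rfl fun i _ => ?_
        rw [Algebra.smul_def, map_mul, hxy]) i
      beta_reduce at h2
      rw [map_eq_zero_iff φ hφ, PowerSeries.algebraMap_apply'] at h2
      refine Polynomial.coe_eq_zero_iff.1 ?_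
      exact (map_eq_zero_iff _ (PowerSeries.map_injective _ (algebraMap ℚ ℂ).injective)).1 h2
    have h3 := Fintype.linearIndependent_iff.1 (linearIndependent_powerSeries_of_taylorE hx h1)
    intro a ha hs i
    choose c hc using ha
    rw [← hc i, h3 c ?_ i, map_zero]
    apply hφ
    rw [map_zero, ← hs, map_sum]
    refine Finset.sum_congr rfl fun i _ => ?_
    rw [powerSeries_smul_eq, map_mul, hxy, ← hc i]
    rfl
  have hclosed : ∀ u ∈ E, ∀ v ∈ E, v ≠ 0 → ∀ (e : ℕ) (q : ℕ → Ω), (∀ i, q i ∈ R) →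
      ∑ i ∈ Finset.range (e + 2), q i * u ^ i * v ^ (e + 1 - i) = 0 →
      ∃ r ∈ R, q (e + 1) * u = r * v := by
    rintro _ ⟨u, hu, rfl⟩ _ ⟨v, hv, rfl⟩ hv0 e q hq hs
    choose p hp using hq
    obtain ⟨r, hr⟩ := exists_polynomial_of_taylorE_relation hu hv
      (fun h => hv0 (by rw [h, map_zero])) (e := e) (p := p) (by
        apply hφ
        rw [map_zero, ← hs, map_sum]
        refine Finset.sum_congr rfl fun i _ => ?_
        rw [map_mul, map_mul, map_pow, map_pow, ← hp i]
        rfl)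
    refine ⟨_, ⟨r, rfl⟩, ?_⟩
    rw [← hp, RingHom.comp_apply, RingHom.comp_apply, ← map_mul, hr, map_mul]
  have hyR : IndepOver (R : Set Ω) fun i => φ (y i) := by
    intro a ha hs i
    choose c hc using ha
    rw [← hc i, Fintype.linearIndependent_iff.1 hli c ?_ i, map_zero]
    apply hφ
    rw [map_zero, ← hs, map_sum]
    refine Finset.sum_congr rfl fun i _ => ?_
    rw [Algebra.smul_def, map_mul, ← hc i]
    rfl
  have hfin := IndepOver.of_isIntegral hRE hRS hind hclosed (fun i => ⟨_, hy i, rfl⟩) hyR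
  have hInt : ∀ c : PowerSeries K, IsIntegral S (φ (PowerSeries.map (algebraMap K ℂ) c)) := by
    intro c
    rw [map_eq_sum_coord, map_sum]
    refine IsIntegral.sum _ fun j _ => ?_
    rw [map_mul]
    refine IsIntegral.mul ?_ ?_
    · have h1 : IsIntegral ℚ ((Module.finBasis ℚ K j : K) : ℂ) :=
        (Algebra.IsIntegral.isIntegral (R := ℚ) (Module.finBasis ℚ K j)).map K.val
      obtain ⟨p, hp, hpx⟩ := h1
      let j' : ℚ →+* S := (φ.comp (PowerSeries.map (algebraMap ℚ ℂ))).rangeRestrict.comp C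
      refine ⟨p.map j', hp.map _, ?_⟩
      rw [Polynomial.eval₂_map]
      have h2 := congrArg (φ.comp C) hpx
      rw [Polynomial.hom_eval₂, map_zero] at h2
      rw [← h2]
      congr 1
      exact Subsingleton.elim _ _
    · exact isIntegral_algebraMap (x := (⟨_, ⟨_, rfl⟩⟩ : S))
  rw [Fintype.linearIndependent_iff]
  intro c hc i
  have h5 := hfin (fun i => φ (PowerSeries.map (algebraMap K ℂ) (c i))) (fun i => hInt _) (by
    rw [← map_zero φ, ← hc, map_sum]
    refine Finset.sum_congr rfl fun i _ => ?_
    rw [powerSeries_smul_eq, map_mul]) i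
  beta_reduce at h5
  rw [map_eq_zero_iff φ hφ] at h5
  exact (map_eq_zero_iff _ (PowerSeries.map_injective _ (algebraMap K ℂ).injective)).1 h5

end

/-! ### The derivative module over a number field -/

section

variable (K : IntermediateField ℚ ℂ)

/-- The combinations of expansions of rational `E`-functions with coefficients in `K[X]`. -/
def taylorSpan : Submodule (Polynomial K) (PowerSeries ℂ) :=
  Submodule.span (Polynomial K) (taylorE : Set (PowerSeries ℂ))

variable {K}

theorem derivative_mem_taylorSpan {x : PowerSeries ℂ} (hx : x ∈ taylorSpan K) :
    d⁄dX ℂ x ∈ taylorSpan K := by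
  induction hx using Submodule.span_induction with
  | mem y hy => exact Submodule.subset_span (derivative_mem_taylorE hy)
  | zero => rw [map_zero]; exact zero_mem _
  | add y z _ _ hy hz => rw [map_add]; exact add_mem hy hz
  | smul p y hy' hy =>
    rw [derivative_polynomial_smul]
    exact add_mem (Submodule.smul_mem _ _ hy') (Submodule.smul_mem _ _ hy)

theorem derivSpan_le_taylorSpan {x : PowerSeries ℂ} (hx : x ∈ taylorSpan K) :
    derivSpan K x ≤ taylorSpan K := by
  rw [derivSpan, Submodule.span_le]
  rintro _ ⟨k, rfl⟩
  beta_reduce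
  induction k with
  | zero => exact hx
  | succ k ih => rw [Function.iterate_succ_apply']; exact derivative_mem_taylorSpan ih

theorem coeff_polynomial_smul_mem {W : Submodule K ℂ} {x : PowerSeries ℂ}
    (hx : ∀ n, coeff n x ∈ W) (p : Polynomial K) (n : ℕ) : coeff n (p • x) ∈ W := by
  rw [polynomial_smul_eq, coeff_mul]
  refine sum_mem fun i _ => ?_
  rw [coeff_map, ← Algebra.smul_def]
  exact W.smul_mem _ (hx _)

theorem mem_of_ecoeff_mem {W : Submodule K ℂ} {x : PowerSeries ℂ} (hx : ∀ n, ecoeff n x ∈ W)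
    (n : ℕ) : coeff n x ∈ W := by
  rw [coeff_eq_ecoeff_div]
  have : ecoeff n x / (n.factorial : ℂ) = ((n.factorial : K)⁻¹) • ecoeff n x := by
    rw [Algebra.smul_def, map_inv₀, map_natCast, mul_comm, div_eq_mul_inv]
  rw [this]
  exact W.smul_mem _ (hx n)

theorem ecoeff_mem_of_coeff_mem {W : Submodule K ℂ} {x : PowerSeries ℂ}
    (hx : ∀ n, coeff n x ∈ W) (n : ℕ) : ecoeff n x ∈ W := by
  have : ecoeff n x = (n.factorial : K) • coeff n x := by
    rw [Algebra.smul_def, map_natCast, ecoeff]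
  rw [this]
  exact W.smul_mem _ (hx n)

theorem exists_fg_of_mem_taylorSpan {x : PowerSeries ℂ} (hx : x ∈ taylorSpan K) :
    ∃ W : Submodule K ℂ, W.FG ∧ ∀ n, coeff n x ∈ W := by
  induction hx using Submodule.span_induction with
  | mem y hy =>
    have hfd := (hasValueRank_of_mem_taylorE hy).1
    obtain ⟨s, hs⟩ := (Submodule.fg_iff_finiteDimensional _).2 hfd
    refine ⟨Submodule.span K (s : Set ℂ), ⟨s, rfl⟩, mem_of_ecoeff_mem fun n => ?_⟩
    have h1 : ecoeff n y ∈ valueSpan ℚ y := Submodule.subset_span ⟨n, rfl⟩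
    rw [← hs] at h1
    exact Submodule.span_le_restrictScalars ℚ K (s : Set ℂ) h1
  | zero => exact ⟨⊥, Submodule.fg_bot, fun n => by rw [map_zero]; exact zero_mem _⟩
  | add y z _ _ hy hz =>
    obtain ⟨W, hW, h⟩ := hy
    obtain ⟨W', hW', h'⟩ := hz
    refine ⟨W ⊔ W', hW.sup hW', fun n => ?_⟩
    rw [map_add]
    exact add_mem (Submodule.mem_sup_left (h n)) (Submodule.mem_sup_right (h' n))
  | smul p y _ hy =>
    obtain ⟨W, hW, h⟩ := hy
    exact ⟨W, hW, coeff_polynomial_smul_mem h p⟩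

theorem coeff_derivative_mem {W : Submodule K ℂ} {x : PowerSeries ℂ}
    (hx : ∀ n, coeff n x ∈ W) (n : ℕ) : coeff n (d⁄dX ℂ x) ∈ W := by
  have : coeff n (d⁄dX ℂ x) = ((n : K) + 1) • coeff (n + 1) x := by
    rw [coeff_derivative, Algebra.smul_def, map_add, map_natCast, map_one, mul_comm]
  rw [this]
  exact W.smul_mem _ (hx _)

theorem coeff_mem_of_mem_derivSpan {W : Submodule K ℂ} {x y : PowerSeries ℂ}
    (hx : ∀ n, coeff n x ∈ W) (hy : y ∈ derivSpan K x) : ∀ n, coeff n y ∈ W := by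
  induction hy using Submodule.span_induction with
  | mem y hy =>
    obtain ⟨k, rfl⟩ := hy
    beta_reduce
    induction k with
    | zero => exact hx
    | succ k ih => rw [Function.iterate_succ_apply']; exact coeff_derivative_mem ih
  | zero => intro n; rw [map_zero]; exact zero_mem _
  | add y z _ _ hy hz => intro n; rw [map_add]; exact add_mem (hy n) (hz n)
  | smul p y _ hy => exact coeff_polynomial_smul_mem hy p

theorem exists_coordinates (W : Submodule K ℂ) [FiniteDimensional K W] :
    ∃ (v : Fin (Module.finrank K W) → ℂ) (l : Fin (Module.finrank K W) → ℂ →ₗ[K] K),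
      ∀ x ∈ W, x = ∑ i, l i x • v i := by
  have h := fun i => LinearMap.exists_extend ((Module.finBasis K W).coord i)
  choose l hl using h
  refine ⟨fun i => Module.finBasis K W i, l, fun x hx => ?_⟩
  have h1 := congrArg Subtype.val ((Module.finBasis K W).sum_repr ⟨x, hx⟩)
  rw [AddSubmonoidClass.coe_finsetSum] at h1
  refine h1.symm.trans (Finset.sum_congr rfl fun i _ => ?_)
  have h2 := LinearMap.congr_fun (hl i) ⟨x, hx⟩
  rw [Module.Basis.coord_apply] at h2
  rw [Submodule.coe_smul, ← h2]
  rfl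

theorem linearIndependent_powerSeries_of_taylorSpan [FiniteDimensional ℚ K] {n : ℕ}
    {x : Fin n → PowerSeries ℂ} (hx : ∀ i, x i ∈ taylorSpan K)
    (hli : LinearIndependent (Polynomial K) x) : LinearIndependent (PowerSeries K) x := by
  classical
  choose T hT hxT using fun i => Submodule.mem_span_finite_of_mem_span (hx i)
  let U : Finset (PowerSeries ℂ) := Finset.univ.biUnion T
  have hU : ∀ y ∈ U, y ∈ taylorE := by
    intro y hy
    obtain ⟨i, -, hi⟩ := Finset.mem_biUnion.1 hy
    exact hT i hi
  let y : Fin U.card → PowerSeries ℂ := fun j => (U.equivFin.symm j : PowerSeries ℂ)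
  have hyr : Set.range y = U := by
    ext z
    constructor
    · rintro ⟨j, rfl⟩
      exact (U.equivFin.symm j).2
    · intro hz
      exact ⟨U.equivFin ⟨z, hz⟩, by simp [y]⟩
  obtain ⟨m, b, D, hbE, hbli, hyb⟩ := exists_lattice_of_taylorE (y := y)
    fun j => hU _ (U.equivFin.symm j).2
  have hbK : LinearIndependent (PowerSeries K) b := linearIndependent_powerSeries_numberField hbE
    (linearIndependent_polynomial_of_powerSeries hbli)
  have hle : Submodule.span (Polynomial K) (U : Set (PowerSeries ℂ))
      ≤ Submodule.span (Polynomial K) (Set.range b) := by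
    rw [← hyr, Submodule.span_le]
    rintro _ ⟨j, rfl⟩
    rw [hyb j]
    refine sum_mem fun l _ => ?_
    have : D j l • b l = (D j l).map (algebraMap ℚ K) • b l := by
      rw [polynomial_smul_eq, polynomial_smul_eq, ← Polynomial.polynomial_map_coe,
        ← Polynomial.polynomial_map_coe, Polynomial.map_map, ← IsScalarTower.algebraMap_eq]
    rw [this]
    exact Submodule.smul_mem _ _ (Submodule.subset_span ⟨l, rfl⟩)
  have hxb : ∀ i, ∃ c : Fin m → Polynomial K, ∑ j, c j • b j = x i := fun i =>
    (Submodule.mem_span_range_iff_exists_fun _).1 (hle (Submodule.span_mono (by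
      intro z hz
      exact Finset.mem_biUnion.2 ⟨i, Finset.mem_univ _, hz⟩) (hxT i)))
  choose c hc using hxb
  exact linearIndependent_powerSeries_of_lattice hbK (fun i => (hc i).symm) hli

/-- The derivative module of a `K`-combination of `E`-functions has rank at most the dimension of the
space of values at `1`. -/
theorem hasValueRank_of_mem_taylorSpan [FiniteDimensional ℚ K] {g : PowerSeries ℂ}
    (hg : g ∈ taylorSpan K) : HasValueRank K g := by
  obtain ⟨W, hW, hgW⟩ := exists_fg_of_mem_taylorSpan hg
  have hfdW : FiniteDimensional K W := (Submodule.fg_iff_finiteDimensional _).1 hW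
  have hle : valueSpan K g ≤ W := by
    rw [valueSpan, Submodule.span_le]
    rintro _ ⟨n, rfl⟩
    exact ecoeff_mem_of_coeff_mem hgW n
  have hfd : FiniteDimensional K (valueSpan K g) := Submodule.finiteDimensional_of_le hle
  refine ⟨hfd, fun w hw hli => ?_⟩
  have hliP := linearIndependent_powerSeries_of_taylorSpan
    (fun i => derivSpan_le_taylorSpan hg (hw i)) hli
  obtain ⟨v, l, hvl⟩ := exists_coordinates (valueSpan K g)
  have hgV : ∀ n, coeff n g ∈ valueSpan K g :=
    mem_of_ecoeff_mem fun n => Submodule.subset_span ⟨n, rfl⟩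
  have hmem : ∀ i, w i ∈ satSpan (PowerSeries K) fun j => C (v j) := by
    intro i
    have h1 : w i = ∑ j, coeffMap (l j) (w i) • C (v j) := by
      ext n
      conv_lhs => rw [hvl _ (coeff_mem_of_mem_derivSpan hgV (hw i) n)]
      rw [map_sum]
      refine Finset.sum_congr rfl fun j _ => ?_
      rw [powerSeries_smul_eq, coeff_mul_C, coeff_map, coeff_coeffMap, Algebra.smul_def]
    rw [h1]
    exact sum_mem fun j _ => Submodule.smul_mem _ _ (subset_satSpan (fun j => C (v j)) j)
  have := card_le_of_mem_satSpan hmem hliP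
  omega

end

/-! ### Components of `E`-functions -/

theorem psD_eq_derivative : psD = d⁄dX ℂ := by
  funext f
  ext n
  rw [psD, coeff_mk, coeff_derivative, mul_comm]

theorem ecoeff_ePS (b : ℕ → ℂ) (n : ℕ) : ecoeff n (ePS b) = b n := by
  rw [ecoeff, ePS, coeff_mk]
  exact mul_div_cancel₀ _ (Nat.cast_ne_zero.2 n.factorial_ne_zero)

theorem exists_ringHom_extension {F S M : Type*} [Field F] [CommRing S] [IsDomain S] [Field M]
    [IsAlgClosed M] (i : F →+* S) (hi : i.IsIntegral) (τ : F →+* M) :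
    ∃ σ : S →+* M, ∀ x, σ (i x) = τ x := by
  let _ := i.toAlgebra
  let _ := τ.toAlgebra
  have : Algebra.IsIntegral F S := ⟨hi⟩
  exact ⟨(IsAlgClosed.lift : S →ₐ[F] M).toRingHom, fun x => AlgHom.commutes _ x⟩

section

variable {K : IntermediateField ℚ ℂ} [FiniteDimensional ℚ K]

theorem mem_integralClosure_of_mem (x : K) : (x : ℂ) ∈ integralClosure ℚ ℂ :=
  (Algebra.IsIntegral.isIntegral (R := ℚ) x).map K.val

theorem exists_embedding_extension (τ : K →+* ℂ) :
    ∃ σ : integralClosure ℚ ℂ →+* ℂ, ∀ x : K, σ ⟨x, mem_integralClosure_of_mem x⟩ = τ x := by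
  let i : K →+* integralClosure ℚ ℂ :=
    (algebraMap K ℂ).codRestrict (integralClosure ℚ ℂ) fun x => mem_integralClosure_of_mem x
  refine exists_ringHom_extension i (fun x => ?_) τ
  have h1 : IsIntegral ℚ x := Algebra.IsIntegral.isIntegral x
  obtain ⟨p, hp, hpx⟩ := h1
  refine ⟨p.map (algebraMap ℚ K), hp.map _, ?_⟩
  rw [Polynomial.eval₂_map, ← hpx]
  congr 1

theorem exists_eq_trace (l : K →ₗ[ℚ] ℚ) : ∃ c : K, ∀ x, l x = Algebra.trace ℚ K (c * x) := by
  refine ⟨((Algebra.traceForm ℚ K).toDual (traceForm_nondegenerate ℚ K)).symm l, fun x => ?_⟩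
  rw [← LinearMap.BilinForm.apply_toDual_symm_apply (B := Algebra.traceForm ℚ K)
    (hB := traceForm_nondegenerate ℚ K) l x]
  rfl

theorem exists_abs_le_embeddings (l : K →ₗ[ℚ] ℚ) :
    ∃ M : ℝ, 0 ≤ M ∧ ∀ (x : K) (B : ℝ), (∀ τ : K →+* ℂ, ‖τ x‖ ≤ B) → |(l x : ℝ)| ≤ M * B := by
  obtain ⟨c, hc⟩ := exists_eq_trace l
  refine ⟨∑ τ : K →ₐ[ℚ] ℂ, ‖τ c‖, Finset.sum_nonneg fun _ _ => norm_nonneg _, fun x B hB => ?_⟩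
  have h1 : ((l x : ℚ) : ℂ) = ∑ τ : K →ₐ[ℚ] ℂ, τ c * τ x := by
    rw [hc x]
    have := trace_eq_sum_embeddings (K := ℚ) (L := K) ℂ (x := c * x)
    simp only [map_mul] at this
    exact this
  have h2 : |(l x : ℝ)| = ‖((l x : ℚ) : ℂ)‖ := by
    rw [← Real.norm_eq_abs, ← Complex.norm_real, Complex.ofReal_ratCast]
  rw [h2, h1, Finset.sum_mul]
  refine (norm_sum_le _ _).trans (Finset.sum_le_sum fun τ _ => ?_)
  rw [norm_mul]
  exact mul_le_mul_of_nonneg_left (hB τ.toRingHom) (norm_nonneg _)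

theorem exists_denominator_linearMap (l : K →ₗ[ℚ] ℚ) :
    ∃ D : ℕ, 0 < D ∧ ∀ x : K, IsIntegral ℤ (x : ℂ) → ∃ z : ℤ, (D : ℚ) * l x = z := by
  obtain ⟨c, hc⟩ := exists_eq_trace l
  have hcalg : IsAlgebraic ℤ c :=
    (IsFractionRing.isAlgebraic_iff ℤ ℚ K).2 (Algebra.IsAlgebraic.isAlgebraic (R := ℚ) c)
  obtain ⟨y, hy0, hy⟩ := hcalg.exists_integral_multiple
  refine ⟨y.natAbs, Int.natAbs_pos.2 hy0, fun x hx => ?_⟩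
  have hx' : IsIntegral ℤ x := (isIntegral_algebraMap_iff (algebraMap K ℂ).injective).1 hx
  have h1 : IsIntegral ℤ (Algebra.trace ℚ K ((y • c) * x)) :=
    Algebra.isIntegral_trace (hy.mul hx')
  obtain ⟨z, hz⟩ := IsIntegrallyClosed.isIntegral_iff.1 h1
  have h2 : (y : ℚ) * l x = z := by
    rw [hc, ← smul_eq_mul, ← map_smul, Int.cast_smul_eq_zsmul, ← smul_mul_assoc, ← hz]
    rfl
  rw [Nat.cast_natAbs, Int.cast_abs]
  rcases abs_choice (y : ℚ) with h | h
  · exact ⟨z, by rw [h, h2]⟩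
  · exact ⟨-z, by rw [h, neg_mul, h2, Int.cast_neg]⟩

end

/-- The growth conditions on the coefficients of an `E`-function. -/
def HasSize (b : ℕ → ℂ) : Prop :=
  ∃ C : ℝ, 0 < C ∧ ∃ d : ℕ → ℕ, ∀ n : ℕ, 1 ≤ n →
      1 ≤ d n ∧ (d n : ℝ) ≤ C ^ n ∧
      (∀ σ : (integralClosure ℚ ℂ) →+* ℂ, ∀ h : b n ∈ integralClosure ℚ ℂ,
        ‖σ ⟨b n, h⟩‖ ≤ C ^ n) ∧
      (∀ i, 1 ≤ i → i ≤ n → IsIntegral ℤ ((d n : ℂ) * b i))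

theorem exists_sizeBound_coeffMap {K : IntermediateField ℚ ℂ} [FiniteDimensional ℚ K]
    {b : ℕ → ℂ} (hb : HasSize b) (hbK : ∀ n, b n ∈ K) (l : ℂ →ₗ[ℚ] ℚ) :
    ∃ C, SizeBound C (coeffMap l (ePS b)) := by
  obtain ⟨C, hC, d, h⟩ := hb
  let lK : K →ₗ[ℚ] ℚ := l ∘ₗ K.val.toLinearMap
  obtain ⟨M, hM, hMl⟩ := exists_abs_le_embeddings lK
  obtain ⟨D, hD, hDl⟩ := exists_denominator_linearMap lK
  have hec : ∀ n, ecoeff n (coeffMap l (ePS b)) = l (b n) := by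
    intro n
    rw [ecoeff_coeffMap, ecoeff_ePS]
  set e : ℕ := (l (b 0)).den with he
  have he0 : 0 < e := (l (b 0)).den_pos
  obtain ⟨B, hB⟩ := exists_nat_ge (max (max M C) (max |(l (b 0) : ℝ)| ((D * e : ℕ) : ℝ)))
  have hBM : M ≤ B := (le_max_left _ _).trans ((le_max_left _ _).trans hB)
  have hBC : C ≤ B := (le_max_right _ _).trans ((le_max_left _ _).trans hB)
  have hB0 : |(l (b 0) : ℝ)| ≤ B := (le_max_left _ _).trans ((le_max_right _ _).trans hB)
  have hBD : ((D * e : ℕ) : ℝ) ≤ B := (le_max_right _ _).trans ((le_max_right _ _).trans hB)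
  have hB1 : (0 : ℝ) ≤ B := Nat.cast_nonneg _
  refine ⟨B, fun n => ?_, fun n => ?_⟩
  · rw [hec]
    have : |(l (b n) : ℝ)| ≤ (B : ℝ) ^ (n + 1) := by
      rcases Nat.eq_zero_or_pos n with rfl | hn
      · simpa using hB0
      · have h1 := hMl ⟨b n, hbK n⟩ (C ^ n) (fun τ => by
          obtain ⟨σ, hσ⟩ := exists_embedding_extension τ
          rw [← hσ]
          exact (h n hn).2.2.1 σ _)
        refine h1.trans ?_
        rw [pow_succ']
        gcongr
    exact_mod_cast this
  · rcases Nat.eq_zero_or_pos n with rfl | hn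
    · refine ⟨e, he0, ?_, fun i hi => ?_⟩
      · rw [zero_add, pow_one]
        have : D * e ≤ B := by exact_mod_cast hBD
        nlinarith
      · obtain rfl : i = 0 := by omega
        refine ⟨(l (b 0)).num, ?_⟩
        rw [hec, he, mul_comm]
        exact Rat.mul_den_eq_num _
    · obtain ⟨hd1, hdC, -, hInt⟩ := h n hn
      refine ⟨D * e * d n, by positivity, ?_, fun i hi => ?_⟩
      · have : ((D * e : ℕ) : ℝ) * d n ≤ (B : ℝ) ^ (n + 1) := by
          rw [pow_succ']
          gcongr
          exact hdC.trans (by gcongr)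
        exact_mod_cast this
      · rw [hec]
        rcases Nat.eq_zero_or_pos i with rfl | hi0
        · refine ⟨D * d n * (l (b 0)).num, ?_⟩
          have := Rat.mul_den_eq_num (l (b 0))
          push_cast
          rw [← this, ← he]
          ring
        · obtain ⟨z, hz⟩ := hDl ((d n : K) * ⟨b i, hbK i⟩) (by
            have := hInt i hi0 hi
            simpa using this)
          refine ⟨e * z, ?_⟩
          have h3 : lK ((d n : K) * ⟨b i, hbK i⟩) = (d n : ℚ) * l (b i) := by
            rw [← nsmul_eq_mul, map_nsmul, nsmul_eq_mul]
            rfl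
          rw [h3] at hz
          push_cast
          rw [← hz]
          ring

/-! ### Holonomy and fields of definition -/

section

attribute [local instance] Polynomial.algebra

theorem finite_polynomial_extension (K : IntermediateField ℚ ℂ) [FiniteDimensional ℚ K] :
    Module.Finite (Polynomial ℚ) (Polynomial K) :=
  Module.Finite.equiv
    (Algebra.IsPushout.equiv ℚ (Polynomial ℚ) K (Polynomial K)).toLinearEquiv

theorem isScalarTower_polynomial_powerSeries (K : IntermediateField ℚ ℂ) :
    IsScalarTower (Polynomial ℚ) (Polynomial K) (PowerSeries ℂ) := by
  refine IsScalarTower.of_algebraMap_eq fun p => ?_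
  rw [PowerSeries.algebraMap_apply', PowerSeries.algebraMap_apply', Polynomial.algebraMap_def,
    Polynomial.coe_mapRingHom, ← Polynomial.polynomial_map_coe, ← Polynomial.polynomial_map_coe,
    Polynomial.map_map, ← IsScalarTower.algebraMap_eq]

theorem exists_rat_multiple {K : IntermediateField ℚ ℂ} [FiniteDimensional ℚ K]
    {p : Polynomial K} (hp : p ≠ 0) :
    ∃ q : Polynomial ℚ, q ≠ 0 ∧ p ∣ algebraMap (Polynomial ℚ) (Polynomial K) q :=
  (Algebra.IsIntegral.isIntegral (R := Polynomial ℚ) p).isAlgebraic.exists_nonzero_dvd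
    (mem_nonZeroDivisors_of_ne_zero hp)

theorem isHolonomic_of_differentialEquation {K : IntermediateField ℚ ℂ} [FiniteDimensional ℚ K]
    {f : PowerSeries ℂ} {m : ℕ} {p : ℕ → Polynomial K} (hp : p m ≠ 0)
    (h : ∑ i ∈ Finset.range (m + 1), p i • (d⁄dX ℂ)^[i] f = 0) : IsHolonomic f := by
  have := finite_polynomial_extension K
  have := isScalarTower_polynomial_powerSeries K
  have htf := isTorsionFree_polynomial_powerSeries (K := K)
  rw [Finset.sum_range_succ] at h
  let N : Submodule (Polynomial K) (PowerSeries ℂ) :=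
    Submodule.span (Polynomial K) ((fun i => (d⁄dX ℂ)^[i] f) '' Set.Iio m)
  have hN : ∀ i < m, (d⁄dX ℂ)^[i] f ∈ N := fun i hi => Submodule.subset_span ⟨i, hi, rfl⟩
  have hpm : p m • (d⁄dX ℂ)^[m] f ∈ N := by
    rw [← neg_eq_of_add_eq_zero_right h]
    exact neg_mem (sum_mem fun i hi => N.smul_mem _ (hN i (Finset.mem_range.1 hi)))
  obtain ⟨q, hq0, s, hqs⟩ := exists_rat_multiple hp
  have hqm : q • (d⁄dX ℂ)^[m] f ∈ N := by
    rw [← algebraMap_smul (Polynomial K) q, hqs, mul_comm, mul_smul]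
    exact N.smul_mem _ hpm
  have hfN : f ∈ N := by
    rcases Nat.eq_zero_or_pos m with rfl | hm
    · rw [Finset.range_zero, Finset.sum_empty, zero_add] at h
      have : f = 0 := (smul_eq_zero.1 h).resolve_left hp
      rw [this]
      exact zero_mem _
    · exact hN 0 hm
  refine ⟨N.restrictScalars (Polynomial ℚ), ?_, hfN, q, hq0, fun x hx => ?_⟩
  · refine Submodule.FG.restrictScalars (Submodule.fg_span ?_)
    exact (Set.finite_Iio m).image _
  · change x ∈ N at hx
    change q • d⁄dX ℂ x ∈ N
    rw [← algebraMap_smul (Polynomial K) q] at hqm ⊢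
    induction hx using Submodule.span_induction with
    | mem y hy =>
      obtain ⟨i, hi, rfl⟩ := hy
      beta_reduce
      rw [← Function.iterate_succ_apply' (d⁄dX ℂ) i f]
      rcases lt_or_eq_of_le (Nat.succ_le_of_lt hi) with h1 | h1
      · exact N.smul_mem _ (hN _ h1)
      · rw [h1]
        exact hqm
    | zero => rw [map_zero, smul_zero]; exact zero_mem _
    | add y z _ _ hy hz => rw [map_add, smul_add]; exact add_mem hy hz
    | smul r y hyN hy =>
      rw [derivative_polynomial_smul, smul_add, smul_comm _ r]
      exact add_mem (N.smul_mem _ (N.smul_mem _ hyN)) (N.smul_mem _ hy)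

end

/-- A number field contains the coefficients of an `E`-function and of a differential equation
satisfied by it. -/
def DefinedOver (K : IntermediateField ℚ ℂ) (b : ℕ → ℂ) : Prop :=
  (∀ n, b n ∈ K) ∧ ∃ (m : ℕ) (p : ℕ → Polynomial K), p m ≠ 0 ∧
    ∑ i ∈ Finset.range (m + 1), p i • (d⁄dX ℂ)^[i] (ePS b) = 0

theorem DefinedOver.coeffMap_mem_ratE {K : IntermediateField ℚ ℂ} [FiniteDimensional ℚ K]
    {b : ℕ → ℂ} (hK : DefinedOver K b) (hb : HasSize b) (l : ℂ →ₗ[ℚ] ℚ) :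
    coeffMap l (ePS b) ∈ ratE := by
  obtain ⟨hbK, m, p, hp, h⟩ := hK
  exact mem_ratE.2 ⟨exists_sizeBound_coeffMap hb hbK l,
    (isHolonomic_of_differentialEquation hp h).coeffMap l⟩

theorem exists_lift_polynomial {K : IntermediateField ℚ ℂ} {p : Polynomial ℂ}
    (hp : ∀ k, p.coeff k ∈ K) : ∃ q : Polynomial K, q.map (algebraMap K ℂ) = p := by
  have : p ∈ Polynomial.lifts (algebraMap K ℂ) :=
    (Polynomial.lifts_iff_coeff_lifts p).2 fun n => ⟨⟨_, hp n⟩, rfl⟩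
  exact (Polynomial.mem_lifts p).1 this

theorem exists_finset_adjoin {b : ℕ → ℂ} (hb : ∀ n, IsAlgebraic ℚ (b n)) {m : ℕ}
    {p : ℕ → Polynomial ℂ} (halg : ∀ i k, IsAlgebraic ℚ ((p i).coeff k)) (hm : p m ≠ 0)
    (h : ∑ i ∈ Finset.range (m + 1), (p i : PowerSeries ℂ) * (d⁄dX ℂ)^[i] (ePS b) = 0) :
    ∃ s : Finset ℂ, (∀ x ∈ s, IsAlgebraic ℚ x) ∧
      ∀ K : IntermediateField ℚ ℂ, (s : Set ℂ) ⊆ K → DefinedOver K b := by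
  classical
  let s₁ : Finset ℂ := (Finset.range (m + 1)).biUnion fun i => (p i).coeffs
  have hs₁ : ∀ x ∈ s₁, IsAlgebraic ℚ x := by
    intro x hx
    obtain ⟨i, -, hi⟩ := Finset.mem_biUnion.1 hx
    obtain ⟨k, -, rfl⟩ := Polynomial.mem_coeffs_iff.1 hi
    exact halg i k
  have hlift : ∀ K : IntermediateField ℚ ℂ, (s₁ : Set ℂ) ⊆ K → ∃ q : ℕ → Polynomial K,
      ∀ i ≤ m, (q i).map (algebraMap K ℂ) = p i := by
    intro K hK
    have h1 : ∀ i, ∃ q : Polynomial K, i ≤ m → q.map (algebraMap K ℂ) = p i := by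
      intro i
      by_cases hi : i ≤ m
      · obtain ⟨q, hq⟩ := exists_lift_polynomial (K := K) (p := p i) fun k => by
          by_cases hk : (p i).coeff k = 0
          · rw [hk]; exact zero_mem _
          · exact hK (Finset.mem_biUnion.2 ⟨i, Finset.mem_range.2 (Nat.lt_succ_of_le hi),
              Polynomial.coeff_mem_coeffs hk⟩)
        exact ⟨q, fun _ => hq⟩
      · exact ⟨0, fun h => absurd h hi⟩
    choose q hq using h1
    exact ⟨q, hq⟩
  let K₁ := IntermediateField.adjoin ℚ (s₁ : Set ℂ)
  obtain ⟨q₁, hq₁⟩ := hlift K₁ (IntermediateField.subset_adjoin _ _)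
  have hq₁m : q₁ m ≠ 0 := by
    intro h0
    apply hm
    rw [← hq₁ m le_rfl, h0, Polynomial.map_zero]
  obtain ⟨E, P, hPE, hrec⟩ := exists_recurrence m q₁ ⟨m, le_rfl, hq₁m⟩ (ePS b) (by
    rw [← h]
    refine Finset.sum_congr rfl fun i hi => ?_
    rw [hq₁ i (Nat.lt_succ_iff.1 (Finset.mem_range.1 hi))])
  simp only [ecoeff_ePS] at hrec
  obtain ⟨n₀, hn₀⟩ : ∃ n₀ : ℕ, ∀ n ≥ n₀, (P E).eval (n : K₁) ≠ 0 := by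
    have hfin : {n : ℕ | (P E).eval (n : K₁) = 0}.Finite := by
      refine Set.Finite.of_finite_image (f := fun n : ℕ => (n : K₁)) ?_ Nat.cast_injective.injOn
      refine ((P E).roots.toFinset.finite_toSet).subset ?_
      rintro _ ⟨n, hn, rfl⟩
      exact Multiset.mem_toFinset.2 ((Polynomial.mem_roots hPE).2 hn)
    obtain ⟨B, hB⟩ := hfin.bddAbove
    exact ⟨B + 1, fun n hn h0 => absurd (hB h0) (by omega)⟩
  let s := s₁ ∪ (Finset.range (n₀ + E)).image b
  refine ⟨s, fun x hx => ?_, fun K hK => ⟨fun n => ?_, ?_⟩⟩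
  · rcases Finset.mem_union.1 hx with hx | hx
    · exact hs₁ x hx
    · obtain ⟨n, -, rfl⟩ := Finset.mem_image.1 hx
      exact hb n
  · have hKK : K₁ ≤ K := IntermediateField.adjoin_le_iff.2 fun x hx =>
      hK (Finset.mem_union_left _ hx)
    induction n using Nat.strong_induction_on with
    | _ n ih =>
      by_cases hn : n < n₀ + E
      · exact hK (Finset.mem_union_right _ (Finset.mem_image.2 ⟨n, Finset.mem_range.2 hn, rfl⟩))
      · obtain ⟨k, rfl⟩ : ∃ k, n = k + E := ⟨n - E, by omega⟩
        have h1 := hrec k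
        rw [Finset.sum_range_succ] at h1
        have h2 := hn₀ k (by omega)
        have h3 : b (k + E) = -(((P E).eval (k : K₁) : K₁) : ℂ)⁻¹ *
            ∑ e ∈ Finset.range E, (P e).eval (k : K₁) • b (k + e) := by
          have h4 : (((P E).eval (k : K₁) : K₁) : ℂ) ≠ 0 := fun h => h2 (Subtype.ext h)
          have h5 : (P E).eval (k : K₁) • b (k + E)
            = (((P E).eval (k : K₁) : K₁) : ℂ) * b (k + E) := rfl
          rw [h5] at h1
          field_simp
          linear_combination h1
        rw [h3]
        refine mul_mem (neg_mem (inv_mem (hKK (Subtype.property _)))) (sum_mem fun e he => ?_)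
        exact mul_mem (hKK (Subtype.property _)) (ih _ (by
          have := Finset.mem_range.1 he
          omega))
  · obtain ⟨q, hq⟩ := hlift K fun x hx => hK (Finset.mem_union_left _ hx)
    refine ⟨m, q, fun h0 => hm ?_, ?_⟩
    · rw [← hq m le_rfl, h0, Polynomial.map_zero]
    · rw [← h]
      refine Finset.sum_congr rfl fun i hi => ?_
      rw [polynomial_smul_eq, ← Polynomial.polynomial_map_coe,
        hq i (Nat.lt_succ_iff.1 (Finset.mem_range.1 hi))]

/-! ### Rescaling `E`-functions -/

theorem ePS_mul_pow (a : ℕ → ℂ) (α : ℂ) :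
    ePS (fun n => a n * α ^ n) = rescale α (ePS a) := by
  ext n
  rw [coeff_rescale, ePS, ePS, coeff_mk, coeff_mk]
  ring

theorem derivative_rescale (α : ℂ) (f : PowerSeries ℂ) :
    d⁄dX ℂ (rescale α f) = C α * rescale α (d⁄dX ℂ f) := by
  ext n
  rw [coeff_derivative, coeff_rescale, coeff_C_mul, coeff_rescale, coeff_derivative]
  ring

theorem iterate_derivative_rescale (α : ℂ) (f : PowerSeries ℂ) (k : ℕ) :
    (d⁄dX ℂ)^[k] (rescale α f) = C (α ^ k) * rescale α ((d⁄dX ℂ)^[k] f) := by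
  induction k with
  | zero => rw [pow_zero, map_one, one_mul]; rfl
  | succ k ih =>
    rw [Function.iterate_succ_apply', ih, Function.iterate_succ_apply', ← smul_eq_C_mul,
      Derivation.map_smul, derivative_rescale, smul_eq_C_mul, ← mul_assoc, ← map_mul, pow_succ]

theorem rescale_polynomial (α : ℂ) (p : Polynomial ℂ) :
    rescale α (p : PowerSeries ℂ) = (p.comp (Polynomial.C α * Polynomial.X) : Polynomial ℂ) := by
  ext n
  rw [coeff_rescale, Polynomial.coeff_coe, Polynomial.coeff_coe, Polynomial.comp_C_mul_X_coeff,
    mul_comm]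

theorem exists_norm_ringHom_le {α : ℂ} (hα : α ∈ integralClosure ℚ ℂ) :
    ∃ A : ℝ, 1 ≤ A ∧ ∀ σ : (integralClosure ℚ ℂ) →+* ℂ, ‖σ ⟨α, hα⟩‖ ≤ A := by
  have hInt : IsIntegral ℚ α := hα
  let R : Multiset ℂ := ((minpoly ℚ α).map (algebraMap ℚ ℂ)).roots
  refine ⟨1 + (R.map fun x => ‖x‖).sum, ?_, fun σ => ?_⟩
  · have : 0 ≤ (R.map fun x => ‖x‖).sum := Multiset.sum_nonneg (by
      intro x hx
      obtain ⟨y, -, rfl⟩ := Multiset.mem_map.1 hx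
      exact norm_nonneg y)
    linarith
  · have hroot : σ ⟨α, hα⟩ ∈ R := by
      refine (Polynomial.mem_roots
        (Polynomial.map_ne_zero (minpoly.ne_zero hInt))).2 ?_
      rw [Polynomial.IsRoot.def, Polynomial.eval_map]
      have h1 : Polynomial.eval₂ (algebraMap ℚ (integralClosure ℚ ℂ)) ⟨α, hα⟩ (minpoly ℚ α)
          = 0 := by
        apply Subtype.ext
        have := Polynomial.hom_eval₂ (minpoly ℚ α) (algebraMap ℚ (integralClosure ℚ ℂ))
          (integralClosure ℚ ℂ).val.toRingHom ⟨α, hα⟩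
        exact this.trans (minpoly.aeval ℚ α)
      have h2 := congrArg σ h1
      rw [map_zero, Polynomial.hom_eval₂] at h2
      rwa [Subsingleton.elim (algebraMap ℚ ℂ) (σ.comp (algebraMap ℚ (integralClosure ℚ ℂ)))]
    have := Multiset.single_le_sum (s := R.map fun x => ‖x‖) (by
      intro x hx
      obtain ⟨y, -, rfl⟩ := Multiset.mem_map.1 hx
      exact norm_nonneg y) _ (Multiset.mem_map_of_mem _ hroot)
    linarith

theorem exists_nat_mul_isIntegral {α : ℂ} (hα : IsAlgebraic ℚ α) :
    ∃ D : ℕ, 1 ≤ D ∧ IsIntegral ℤ ((D : ℂ) * α) := by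
  have hα' : IsAlgebraic ℤ α := (IsFractionRing.isAlgebraic_iff ℤ ℚ ℂ).2 hα
  obtain ⟨y, hy, hInt⟩ := hα'.exists_integral_multiple
  refine ⟨y.natAbs, Int.natAbs_pos.2 hy, ?_⟩
  rw [zsmul_eq_mul] at hInt
  rcases Int.natAbs_eq y with h | h
  · rw [h, Int.cast_natCast] at hInt
    exact hInt
  · rw [h] at hInt
    rw [Int.cast_neg, Int.cast_natCast, neg_mul] at hInt
    exact neg_neg ((y.natAbs : ℂ) * α) ▸ hInt.neg

theorem HasSize.mul_pow {a : ℕ → ℂ} (ha : HasSize a) (halg : ∀ n, IsAlgebraic ℚ (a n)) {α : ℂ}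
    (hα : IsAlgebraic ℚ α) : HasSize fun n => a n * α ^ n := by
  obtain ⟨C, hC, d, h⟩ := ha
  have hα' : α ∈ integralClosure ℚ ℂ := hα.isIntegral
  obtain ⟨A, hA, hσ⟩ := exists_norm_ringHom_le hα'
  obtain ⟨D, hD, hInt⟩ := exists_nat_mul_isIntegral hα
  have hDr : (1 : ℝ) ≤ D := by exact_mod_cast hD
  refine ⟨C * (A * D), by positivity, fun n => d n * D ^ n, fun n hn => ?_⟩
  obtain ⟨h1, h2, h3, h4⟩ := h n hn
  refine ⟨Nat.mul_pos h1 (pow_pos hD n), ?_, fun σ hb => ?_, fun i hi hin => ?_⟩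
  · push_cast
    rw [_root_.mul_pow C]
    have : (D : ℝ) ≤ A * D := by nlinarith
    gcongr
  · have haC : a n ∈ integralClosure ℚ ℂ := (halg n).isIntegral
    have heq : (⟨a n * α ^ n, hb⟩ : integralClosure ℚ ℂ) = ⟨a n, haC⟩ * ⟨α, hα'⟩ ^ n :=
      Subtype.ext rfl
    rw [heq, map_mul, map_pow, norm_mul, norm_pow, _root_.mul_pow C]
    have : A ≤ A * D := by nlinarith
    gcongr
    · exact h3 σ haC
    · exact (hσ σ).trans this
  · have heq : ((d n * D ^ n : ℕ) : ℂ) * (a i * α ^ i)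
        = ((d n : ℂ) * a i) * ((D : ℂ) * α) ^ i * ((D ^ (n - i) : ℕ) : ℂ) := by
      have : (D : ℂ) ^ n = (D : ℂ) ^ i * (D : ℂ) ^ (n - i) := by
        rw [← pow_add, Nat.add_sub_cancel' hin]
      push_cast
      rw [this, _root_.mul_pow]
      ring
    rw [heq]
    exact ((h4 i hi hin).mul (hInt.pow i)).mul (isIntegral_natCast _)

theorem IsE.exists_leading {a : ℕ → ℂ} (ha : IsE a) :
    ∃ (m : ℕ) (p : ℕ → Polynomial ℂ), (∀ i k, IsAlgebraic ℚ ((p i).coeff k)) ∧ p m ≠ 0 ∧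
      ∑ i ∈ Finset.range (m + 1), (p i : PowerSeries ℂ) * (d⁄dX ℂ)^[i] (ePS a) = 0 := by
  classical
  obtain ⟨-, ⟨m, p, halg, hex, hsum⟩, -⟩ := ha
  obtain ⟨n, hn⟩ : ∃ n, n = Nat.findGreatest (fun i => p i ≠ 0) m := ⟨_, rfl⟩
  obtain ⟨i₀, hi₀, hpi₀⟩ := hex
  have hpn : p n ≠ 0 := by rw [hn]; exact Nat.findGreatest_spec (P := fun i => p i ≠ 0) hi₀ hpi₀
  have hnm : n ≤ m := by rw [hn]; exact Nat.findGreatest_le m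
  refine ⟨n, p, halg, hpn, ?_⟩
  rw [psD_eq_derivative] at hsum
  rw [← hsum]
  refine Finset.sum_subset (Finset.range_mono (by omega)) fun i hi hi' => ?_
  have hpi : p i = 0 := by
    by_contra h0
    have := Nat.le_findGreatest (P := fun i => p i ≠ 0)
      (Nat.lt_succ_iff.1 (Finset.mem_range.1 hi)) h0
    rw [Finset.mem_range] at hi'
    omega
  rw [hpi, Polynomial.coe_zero, zero_mul]

theorem IsE.exists_finset_definedOver {a : ℕ → ℂ} (ha : IsE a) {α : ℂ} (hα : IsAlgebraic ℚ α)
    (hα0 : α ≠ 0) : ∃ s : Finset ℂ, (∀ x ∈ s, IsAlgebraic ℚ x) ∧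
      ∀ K : IntermediateField ℚ ℂ, (s : Set ℂ) ⊆ K → DefinedOver K fun n => a n * α ^ n := by
  obtain ⟨m, p, halg, hpm, hsum⟩ := ha.exists_leading
  let q : ℕ → Polynomial ℂ := fun i =>
    Polynomial.C ((α ^ i)⁻¹) * (p i).comp (Polynomial.C α * Polynomial.X)
  have hq : ∀ i k, (q i).coeff k = (α ^ i)⁻¹ * ((p i).coeff k * α ^ k) := by
    intro i k
    rw [Polynomial.coeff_C_mul, Polynomial.comp_C_mul_X_coeff]
  refine exists_finset_adjoin (p := q) (m := m) (fun n => (ha.1 n).mul (hα.pow n))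
    (fun i k => ?_) (fun h0 => hpm ?_) ?_
  · rw [hq]
    exact (hα.pow i).inv.mul ((halg i k).mul (hα.pow k))
  · ext k
    have := congrArg (fun r : Polynomial ℂ => r.coeff k) h0
    beta_reduce at this
    rw [hq, Polynomial.coeff_zero] at this
    rw [Polynomial.coeff_zero]
    have h1 : (α ^ m)⁻¹ ≠ 0 := inv_ne_zero (pow_ne_zero _ hα0)
    exact (mul_eq_zero.1 ((mul_eq_zero.1 this).resolve_left h1)).resolve_right
      (pow_ne_zero _ hα0)
  · have := congrArg (rescale α) hsum
    rw [map_zero, map_sum] at this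
    rw [← this]
    refine Finset.sum_congr rfl fun i _ => ?_
    rw [ePS_mul_pow, iterate_derivative_rescale, map_mul, rescale_polynomial,
      Polynomial.coe_mul, Polynomial.coe_C]
    have h1 : (C ((α ^ i)⁻¹) : PowerSeries ℂ) * C (α ^ i) = 1 := by
      rw [← map_mul, inv_mul_cancel₀ (pow_ne_zero _ hα0), map_one]
    linear_combination
      (((p i).comp (Polynomial.C α * Polynomial.X) : Polynomial ℂ) : PowerSeries ℂ) *
        rescale α ((d⁄dX ℂ)^[i] (ePS a)) * h1

/-! ### Entire functions with expansion in `taylorSpan` -/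

section

variable {K : IntermediateField ℚ ℂ}

theorem mul_mem_taylorSpan {x y : PowerSeries ℂ} (hx : x ∈ taylorSpan K)
    (hy : y ∈ taylorSpan K) : x * y ∈ taylorSpan K := by
  have h := Submodule.mul_mem_mul hx hy
  rw [taylorSpan, Submodule.span_mul_span] at h
  refine Submodule.span_mono ?_ h
  rintro _ ⟨u, hu, v, hv, rfl⟩
  exact mul_mem (S := Subring (PowerSeries ℂ)) hu hv

variable (K) in
/-- The entire power series with Taylor expansion at `1` in `taylorSpan K`. -/
def entireSpan : Set (PowerSeries ℂ) := {f | f ∈ entirePS ∧ taylorFun f ∈ taylorSpan K}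

theorem add_mem_entireSpan {f g : PowerSeries ℂ} (hf : f ∈ entireSpan K)
    (hg : g ∈ entireSpan K) : f + g ∈ entireSpan K :=
  ⟨add_mem hf.1 hg.1, by rw [taylorFun_add hf.1 hg.1]; exact add_mem hf.2 hg.2⟩

theorem mul_mem_entireSpan {f g : PowerSeries ℂ} (hf : f ∈ entireSpan K)
    (hg : g ∈ entireSpan K) : f * g ∈ entireSpan K :=
  ⟨mul_mem hf.1 hg.1, by rw [taylorFun_mul hf.1 hg.1]; exact mul_mem_taylorSpan hf.2 hg.2⟩

theorem C_mem_entirePS (c : ℂ) : (C c : PowerSeries ℂ) ∈ entirePS :=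
  Polynomial.coe_C c ▸ polynomial_mem_entirePS (Polynomial.C c)

theorem C_mem_entireSpan (c : K) : C (c : ℂ) ∈ entireSpan K := by
  refine ⟨C_mem_entirePS _, ?_⟩
  have h : (C (c : ℂ) : PowerSeries ℂ) = (Polynomial.C c : Polynomial K) • 1 := by
    rw [polynomial_smul_eq, Polynomial.coe_C, map_C, mul_one]
    rfl
  rw [taylorFun_C, h]
  exact Submodule.smul_mem _ _ (Submodule.subset_span (one_mem (S := Subring (PowerSeries ℂ)) _))

theorem map_mem_entireSpan {g : PowerSeries ℚ} (hg : g ∈ ratE) :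
    PowerSeries.map (algebraMap ℚ ℂ) g ∈ entireSpan K :=
  ⟨mem_entireRat.1 (ratE_le_entireRat hg),
    Submodule.subset_span (mem_taylorE.2 ⟨g, hg, rfl⟩)⟩

theorem DefinedOver.mem_entireSpan [FiniteDimensional ℚ K] {b : ℕ → ℂ} (hK : DefinedOver K b)
    (hb : HasSize b) : ePS b ∈ entireSpan K := by
  let ω := Module.finBasis ℚ K
  have hex := fun j => LinearMap.exists_extend
    (p := Subalgebra.toSubmodule K.toSubalgebra) (ω.coord j)
  choose l hl using hex
  have h : ePS b = ∑ j, C ((ω j : K) : ℂ) *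
      PowerSeries.map (algebraMap ℚ ℂ) (coeffMap (l j) (ePS b)) := by
    ext n
    have hn : coeff n (ePS b) ∈ K := by
      rw [ePS, coeff_mk]
      exact div_mem (hK.1 n) (natCast_mem K _)
    rw [map_sum]
    have h1 := congrArg (algebraMap K ℂ) (ω.sum_repr ⟨_, hn⟩)
    rw [map_sum] at h1
    refine Eq.trans h1.symm (Finset.sum_congr rfl fun j _ => ?_)
    have h2 : l j (coeff n (ePS b)) = ω.repr ⟨_, hn⟩ j :=
      LinearMap.congr_fun (hl j) ⟨_, hn⟩
    rw [coeff_C_mul, coeff_map, coeff_coeffMap, h2, Algebra.smul_def, map_mul, mul_comm]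
    rfl
  rw [h]
  refine Finset.sum_induction _ (· ∈ entireSpan K) (fun _ _ => add_mem_entireSpan) ?_
    fun j _ => mul_mem_entireSpan (C_mem_entireSpan _)
      (map_mem_entireSpan (hK.coeffMap_mem_ratE hb (l j)))
  simpa using C_mem_entireSpan (0 : K)

theorem taylorFun_polynomial_comp (p : Polynomial ℂ) :
    taylorFun (p.comp (Polynomial.X - 1) : Polynomial ℂ) = p := by
  induction p using Polynomial.induction_on with
  | C a => rw [Polynomial.C_comp, Polynomial.coe_C, taylorFun_C]
  | add p q hp hq =>
    rw [Polynomial.add_comp, Polynomial.coe_add, taylorFun_add (polynomial_mem_entirePS _)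
      (polynomial_mem_entirePS _), hp, hq, Polynomial.coe_add]
  | monomial n a h =>
    have h1 : taylorFun ((Polynomial.X - 1 : Polynomial ℂ) : PowerSeries ℂ) = X := by
      have h2 : ((Polynomial.X - 1 : Polynomial ℂ) : PowerSeries ℂ) = X + C (-1) := by
        simp [sub_eq_add_neg]
      rw [h2, taylorFun_add (Polynomial.coe_X (R := ℂ) ▸ polynomial_mem_entirePS _)
        (C_mem_entirePS _), taylorFun_X, taylorFun_C]
      simp
    rw [pow_succ, ← mul_assoc, Polynomial.mul_comp, Polynomial.coe_mul,
      taylorFun_mul (polynomial_mem_entirePS _) (polynomial_mem_entirePS _), h,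
      Polynomial.X_comp, h1, Polynomial.coe_mul _ Polynomial.X, Polynomial.coe_X]

theorem iterate_derivative_taylorFun (g : PowerSeries ℂ) (k : ℕ) :
    (d⁄dX ℂ)^[k] (taylorFun g) = taylorFun ((d⁄dX ℂ)^[k] g) := by
  induction k with
  | zero => rfl
  | succ k ih =>
    rw [Function.iterate_succ_apply', ih, derivative_taylorFun,
      ← Function.iterate_succ_apply' (d⁄dX ℂ) k g]

theorem taylorFun_injOn {f g : PowerSeries ℂ} (hf : f ∈ entirePS) (hg : g ∈ entirePS)
    (h : taylorFun f = taylorFun g) : f = g :=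
  congrArg Subtype.val (@taylorHom_injective ⟨f, hf⟩ ⟨g, hg⟩ h)

/-- An entire function in `entireSpan K` vanishing at `1` is the product of `z - 1` and a
combination of its derivatives. -/
theorem exists_sum_derivative_of_psEval_eq_zero [FiniteDimensional ℚ K] {F : PowerSeries ℂ}
    (hF : F ∈ entireSpan K) (h0 : psEval F 1 = 0) :
    ∃ (n : ℕ) (c : ℕ → Polynomial K),
      F = ((Polynomial.X - 1 : Polynomial ℂ) : PowerSeries ℂ) *
        ∑ k ∈ Finset.range n, ((c k).map (algebraMap K ℂ) : PowerSeries ℂ) *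
          (d⁄dX ℂ)^[k] F := by
  obtain ⟨m, hm, hFm⟩ := (hasValueRank_of_mem_taylorSpan hF.2).exists_eq_X_smul
    ((constantCoeff_taylorFun F).trans h0)
  obtain ⟨c, hc⟩ := (Finsupp.mem_span_range_iff_exists_finsupp).1 hm
  obtain ⟨n, hn⟩ := c.support.exists_nat_subset_range
  let q : ℕ → Polynomial K := fun k => (c k).comp (Polynomial.X - 1)
  let H : PowerSeries ℂ := ∑ k ∈ Finset.range n,
    ((q k).map (algebraMap K ℂ) : PowerSeries ℂ) * (d⁄dX ℂ)^[k] F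
  have hterm : ∀ k, ((q k).map (algebraMap K ℂ) : PowerSeries ℂ) * (d⁄dX ℂ)^[k] F ∈ entirePS :=
    fun k => mul_mem (polynomial_mem_entirePS _) (iterate_derivative_mem_entirePS hF.1 k)
  have hH : H ∈ entirePS := sum_mem fun k _ => hterm k
  have hTH : taylorFun H = m := by
    have h1 := map_sum taylorHom (fun k => ⟨_, hterm k⟩) (Finset.range n)
    have h2 : taylorHom (∑ k ∈ Finset.range n, ⟨_, hterm k⟩) = taylorFun H := by
      change taylorFun _ = _
      rw [AddSubmonoidClass.coe_finsetSum]
    rw [← h2, h1, ← hc, Finsupp.sum_of_support_subset _ hn _ (by intros; exact zero_smul _ _)]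
    refine Finset.sum_congr rfl fun k _ => ?_
    change taylorFun _ = _
    rw [taylorFun_mul (polynomial_mem_entirePS _) (iterate_derivative_mem_entirePS hF.1 k),
      polynomial_smul_eq, iterate_derivative_taylorFun, ← Polynomial.polynomial_map_coe,
      Polynomial.map_comp, Polynomial.map_sub, Polynomial.map_X, Polynomial.map_one,
      taylorFun_polynomial_comp]
  refine ⟨n, q, taylorFun_injOn hF.1 (mul_mem (polynomial_mem_entirePS _) hH) ?_⟩
  have hX := taylorFun_polynomial_comp Polynomial.X
  rw [Polynomial.X_comp, Polynomial.coe_X] at hX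
  rw [taylorFun_mul (polynomial_mem_entirePS _) hH, hTH, hX, hFm, polynomial_X_smul_eq]

end

/-! ### The total derivative of differential polynomials -/

section

variable {ι k : Type*} [Field k]

variable (ι k) in
/-- The derivation of the ring of differential polynomials with constant coefficients that maps
`X_{i,j}` to `X_{i,j+1}`. -/
def totalDerivation :
    Derivation k (MvPolynomial (ι × ℕ) k) (MvPolynomial (ι × ℕ) k) :=
  MvPolynomial.mkDerivation k fun v => MvPolynomial.X (v.1, v.2 + 1)

theorem totalDerivation_isHomogeneous {φ : MvPolynomial (ι × ℕ) k} {n : ℕ}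
    (hφ : φ.IsHomogeneous n) : (totalDerivation ι k φ).IsHomogeneous n := by
  classical
  rw [φ.as_sum, map_sum]
  refine MvPolynomial.IsHomogeneous.sum _ _ _ fun s hs => ?_
  have hdeg : s.degree = n := by
    rw [Finsupp.degree_eq_weight_one]
    exact hφ (MvPolynomial.mem_support_iff.1 hs)
  rw [totalDerivation, MvPolynomial.mkDerivation_monomial, MvPolynomial.smul_eq_C_mul,
    Finsupp.sum, Finset.mul_sum]
  refine MvPolynomial.IsHomogeneous.sum _ _ _ fun i hi => ?_
  have hle : Finsupp.single i 1 ≤ s :=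
    Finsupp.single_le_iff.2 (Nat.one_le_iff_ne_zero.2 (Finsupp.mem_support_iff.1 hi))
  have h1 : (s - Finsupp.single i 1).degree + 1 = n := by
    have h := map_add Finsupp.degree (s - Finsupp.single i 1) (Finsupp.single i 1)
    rw [tsub_add_cancel_of_le hle, Finsupp.degree_single, hdeg] at h
    exact h.symm
  have h2 : (MvPolynomial.X (i.1, i.2 + 1) : MvPolynomial (ι × ℕ) k).IsHomogeneous 1 :=
    MvPolynomial.isHomogeneous_X _ _
  have h3 := (MvPolynomial.isHomogeneous_C (ι × ℕ) (φ.coeff s)).mul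
    ((MvPolynomial.isHomogeneous_monomial (s i : k) (rfl : (s - Finsupp.single i 1).degree = _)).mul
      h2)
  rw [zero_add, h1] at h3
  exact h3

theorem iterate_totalDerivation_isHomogeneous {φ : MvPolynomial (ι × ℕ) k} {n : ℕ}
    (hφ : φ.IsHomogeneous n) (j : ℕ) : ((totalDerivation ι k)^[j] φ).IsHomogeneous n := by
  induction j with
  | zero => exact hφ
  | succ j ih => rw [Function.iterate_succ_apply']; exact totalDerivation_isHomogeneous ih

variable (f : ι → PowerSeries ℂ) (s : k →+* ℂ)

/-- The evaluation of differential polynomials with constant coefficients at a family of power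
series. -/
def diffEval : MvPolynomial (ι × ℕ) k →+* PowerSeries ℂ :=
  MvPolynomial.eval₂Hom ((C (R := ℂ)).comp s) fun v => (d⁄dX ℂ)^[v.2] (f v.1)

theorem diffEval_totalDerivation (φ : MvPolynomial (ι × ℕ) k) :
    diffEval f s (totalDerivation ι k φ) = d⁄dX ℂ (diffEval f s φ) := by
  induction φ using MvPolynomial.induction_on with
  | C a =>
    rw [totalDerivation, MvPolynomial.derivation_C, map_zero, diffEval,
      MvPolynomial.coe_eval₂Hom, MvPolynomial.eval₂_C, RingHom.comp_apply, derivative_C]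
  | add p q hp hq => rw [map_add, map_add, hp, hq, map_add, map_add]
  | mul_X p v hp =>
    have h1 : diffEval f s (MvPolynomial.X v) = (d⁄dX ℂ)^[v.2] (f v.1) :=
      MvPolynomial.eval₂_X _ _ _
    have h2 : diffEval f s (MvPolynomial.X (v.1, v.2 + 1)) = (d⁄dX ℂ)^[v.2 + 1] (f v.1) :=
      MvPolynomial.eval₂_X _ _ _
    have h3 : totalDerivation ι k (MvPolynomial.X v) = MvPolynomial.X (v.1, v.2 + 1) :=
      MvPolynomial.mkDerivation_X _ _ _
    rw [Derivation.leibniz, smul_eq_mul, smul_eq_mul, map_add, map_mul, map_mul, map_mul,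
      Derivation.leibniz, smul_eq_mul, smul_eq_mul, hp, h3, h2, h1,
      Function.iterate_succ_apply']

theorem diffEval_iterate_totalDerivation (φ : MvPolynomial (ι × ℕ) k) (j : ℕ) :
    diffEval f s ((totalDerivation ι k)^[j] φ) = (d⁄dX ℂ)^[j] (diffEval f s φ) := by
  induction j with
  | zero => rfl
  | succ j ih =>
    rw [Function.iterate_succ_apply', diffEval_totalDerivation, ih,
      ← Function.iterate_succ_apply' (d⁄dX ℂ) j (diffEval f s φ)]

theorem diffEval_rename (P : MvPolynomial ι k) :
    diffEval f s (MvPolynomial.rename (fun i => (i, 0)) P)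
      = MvPolynomial.eval₂ ((C (R := ℂ)).comp s) f P := by
  rw [diffEval, MvPolynomial.coe_eval₂Hom, MvPolynomial.eval₂_rename]
  rfl

end

theorem exists_degeneration {r : ℕ} {K : IntermediateField ℚ ℂ} [FiniteDimensional ℚ K]
    (f : Fin r → PowerSeries ℂ) {P : MvPolynomial (Fin r) K} {d : ℕ} (hP : P.IsHomogeneous d)
    {α : ℂ} {l : Polynomial K} (hl : (l.map (algebraMap K ℂ)).eval α = 0)
    {n : ℕ} {c : ℕ → Polynomial K} {G : PowerSeries ℂ}
    (hG : G = MvPolynomial.eval₂ ((C (R := ℂ)).comp (algebraMap K ℂ)) f P)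
    (h : G = (l.map (algebraMap K ℂ) : PowerSeries ℂ) *
        ∑ k ∈ Finset.range n, ((c k).map (algebraMap K ℂ) : PowerSeries ℂ) *
          (d⁄dX ℂ)^[k] G) :
    ∃ Q : MvPolynomial (Fin r × ℕ) (Polynomial ℂ),
      (∀ w k, IsAlgebraic ℚ ((MvPolynomial.coeff w Q).coeff k)) ∧ Q.IsHomogeneous d ∧
      MvPolynomial.eval₂ polyPS (fun v => (d⁄dX ℂ)^[v.2] (f v.1)) Q = 0 ∧
      MvPolynomial.map (Polynomial.evalRingHom α) Q
        = MvPolynomial.rename (fun i => (i, 0)) (MvPolynomial.map (algebraMap K ℂ) P) := by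
  let P' : MvPolynomial (Fin r × ℕ) K := MvPolynomial.rename (fun i => (i, 0)) P
  have hP' : P'.IsHomogeneous d := hP.rename_isHomogeneous
  let D := totalDerivation (Fin r) K
  let Q₀ : MvPolynomial (Fin r × ℕ) (Polynomial K) := MvPolynomial.map Polynomial.C P' -
    MvPolynomial.C l * ∑ k ∈ Finset.range n,
      MvPolynomial.C (c k) * MvPolynomial.map Polynomial.C (D^[k] P')
  let ψ := Polynomial.mapRingHom (algebraMap K ℂ)
  have hQ₀ : Q₀.IsHomogeneous d := by
    refine (hP'.map _).sub ?_
    have h1 : ∀ k, (MvPolynomial.C (c k) *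
        MvPolynomial.map Polynomial.C (D^[k] P')).IsHomogeneous d := by
      intro k
      have := (MvPolynomial.isHomogeneous_C (Fin r × ℕ) (c k)).mul
        ((iterate_totalDerivation_isHomogeneous hP' k).map Polynomial.C)
      rwa [zero_add] at this
    have := (MvPolynomial.isHomogeneous_C (Fin r × ℕ) l).mul
      (MvPolynomial.IsHomogeneous.sum (Finset.range n) _ d fun k _ => h1 k)
    rwa [zero_add] at this
  refine ⟨MvPolynomial.map ψ Q₀, fun w k => ?_, hQ₀.map _, ?_, ?_⟩
  · rw [MvPolynomial.coeff_map, Polynomial.coe_mapRingHom, Polynomial.coeff_map]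
    exact (Algebra.IsAlgebraic.isAlgebraic (R := ℚ) ((MvPolynomial.coeff w Q₀).coeff k)).algebraMap
  · have hcomp : ∀ φ : MvPolynomial (Fin r × ℕ) K,
        MvPolynomial.eval₂ (polyPS.comp ψ) (fun v => (d⁄dX ℂ)^[v.2] (f v.1))
          (MvPolynomial.map Polynomial.C φ) = diffEval f (algebraMap K ℂ) φ := by
      intro φ
      rw [MvPolynomial.eval₂_map, diffEval, MvPolynomial.coe_eval₂Hom]
      congr 1
      ext x
      · change coeff _ ((((Polynomial.C x).map (algebraMap K ℂ) : Polynomial ℂ)) : PowerSeries ℂ) = _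
        rw [Polynomial.map_C, Polynomial.coe_C]
        rfl
    have hcoe : ∀ p : Polynomial K,
        (polyPS.comp ψ) p = ((p.map (algebraMap K ℂ) : Polynomial ℂ) : PowerSeries ℂ) :=
      fun p => rfl
    have hGP : diffEval f (algebraMap K ℂ) P' = G := (diffEval_rename f _ P).trans hG.symm
    rw [MvPolynomial.eval₂_map, MvPolynomial.eval₂_sub, MvPolynomial.eval₂_mul,
      MvPolynomial.eval₂_sum, MvPolynomial.eval₂_C, hcomp, hGP, hcoe]
    refine sub_eq_zero.2 (h.trans ?_)
    congr 1
    refine Finset.sum_congr rfl fun k _ => ?_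
    rw [MvPolynomial.eval₂_mul, MvPolynomial.eval₂_C, hcomp, hcoe,
      diffEval_iterate_totalDerivation, hGP]
  · have hl' : ((Polynomial.evalRingHom α).comp ψ) l = 0 := hl
    have hC : (((Polynomial.evalRingHom α).comp ψ).comp Polynomial.C) = algebraMap K ℂ := by
      ext x
      simp [ψ]
    rw [MvPolynomial.map_map, map_sub, map_mul, MvPolynomial.map_C, hl', map_zero, zero_mul,
      sub_zero, MvPolynomial.map_map, hC, MvPolynomial.map_rename]

/-! ### Relations between values of `E`-functions -/

section

variable {K : IntermediateField ℚ ℂ} {r : ℕ}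

theorem eval₂_mem_entireSpan {F : Fin r → PowerSeries ℂ} (hF : ∀ i, F i ∈ entireSpan K)
    (P : MvPolynomial (Fin r) K) :
    MvPolynomial.eval₂ ((C (R := ℂ)).comp (algebraMap K ℂ)) F P ∈ entireSpan K := by
  induction P using MvPolynomial.induction_on with
  | C a => rw [MvPolynomial.eval₂_C]; exact C_mem_entireSpan a
  | add p q hp hq => rw [MvPolynomial.eval₂_add]; exact add_mem_entireSpan hp hq
  | mul_X p i hp =>
    rw [MvPolynomial.eval₂_mul, MvPolynomial.eval₂_X]
    exact mul_mem_entireSpan hp (hF i)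

theorem psEval_eval₂ {F : Fin r → PowerSeries ℂ} (hF : ∀ i, F i ∈ entireSpan K)
    (P : MvPolynomial (Fin r) K) (z : ℂ) :
    psEval (MvPolynomial.eval₂ ((C (R := ℂ)).comp (algebraMap K ℂ)) F P) z
      = MvPolynomial.eval₂ (algebraMap K ℂ) (fun i => psEval (F i) z) P := by
  induction P using MvPolynomial.induction_on with
  | C a => rw [MvPolynomial.eval₂_C, MvPolynomial.eval₂_C, RingHom.comp_apply, psEval_C]
  | add p q hp hq =>
    rw [MvPolynomial.eval₂_add, MvPolynomial.eval₂_add, psEval_add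
      (eval₂_mem_entireSpan hF p).1 (eval₂_mem_entireSpan hF q).1, hp, hq]
  | mul_X p i hp =>
    rw [MvPolynomial.eval₂_mul, MvPolynomial.eval₂_mul, MvPolynomial.eval₂_X,
      MvPolynomial.eval₂_X, psEval_mul (eval₂_mem_entireSpan hF p).1 (hF i).1, hp]

theorem psEval_ePS_mul_pow (a : ℕ → ℂ) (α : ℂ) :
    psEval (ePS fun n => a n * α ^ n) 1 = evalE a α := by
  refine tsum_congr fun n => ?_
  rw [ePS, coeff_mk, one_pow]
  ring

theorem rescale_constant (α c : ℂ) : rescale α (C c : PowerSeries ℂ) = C c := by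
  rw [← Polynomial.coe_C, rescale_polynomial, Polynomial.C_comp]

theorem rescale_eval₂ (α : ℂ) (f : Fin r → PowerSeries ℂ) (P : MvPolynomial (Fin r) K) :
    rescale α (MvPolynomial.eval₂ ((C (R := ℂ)).comp (algebraMap K ℂ)) f P)
      = MvPolynomial.eval₂ ((C (R := ℂ)).comp (algebraMap K ℂ)) (fun i => rescale α (f i)) P := by
  rw [MvPolynomial.eval₂_comp_left]
  have h : (rescale α).comp ((C (R := ℂ)).comp (algebraMap K ℂ))
      = (C (R := ℂ)).comp (algebraMap K ℂ) :=
    RingHom.ext fun x => rescale_constant α _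
  rw [h]
  rfl

theorem exists_lift_mvPolynomial {d : ℕ} {P : MvPolynomial (Fin r) ℂ} (hP : P.IsHomogeneous d)
    (h : ∀ w, P.coeff w ∈ K) :
    ∃ P₀ : MvPolynomial (Fin r) K, MvPolynomial.map (algebraMap K ℂ) P₀ = P ∧
      P₀.IsHomogeneous d := by
  have h1 : P ∈ Set.range (MvPolynomial.map (σ := Fin r) (algebraMap K ℂ)) := by
    rw [MvPolynomial.mem_range_map_iff_coeffs_subset]
    intro x hx
    obtain ⟨w, -, rfl⟩ := MvPolynomial.mem_coeffs_iff.1 hx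
    exact ⟨⟨_, h w⟩, rfl⟩
  obtain ⟨P₀, rfl⟩ := h1
  refine ⟨P₀, rfl, fun w hw => hP (d := w) ?_⟩
  rw [MvPolynomial.coeff_map]
  exact (map_ne_zero _).2 hw

end

theorem exists_numberField {r : ℕ} {a : Fin r → ℕ → ℂ} (hE : ∀ i, IsE (a i)) {α : ℂ}
    (hα : IsAlgebraic ℚ α) (hα0 : α ≠ 0) {P : MvPolynomial (Fin r) ℂ}
    (hP : ∀ w, IsAlgebraic ℚ (MvPolynomial.coeff w P)) :
    ∃ K : IntermediateField ℚ ℂ, FiniteDimensional ℚ K ∧ α ∈ K ∧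
      (∀ w, MvPolynomial.coeff w P ∈ K) ∧ ∀ i, DefinedOver K fun n => a i n * α ^ n := by
  classical
  choose s hs hsK using fun i => (hE i).exists_finset_definedOver hα hα0
  let S : Finset ℂ := insert α (P.coeffs ∪ Finset.univ.biUnion s)
  let K := IntermediateField.adjoin ℚ (S : Set ℂ)
  have hSK : ∀ x ∈ S, x ∈ K := fun x hx => IntermediateField.subset_adjoin ℚ _ hx
  have hS : ∀ x ∈ S, IsAlgebraic ℚ x := by
    intro x hx
    rcases Finset.mem_insert.1 hx with rfl | hx
    · exact hα
    rcases Finset.mem_union.1 hx with hx | hx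
    · obtain ⟨w, -, rfl⟩ := MvPolynomial.mem_coeffs_iff.1 hx
      exact hP w
    · obtain ⟨i, -, hi⟩ := Finset.mem_biUnion.1 hx
      exact hs i x hi
  refine ⟨K, IntermediateField.finiteDimensional_adjoin fun x hx => (hS x hx).isIntegral,
    hSK _ (Finset.mem_insert_self _ _), fun w => ?_, fun i => hsK i K fun x hx => ?_⟩
  · by_cases hw : P.coeff w = 0
    · rw [hw]; exact zero_mem _
    · exact hSK _ (Finset.mem_insert_of_mem (Finset.mem_union_left _
        (MvPolynomial.coeff_mem_coeffs _ hw)))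
  · exact hSK _ (Finset.mem_insert_of_mem (Finset.mem_union_right _
      (Finset.mem_biUnion.2 ⟨i, Finset.mem_univ _, hx⟩)))

theorem rescale_inv_rescale {α : ℂ} (hα : α ≠ 0) (f : PowerSeries ℂ) :
    rescale α⁻¹ (rescale α f) = f := by
  rw [rescale_rescale, mul_inv_cancel₀ hα, rescale_one]
  rfl

/-- Every homogeneous algebraic relation over `ℚ̄` among the values of
E-functions `f₁, …, f_r` at a nonzero algebraic point `α` is the degeneration at `α` of a
homogeneous `δ`-algebraic relation `Q ∈ ℚ̄[z, X_{i,j}]` among `f₁, …, f_r`: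
`Q(z, (f_i^{(j)}(z))) = 0` identically and `Q(α, X) = P(X_{1,0}, …, X_{r,0})`. -/
theorem E_relations_are_degenerations
    (r : ℕ) (a : Fin r → ℕ → ℂ) (hE : ∀ i, IsE (a i))
    (α : ℂ) (hαalg : IsAlgebraic ℚ α) (hα0 : α ≠ 0)
    (P : MvPolynomial (Fin r) ℂ)
    (hPalg : ∀ w, IsAlgebraic ℚ (MvPolynomial.coeff w P))
    (d : ℕ) (hPhom : P.IsHomogeneous d)
    (hval : MvPolynomial.eval (fun i => evalE (a i) α) P = 0) :
    ∃ m : Fin r → ℕ, (∀ i, 1 ≤ m i) ∧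
      ∃ Q : MvPolynomial (Fin r × ℕ) (Polynomial ℂ),
        (∀ w k, IsAlgebraic ℚ ((MvPolynomial.coeff w Q).coeff k)) ∧
        (∀ v ∈ Q.vars, v.2 < m v.1) ∧
        (∃ e, Q.IsHomogeneous e) ∧
        MvPolynomial.eval₂ polyPS (fun v => psD^[v.2] (ePS (a v.1))) Q = 0 ∧
        MvPolynomial.map (Polynomial.evalRingHom α) Q
          = MvPolynomial.rename (fun i => (i, 0)) P := by
  obtain ⟨K, hfin, hαK, hPK, hdef⟩ := exists_numberField hE hαalg hα0 hPalg
  obtain ⟨P₀, rfl, hP₀⟩ := exists_lift_mvPolynomial hPhom hPK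
  have hF : ∀ i, ePS (fun n => a i n * α ^ n) ∈ entireSpan K := fun i =>
    (hdef i).mem_entireSpan (HasSize.mul_pow (hE i).2.2 (hE i).1 hαalg)
  let G := MvPolynomial.eval₂ ((C (R := ℂ)).comp (algebraMap K ℂ)) (fun i => ePS (a i)) P₀
  have hG : rescale α G = MvPolynomial.eval₂ ((C (R := ℂ)).comp (algebraMap K ℂ))
      (fun i => ePS fun n => a i n * α ^ n) P₀ := by
    simp only [ePS_mul_pow]
    exact rescale_eval₂ α _ P₀
  have hGmem : rescale α G ∈ entireSpan K := hG ▸ eval₂_mem_entireSpan hF P₀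
  have hG0 : psEval (rescale α G) 1 = 0 := by
    rw [hG, psEval_eval₂ hF, ← hval, MvPolynomial.eval_map]
    simp only [psEval_ePS_mul_pow]
  obtain ⟨n, c, hc⟩ := exists_sum_derivative_of_psEval_eq_zero hGmem hG0
  let β : K := ⟨α, hαK⟩
  let t : Polynomial K := Polynomial.C β⁻¹ * Polynomial.X
  have hβ : algebraMap K ℂ β = α := rfl
  have ht : t.map (algebraMap K ℂ) = Polynomial.C α⁻¹ * Polynomial.X := by
    rw [Polynomial.map_mul, Polynomial.map_C, Polynomial.map_X, map_inv₀, hβ]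
  have hrel : G = (((Polynomial.X - 1 : Polynomial K).comp t).map (algebraMap K ℂ) :
      PowerSeries ℂ) * ∑ k ∈ Finset.range n,
        (((Polynomial.C (β ^ k) * (c k).comp t : Polynomial K)).map (algebraMap K ℂ) :
          PowerSeries ℂ) * (d⁄dX ℂ)^[k] G := by
    have h := congrArg (rescale α⁻¹) hc
    rw [rescale_inv_rescale hα0, map_mul, map_sum, rescale_polynomial] at h
    refine h.trans ?_
    rw [Polynomial.map_comp, ht, Polynomial.map_sub, Polynomial.map_X, Polynomial.map_one]
    congr 1
    refine Finset.sum_congr rfl fun k _ => ?_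
    rw [iterate_derivative_rescale, map_mul, map_mul, rescale_polynomial,
      rescale_inv_rescale hα0, rescale_constant, Polynomial.map_mul, Polynomial.map_C, map_pow (algebraMap K ℂ), hβ,
      Polynomial.map_comp, ht, Polynomial.coe_mul, Polynomial.coe_C]
    ring
  have hl : (((Polynomial.X - 1 : Polynomial K).comp t).map (algebraMap K ℂ)).eval α = 0 := by
    rw [Polynomial.map_comp, ht]
    simp [hα0]
  obtain ⟨Q, hQalg, hQhom, hQ0, hQα⟩ := exists_degeneration (fun i => ePS (a i)) hP₀ hl rfl hrel
  refine ⟨fun _ => Q.vars.sup Prod.snd + 1, fun _ => Nat.le_add_left _ _, Q, hQalg,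
    fun v hv => Nat.lt_succ_of_le (Finset.le_sup hv), ⟨d, hQhom⟩, ?_, hQα⟩
  rw [psD_eq_derivative]
  exact hQ0
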